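/- Let p be an odd prime, t ≥ 1 an integer, q = p^t, and m ≥ 2. Then rank_p(A^m_{1,m}(p^t)) = 1 + Σ_s Π_{j=0}^{t−1} d_{(s_j, s_{j+1})}, where the sum is over all functions s : {0,…,t−1} → {1,…,m} and the index j+1 is read modulo t (so s_t = s_0). -/

import Mathlib

open scoped Classical

noncomputable section

/-- The `2m`-dimensional standard symplectic space over `F_q = GaloisField p t`:
pairs `(x, y)` of `m`-tuples. -/
abbrev SympV (p t m : ℕ) [Fact p.Prime] : Type :=
  (Fin m → GaloisField p t) × (Fin m → GaloisField p t)

/-- The nonsingular alternating bilinear form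
`⟨(x,y),(x',y')⟩ = Σ_i (x_i y'_i − y_i x'_i)`. -/
def sform {p t m : ℕ} [Fact p.Prime] (v w : SympV p t m) : GaloisField p t :=
  ∑ i, (v.1 i * w.2 i - v.2 i * w.1 i)

/-- A subspace is totally isotropic if the form vanishes identically on it. -/
def IsTotIso {p t m : ℕ} [Fact p.Prime]
    (W : Submodule (GaloisField p t) (SympV p t m)) : Prop :=
  ∀ u ∈ W, ∀ w ∈ W, sform u w = 0

instance {p t m : ℕ} [Fact p.Prime] :
    Finite (Submodule (GaloisField p t) (SympV p t m)) :=
  Finite.of_injective (fun W => (W : Set (SympV p t m))) SetLike.coe_injective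

/-- Row index type: totally isotropic `r`-dimensional subspaces. -/
abbrev IsoFlats (p t m r : ℕ) [Fact p.Prime] : Type :=
  {W : Submodule (GaloisField p t) (SympV p t m) //
    IsTotIso W ∧ Module.finrank (GaloisField p t) W = r}

/-- Column index type: `1`-dimensional subspaces (points). -/
abbrev Pts (p t m : ℕ) [Fact p.Prime] : Type :=
  {Z : Submodule (GaloisField p t) (SympV p t m) //
    Module.finrank (GaloisField p t) Z = 1}

noncomputable instance (p t m r : ℕ) [Fact p.Prime] : Fintype (IsoFlats p t m r) :=
  Fintype.ofFinite _

noncomputable instance (p t m : ℕ) [Fact p.Prime] : Fintype (Pts p t m) :=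
  Fintype.ofFinite _

/-- The incidence matrix `A^m_{1,r}(p^t)` over `F_p` between totally isotropic
`r`-dimensional subspaces and points: entry `1` if the point lies in the flat. -/
def incMat (p t m r : ℕ) [Fact p.Prime] :
    Matrix (IsoFlats p t m r) (Pts p t m) (ZMod p) :=
  fun W Z => if Z.val ≤ W.val then 1 else 0


/-- `d_λ`: the number of tuples `c ∈ {0,…,p−1}^{2m}` with `Σ_i c_i = λ`
(`λ` an integer, the count being `0` for negative `λ`). -/
def dlam (p m : ℕ) (lam : ℤ) : ℕ :=
  (Finset.univ.filter (fun c : Fin (2 * m) → Fin p => (∑ i, (c i : ℤ)) = lam)).card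

/-- `d_{(a,b)}` for `1 ≤ a,b ≤ m`: equal to `(d_{m(p−1)} + p^m)/2` if `a = b = m`,
and to `d_{pb−a}` otherwise. -/
def dpair (p m a b : ℕ) : ℚ :=
  if a = m ∧ b = m then ((dlam p m (m * (p - 1)) : ℚ) + (p : ℚ) ^ m) / 2
  else (dlam p m ((p : ℤ) * b - a) : ℚ)

/-! ### Part 1 : power sums and the extraction lemma -/
namespace PR
set_option linter.unusedVariables false
set_option linter.unusedSectionVars false

section core
variable {K : Type*} [Field K] [Fintype K]

lemma sum_pow_pos (i : ℕ) (hi : 0 < i) :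
    ∑ x : K, x ^ i = if (Fintype.card K - 1) ∣ i then -1 else 0 := by
  rw [← FiniteField.sum_pow_units K i]
  symm
  refine Finset.sum_bij_ne_zero (fun (u : Kˣ) _ _ => (u : K)) (by simp) ?_ ?_ ?_
  · intro a _ _ b _ _ h
    exact Units.ext h
  · intro b _ hb
    have : b ≠ 0 := by
      rintro rfl
      exact hb (zero_pow hi.ne')
    exact ⟨Units.mk0 b this, by simp, by simpa using hb, rfl⟩
  · intro a _ _
    rfl

lemma digit_inj {p t : ℕ} (hp : 0 < p) (f g : Fin t → ℕ) (hf : ∀ j, f j < p) (hg : ∀ j, g j < p)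
    (h : ∑ j, f j * p ^ (j : ℕ) = ∑ j, g j * p ^ (j : ℕ)) : f = g := by
  have := (finFunctionFinEquiv (m := p) (n := t)).injective
    (a₁ := fun j => ⟨f j, hf j⟩) (a₂ := fun j => ⟨g j, hg j⟩) (by
      apply Fin.ext
      rw [finFunctionFinEquiv_apply, finFunctionFinEquiv_apply]
      exact h)
  funext j
  have := congrFun this j
  simpa using this

lemma digit_lt {p t : ℕ} (hp : 0 < p) (f : Fin t → ℕ) (hf : ∀ j, f j < p) :
    ∑ j, f j * p ^ (j : ℕ) < p ^ t := by
  have := (finFunctionFinEquiv (m := p) (n := t) (fun j => ⟨f j, hf j⟩)).2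
  rw [finFunctionFinEquiv_apply] at this
  exact this

variable {p t : ℕ} [hp : Fact p.Prime] [CharP K p]

lemma power_sum_digits (hK : Fintype.card K = p ^ t) (hp3 : 3 ≤ p) (j0 : Fin t)
    (f : Fin t → ℕ) (hf : ∀ j, f j < p) :
    ∑ x : K, x ^ (p ^ t - 1 - p ^ (j0 : ℕ) + ∑ j, f j * p ^ (j : ℕ)) =
      if f = Pi.single j0 1 then -1 else 0 := by
  have hp0 : 0 < p := by omega
  have hj : p ^ (j0 : ℕ) * 3 ≤ p ^ t := by
    calc p ^ (j0 : ℕ) * 3 ≤ p ^ (j0 : ℕ) * p := by gcongr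
      _ = p ^ ((j0 : ℕ) + 1) := by ring
      _ ≤ p ^ t := Nat.pow_le_pow_right hp0 j0.2
  have hj1 : 1 ≤ p ^ (j0 : ℕ) := Nat.one_le_pow _ _ hp0
  have hlt := digit_lt hp0 f hf
  have hs : ∑ j, (Pi.single j0 1 : Fin t → ℕ) j * p ^ (j : ℕ) = p ^ (j0 : ℕ) := by
    rw [Finset.sum_eq_single j0]
    · simp
    · intro b _ hb; simp [Pi.single_eq_of_ne hb]
    · simp
  rw [sum_pow_pos _ (by omega), hK]
  congr 1
  apply propext
  constructor
  · rintro ⟨c, hc⟩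
    have hc1 : c = 1 := by
      have h0 : c ≠ 0 := by rintro rfl; omega
      by_contra hne
      have : 2 ≤ c := by omega
      have : (p ^ t - 1) * 2 ≤ (p ^ t - 1) * c := Nat.mul_le_mul_left _ this
      omega
    subst hc1
    apply digit_inj hp0 f _ hf
    · intro j
      by_cases h : j = j0
      · subst h; simp; omega
      · simp [Pi.single_eq_of_ne h]; omega
    · rw [hs]; omega
  · rintro rfl
    rw [hs]
    exact ⟨1, by omega⟩

variable {A : Type*} [CommRing A] [Algebra K A]

open Polynomial in
lemma core_extract (hK : Fintype.card K = p ^ t) (hp3 : 3 ≤ p) (j0 : Fin t) [CharP A p]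
    (P : Fin t → A[X]) (N : Submodule K A)
    (hN : ∀ f : Fin t → ℕ, (∃ j, p ≤ f j) → ∏ j, ((P j).coeff (f j)) ^ p ^ (j : ℕ) ∈ N) :
    (∑ x : K, x ^ (p ^ t - 1 - p ^ (j0 : ℕ)) •
      ∏ j, ((P j).eval (algebraMap K A x)) ^ p ^ (j : ℕ)) +
      ∏ j, ((P j).coeff (if j = j0 then 1 else 0)) ^ p ^ (j : ℕ) ∈ N := by
  obtain ⟨D, hD, hpD⟩ : ∃ D, (∀ j, (P j).natDegree < D) ∧ p ≤ D := by
    refine ⟨max p (Finset.univ.sup (fun j => (P j).natDegree) + 1), fun j => ?_, le_max_left _ _⟩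
    have := Finset.le_sup (f := fun j => (P j).natDegree) (Finset.mem_univ j)
    omega
  have h1 : ∀ x : K, ∏ j, ((P j).eval (algebraMap K A x)) ^ p ^ (j : ℕ) =
      ∑ f ∈ Fintype.piFinset (fun _ : Fin t => Finset.range D),
        x ^ (∑ j, f j * p ^ (j : ℕ)) • ∏ j, ((P j).coeff (f j)) ^ p ^ (j : ℕ) := by
    intro x
    have : ∀ j, ((P j).eval (algebraMap K A x)) ^ p ^ (j : ℕ) =
        ∑ n ∈ Finset.range D, (((P j).coeff n) ^ p ^ (j : ℕ) *
          algebraMap K A (x ^ (n * p ^ (j : ℕ)))) := by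
      intro j
      rw [eval_eq_sum_range' (hD j), sum_pow_char_pow]
      refine Finset.sum_congr rfl fun n _ => ?_
      rw [mul_pow, map_pow, pow_mul]
    simp_rw [this]
    rw [Finset.prod_univ_sum]
    refine Finset.sum_congr rfl fun f _ => ?_
    rw [Finset.prod_mul_distrib, ← map_prod, Finset.prod_pow_eq_pow_sum, Algebra.smul_def, mul_comm]
  have h2 : (∑ x : K, x ^ (p ^ t - 1 - p ^ (j0 : ℕ)) •
      ∏ j, ((P j).eval (algebraMap K A x)) ^ p ^ (j : ℕ)) =
      ∑ f ∈ Fintype.piFinset (fun _ : Fin t => Finset.range D),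
        (∑ x : K, x ^ (p ^ t - 1 - p ^ (j0 : ℕ) + ∑ j, f j * p ^ (j : ℕ))) •
          ∏ j, ((P j).coeff (f j)) ^ p ^ (j : ℕ) := by
    simp_rw [h1, Finset.smul_sum, Finset.sum_smul, pow_add, mul_smul]
    rw [Finset.sum_comm]
  have hmem : (Pi.single j0 1 : Fin t → ℕ) ∈ Fintype.piFinset (fun _ : Fin t => Finset.range D) := by
    rw [Fintype.mem_piFinset]
    intro j
    rw [Finset.mem_range]
    by_cases h : j = j0
    · subst h; simp; omega
    · simp [Pi.single_eq_of_ne h]; omega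
  have h3 : ∏ j, ((P j).coeff (if j = j0 then 1 else 0)) ^ p ^ (j : ℕ) =
      ∏ j, ((P j).coeff ((Pi.single j0 1 : Fin t → ℕ) j)) ^ p ^ (j : ℕ) := by
    refine Finset.prod_congr rfl fun j _ => ?_
    by_cases h : j = j0
    · subst h; simp
    · simp [h]
  rw [h2, h3, ← Finset.add_sum_erase _ _ hmem, power_sum_digits hK hp3]
  · rw [if_pos rfl, neg_smul, one_smul, add_right_comm, neg_add_cancel, zero_add]
    refine Submodule.sum_mem _ fun f hf => ?_
    by_cases h : ∃ j, p ≤ f j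
    · exact N.smul_mem _ (hN f h)
    · push Not at h
      rw [power_sum_digits hK hp3 j0 f h, if_neg (Finset.ne_of_mem_erase hf), zero_smul]
      exact N.zero_mem
  · intro j
    by_cases h : j = j0
    · subst h; simp; omega
    · simp [Pi.single_eq_of_ne h]; omega

end core
end PR

/-! ### Part 2 : functions on the symplectic space, filtration, invariance -/
namespace PR
set_option linter.unusedVariables false
set_option linter.unusedSectionVars false

abbrev VV (K : Type*) (m : ℕ) := (Fin m → K) × (Fin m → K)
abbrev RR (K : Type*) (m : ℕ) := VV K m → K

section defs
variable {K : Type*} [Field K] {m : ℕ}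

/-- coordinate functions -/
def Xc (i : Fin m) : RR K m := fun w => w.1 i
def Yc (i : Fin m) : RR K m := fun w => w.2 i

def sf (v w : VV K m) : K := ∑ i, (v.1 i * w.2 i - v.2 i * w.1 i)

def IsLag (W : Submodule K (VV K m)) : Prop :=
  (∀ u ∈ W, ∀ w ∈ W, sf u w = 0) ∧ Module.finrank K W = m

def chi (W : Submodule K (VV K m)) : RR K m := fun v => if v ∈ W then 1 else 0

variable (K m) in
def UU : Submodule K (RR K m) := Submodule.span K {f | ∃ W, IsLag W ∧ f = chi W}

/-- precomposition -/
def cmp (g : VV K m →ₗ[K] VV K m) : RR K m →ₐ[K] RR K m where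
  toFun f := fun v => f (g v)
  map_one' := rfl
  map_mul' _ _ := rfl
  map_zero' := rfl
  map_add' _ _ := rfl
  commutes' _ := rfl

@[simp] lemma cmp_apply (g : VV K m →ₗ[K] VV K m) (f : RR K m) (v : VV K m) :
    cmp g f v = f (g v) := rfl

def IsIsom (g : VV K m →ₗ[K] VV K m) : Prop := ∀ u w, sf (g u) (g w) = sf u w

lemma sf_single_right_y (v : VV K m) (i : Fin m) : sf v (0, Pi.single i 1) = v.1 i := by
  simp [sf, Pi.single_apply]

lemma sf_single_right_x (v : VV K m) (i : Fin m) : sf v (Pi.single i 1, 0) = - v.2 i := by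
  simp [sf, Pi.single_apply]

lemma sf_zero_left (w : VV K m) : sf 0 w = 0 := by simp [sf]

lemma IsIsom.injective {g : VV K m →ₗ[K] VV K m} (h : IsIsom g) : Function.Injective g := by
  rw [← LinearMap.ker_eq_bot, LinearMap.ker_eq_bot']
  intro v hv
  have h1 : ∀ w, sf v w = 0 := fun w => by rw [← h, hv, sf_zero_left]
  ext i
  · simpa [sf_single_right_y] using h1 (0, Pi.single i 1)
  · simpa [sf_single_right_x] using h1 (Pi.single i 1, 0)

lemma IsIsom.lag_comap {g : VV K m →ₗ[K] VV K m} (h : IsIsom g) {W : Submodule K (VV K m)}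
    (hW : IsLag W) : IsLag (W.comap g) := by
  refine ⟨fun u hu w hw => ?_, ?_⟩
  · rw [← h]
    exact hW.1 _ hu _ hw
  · have e := LinearEquiv.ofInjectiveEndo g h.injective
    have h2 : W.comap g = W.comap (LinearEquiv.ofInjectiveEndo g h.injective :
        VV K m →ₗ[K] VV K m) := by
      ext v; rfl
    rw [h2, LinearEquiv.finrank_eq (LinearEquiv.ofSubmodule' _ _)]
    exact hW.2

lemma IsIsom.cmp_mem {g : VV K m →ₗ[K] VV K m} (h : IsIsom g) {f : RR K m} (hf : f ∈ UU K m) :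
    cmp g f ∈ UU K m := by
  have : UU K m ≤ (UU K m).comap (cmp g).toLinearMap := by
    rw [UU, Submodule.span_le]
    rintro _ ⟨W, hW, rfl⟩
    exact Submodule.subset_span ⟨W.comap g, h.lag_comap hW, rfl⟩
  exact this hf

variable (K m) in
/-- linear functions -/
def MM : Submodule K (RR K m) := Submodule.span K (Set.range Xc ∪ Set.range Yc)

lemma X_mem (i : Fin m) : (Xc i : RR K m) ∈ MM K m := Submodule.subset_span (Or.inl ⟨i, rfl⟩)
lemma Y_mem (i : Fin m) : (Yc i : RR K m) ∈ MM K m := Submodule.subset_span (Or.inr ⟨i, rfl⟩)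

lemma lin_mem (l : VV K m →ₗ[K] K) : (l : RR K m) ∈ MM K m := by
  have : (l : RR K m) = ∑ i, (l (Pi.single i 1, 0) • Xc i + l (0, Pi.single i 1) • Yc i) := by
    funext v
    have hv : v = ∑ i, (v.1 i • ((Pi.single i 1, 0) : VV K m) + v.2 i • (0, Pi.single i 1)) := by
      ext k
      · simp [Prod.fst_sum, Finset.sum_apply, Pi.single_apply]
      · simp [Prod.snd_sum, Finset.sum_apply, Pi.single_apply]
    conv_lhs => rw [hv]
    simp only [map_sum, map_add, map_smul, Finset.sum_apply, Pi.add_apply, Pi.smul_apply,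
      smul_eq_mul, Xc, Yc]
    exact Finset.sum_congr rfl fun i _ => by ring
  rw [this]
  exact Submodule.sum_mem _ fun i _ => Submodule.add_mem _ (Submodule.smul_mem _ _ (X_mem i))
    (Submodule.smul_mem _ _ (Y_mem i))

lemma cmp_MM (g : VV K m →ₗ[K] VV K m) {f : RR K m} (hf : f ∈ MM K m) : cmp g f ∈ MM K m := by
  have : MM K m ≤ (MM K m).comap (cmp g).toLinearMap := by
    conv_lhs => rw [MM]
    rw [Submodule.span_le]
    rintro _ (⟨i, rfl⟩ | ⟨i, rfl⟩)
    · exact lin_mem ((LinearMap.proj i ∘ₗ LinearMap.fst K _ _) ∘ₗ g)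
    · exact lin_mem ((LinearMap.proj i ∘ₗ LinearMap.snd K _ _) ∘ₗ g)
  exact this hf

/-- monomial at a single digit -/
def mo (a b : Fin m → ℕ) : RR K m := ∏ i, (Xc i ^ a i * Yc i ^ b i)

lemma mo_mem (a b : Fin m → ℕ) : (mo a b : RR K m) ∈ MM K m ^ (∑ i, (a i + b i)) := by
  unfold mo
  have : ∀ s : Finset (Fin m), (∏ i ∈ s, (Xc i ^ a i * Yc i ^ b i) : RR K m) ∈
      MM K m ^ (∑ i ∈ s, (a i + b i)) := by
    intro s
    induction s using Finset.induction_on with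
    | empty => simp
    | insert i s hi ih =>
      rw [Finset.prod_insert hi, Finset.sum_insert hi, pow_add, pow_add]
      exact Submodule.mul_mem_mul (Submodule.mul_mem_mul (Submodule.pow_mem_pow _ (X_mem i) _)
        (Submodule.pow_mem_pow _ (Y_mem i) _)) ih
  exact this _

end defs

section filt
variable {K : Type*} [Field K] {m : ℕ} {p : ℕ} [Fact p.Prime] [CharP K p]

variable (K m p) in
def LL : Submodule K (RR K m) := 1 ⊔ Submodule.span K {f | ∃ z ∈ MM K m, ∃ j : ℕ, f = z ^ p ^ j}

lemma one_le_LL : (1 : Submodule K (RR K m)) ≤ LL K m p := le_sup_left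

lemma frob_mem_LL {z : RR K m} (hz : z ∈ MM K m) (j : ℕ) : z ^ p ^ j ∈ LL K m p :=
  Submodule.mem_sup_right (Submodule.subset_span ⟨z, hz, j, rfl⟩)

instance : CharP (RR K m) p := by infer_instance

def Frs (j d : ℕ) : Submodule K (RR K m) where
  carrier := {f | f ^ p ^ j ∈ LL K m p ^ d}
  add_mem' := by
    intro a b ha hb
    simp only [Set.mem_ofPred_eq] at *
    rw [add_pow_char_pow]
    exact Submodule.add_mem _ ha hb
  zero_mem' := by
    have : p ^ j ≠ 0 := (pow_pos (Fact.out : p.Prime).pos j).ne'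
    simp [zero_pow this]
  smul_mem' := by
    intro c x hx
    simp only [Set.mem_ofPred_eq] at *
    rw [smul_pow]
    exact Submodule.smul_mem _ _ hx

lemma frob_mem_pow {d : ℕ} {f : RR K m} (hf : f ∈ MM K m ^ d) (j : ℕ) :
    f ^ p ^ j ∈ LL K m p ^ d := by
  suffices h : MM K m ^ d ≤ Frs (p := p) j d from h hf
  clear hf f
  induction d with
  | zero =>
    rw [pow_zero, Submodule.one_le]
    change (1 : RR K m) ^ p ^ j ∈ LL K m p ^ 0
    simp
  | succ d ih =>
    rw [pow_succ, Submodule.mul_le]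
    intro a ha b hb
    change (a * b) ^ p ^ j ∈ LL K m p ^ (d + 1)
    rw [mul_pow, pow_succ]
    exact Submodule.mul_mem_mul (ih ha) (frob_mem_LL hb j)

lemma LL_mono {a b : ℕ} (h : a ≤ b) : LL K m p ^ a ≤ LL K m p ^ b := by
  obtain ⟨c, rfl⟩ := Nat.exists_eq_add_of_le h
  rw [pow_add]
  calc LL K m p ^ a = LL K m p ^ a * 1 := by rw [mul_one]
    _ ≤ _ := by
      gcongr
      exact one_le_pow_of_one_le' one_le_LL c

variable (K m p) in
def NN : ℕ → Submodule K (RR K m)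
  | 0 => ⊥
  | (w + 1) => LL K m p ^ w

lemma NN_mono {a b : ℕ} (h : a ≤ b) : NN K m p a ≤ NN K m p b := by
  cases a with
  | zero => exact bot_le
  | succ a => cases b with
    | zero => omega
    | succ b => exact LL_mono (by omega)

lemma NN_mul {u v : ℕ} {f g : RR K m} (hf : f ∈ NN K m p (u + 1)) (hg : g ∈ NN K m p v) :
    f * g ∈ NN K m p (u + v) := by
  cases v with
  | zero =>
    have : g = 0 := by simpa [NN] using hg
    rw [this, mul_zero]; exact Submodule.zero_mem _
  | succ v =>
    change f * g ∈ LL K m p ^ (u + v)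
    rw [pow_add]
    exact Submodule.mul_mem_mul hf hg

lemma NN_prod {ι : Type*} (s : Finset ι) (f : ι → RR K m) (w : ι → ℕ)
    (h : ∀ i ∈ s, f i ∈ NN K m p (w i + 1)) : ∏ i ∈ s, f i ∈ NN K m p (∑ i ∈ s, w i + 1) := by
  induction s using Finset.induction_on with
  | empty => simp [NN]
  | insert i s hi ih =>
    rw [Finset.prod_insert hi, Finset.sum_insert hi, add_assoc]
    exact NN_mul (h i (Finset.mem_insert_self _ _))
      (ih fun k hk => h k (Finset.mem_insert_of_mem hk))

lemma NN_prod_lt {ι : Type*} (s : Finset ι) (f : ι → RR K m) (w : ι → ℕ)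
    (h : ∀ i ∈ s, f i ∈ NN K m p (w i + 1)) (k : ι) (hk : k ∈ s) (hlt : f k ∈ NN K m p (w k)) :
    ∏ i ∈ s, f i ∈ NN K m p (∑ i ∈ s, w i) := by
  rw [← Finset.mul_prod_erase s f hk, ← Finset.add_sum_erase s w hk, mul_comm, add_comm]
  exact NN_mul (NN_prod _ f w fun i hi => h i (Finset.mem_of_mem_erase hi)) hlt

lemma cmp_LL (g : VV K m →ₗ[K] VV K m) {f : RR K m} (hf : f ∈ LL K m p) : cmp g f ∈ LL K m p := by
  have : LL K m p ≤ (LL K m p).comap (cmp g).toLinearMap := by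
    conv_lhs => rw [LL]
    refine sup_le ?_ ?_
    · rw [Submodule.one_le]
      change cmp g 1 ∈ LL K m p
      rw [map_one]
      exact Submodule.one_le.mp one_le_LL
    · rw [Submodule.span_le]
      rintro _ ⟨z, hz, j, rfl⟩
      change cmp g (z ^ p ^ j) ∈ LL K m p
      rw [map_pow]
      exact frob_mem_LL (cmp_MM g hz) j
  exact this hf

lemma cmp_NN (g : VV K m →ₗ[K] VV K m) {w : ℕ} {f : RR K m} (hf : f ∈ NN K m p w) :
    cmp g f ∈ NN K m p w := by
  cases w with
  | zero =>
    have : f = 0 := by simpa [NN] using hf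
    rw [this, map_zero]; exact Submodule.zero_mem _
  | succ w =>
    change cmp g f ∈ LL K m p ^ w
    change f ∈ LL K m p ^ w at hf
    have h1 : cmp g f ∈ (LL K m p ^ w).map (cmp g).toLinearMap := ⟨f, hf, rfl⟩
    rw [Submodule.map_pow] at h1
    refine (pow_le_pow_left' (?_ : _ ≤ LL K m p) w) h1
    rintro _ ⟨x, hx, rfl⟩
    exact cmp_LL g hx

end filt
end PR

/-! ### Part 3 : one-parameter families and the operators they induce -/
namespace PR
set_option linter.unusedVariables false
set_option linter.unusedSectionVars false
open Polynomial

section shears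
variable {K : Type*} [Field K] {m : ℕ}

def shx (B : Matrix (Fin m) (Fin m) K) : VV K m →ₗ[K] VV K m :=
  LinearMap.prod (LinearMap.fst K _ _ + B.mulVecLin ∘ₗ LinearMap.snd K _ _) (LinearMap.snd K _ _)

def shy (B : Matrix (Fin m) (Fin m) K) : VV K m →ₗ[K] VV K m :=
  LinearMap.prod (LinearMap.fst K _ _) (LinearMap.snd K _ _ + B.mulVecLin ∘ₗ LinearMap.fst K _ _)

lemma sf_eq (v w : VV K m) : sf v w = v.1 ⬝ᵥ w.2 - v.2 ⬝ᵥ w.1 := by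
  simp [sf, dotProduct, Finset.sum_sub_distrib]

lemma shx_isom {B : Matrix (Fin m) (Fin m) K} (hB : B.IsSymm) : IsIsom (shx B) := by
  rintro ⟨x, y⟩ ⟨x', y'⟩
  have e : ∀ a b, shx B (a, b) = (a + B.mulVec b, b) := fun a b => rfl
  rw [e, e]
  simp only [sf_eq, add_dotProduct, dotProduct_add]
  have : B.mulVec y ⬝ᵥ y' = y ⬝ᵥ B.mulVec y' := by
    rw [Matrix.dotProduct_mulVec, ← Matrix.mulVec_transpose, hB.eq]
  rw [this]; ring

lemma shy_isom {B : Matrix (Fin m) (Fin m) K} (hB : B.IsSymm) : IsIsom (shy B) := by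
  rintro ⟨x, y⟩ ⟨x', y'⟩
  have e : ∀ a b, shy B (a, b) = (a, b + B.mulVec a) := fun a b => rfl
  rw [e, e]
  simp only [sf_eq, add_dotProduct, dotProduct_add]
  have : B.mulVec x ⬝ᵥ x' = x ⬝ᵥ B.mulVec x' := by
    rw [Matrix.dotProduct_mulVec, ← Matrix.mulVec_transpose, hB.eq]
  rw [this]; ring

lemma cmp_shx_X (B : Matrix (Fin m) (Fin m) K) (k : Fin m) :
    cmp (shx B) (Xc k) = Xc k + ∑ l, B k l • Yc l := by
  funext v
  simp [shx, Xc, Yc, Matrix.mulVec, dotProduct]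

lemma cmp_shx_Y (B : Matrix (Fin m) (Fin m) K) (k : Fin m) :
    cmp (shx B) (Yc k) = Yc k := by
  funext v
  simp [shx, Yc]

lemma cmp_shy_Y (B : Matrix (Fin m) (Fin m) K) (k : Fin m) :
    cmp (shy B) (Yc k) = Yc k + ∑ l, B k l • Xc l := by
  funext v
  simp [shy, Xc, Yc, Matrix.mulVec, dotProduct]

lemma cmp_shy_X (B : Matrix (Fin m) (Fin m) K) (k : Fin m) :
    cmp (shy B) (Xc k) = Xc k := by
  funext v
  simp [shy, Xc]

/-- partial swap -/
def swp (J : Finset (Fin m)) : VV K m →ₗ[K] VV K m where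
  toFun w := (fun i => if i ∈ J then w.2 i else w.1 i, fun i => if i ∈ J then - w.1 i else w.2 i)
  map_add' := by
    intro a b
    ext i
    · by_cases h : i ∈ J <;> simp [h]
    · by_cases h : i ∈ J <;> simp [h]; ring
  map_smul' := by
    intro c a
    ext i
    · by_cases h : i ∈ J <;> simp [h]
    · by_cases h : i ∈ J <;> simp [h]

lemma swp_isom (J : Finset (Fin m)) : IsIsom (swp (K := K) J) := by
  rintro v w
  simp only [sf, swp, LinearMap.coe_mk, AddHom.coe_mk]
  refine Finset.sum_congr rfl fun i _ => ?_
  by_cases h : i ∈ J <;> simp [h]; ring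

lemma cmp_swp_X (J : Finset (Fin m)) (k : Fin m) :
    cmp (swp (K := K) J) (Xc k) = if k ∈ J then Yc k else Xc k := by
  funext v
  by_cases h : k ∈ J <;> simp [swp, Xc, Yc, h]

lemma cmp_swp_Y (J : Finset (Fin m)) (k : Fin m) :
    cmp (swp (K := K) J) (Yc k) = if k ∈ J then - Xc k else Yc k := by
  funext v
  by_cases h : k ∈ J <;> simp [swp, Xc, Yc, h]

end shears

section polys
variable {K : Type*} [Field K] {m : ℕ}

/-- the lift of a monomial along `X_k ↦ X_k + T u_k`, `Y_k ↦ Y_k + T v_k` -/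
def Pmo (u v : Fin m → RR K m) (a b : Fin m → ℕ) : (RR K m)[X] :=
  ∏ k, ((C (Xc k) + X * C (u k)) ^ a k * (C (Yc k) + X * C (v k)) ^ b k)

lemma Pmo_eval (u v : Fin m → RR K m) (a b : Fin m → ℕ) (g : VV K m →ₗ[K] VV K m) (x : K)
    (hX : ∀ k, cmp g (Xc k) = Xc k + x • u k) (hY : ∀ k, cmp g (Yc k) = Yc k + x • v k) :
    cmp g (mo a b) = (Pmo u v a b).eval (algebraMap K (RR K m) x) := by
  simp only [mo, Pmo, map_prod, map_mul, map_pow, hX, hY, eval_prod, eval_mul, eval_pow, eval_add,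
    eval_C, eval_X, Algebra.smul_def]

lemma Pmo_coeff_zero (u v : Fin m → RR K m) (a b : Fin m → ℕ) :
    (Pmo u v a b).coeff 0 = mo a b := by
  rw [coeff_zero_eq_eval_zero]
  simp [mo, Pmo, eval_prod]

lemma Pmo_coeff_one (u v : Fin m → RR K m) (a b : Fin m → ℕ) :
    (Pmo u v a b).coeff 1 = ∑ k, (∏ i ∈ Finset.univ.erase k, (Xc i ^ a i * Yc i ^ b i)) *
      ((a k : RR K m) * Xc k ^ (a k - 1) * u k * Yc k ^ b k +
        Xc k ^ a k * ((b k : RR K m) * Yc k ^ (b k - 1) * v k)) := by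
  have h : (Pmo u v a b).coeff 1 = (derivative (Pmo u v a b)).eval 0 := by
    rw [← coeff_zero_eq_eval_zero, coeff_derivative]; simp
  rw [h, Pmo, derivative_prod_finset, eval_finset_sum]
  refine Finset.sum_congr rfl fun k _ => ?_
  simp [eval_prod, derivative_pow, derivative_mul]

lemma mo_erase (a b : Fin m → ℕ) (k : Fin m) : (mo a b : RR K m) =
    (∏ i ∈ Finset.univ.erase k, (Xc i ^ a i * Yc i ^ b i)) * (Xc k ^ a k * Yc k ^ b k) := by
  rw [mo, ← Finset.prod_erase_mul _ _ (Finset.mem_univ k)]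

lemma mo_mul (a b a' b' : Fin m → ℕ) : (mo a b * mo a' b' : RR K m) = mo (a + a') (b + b') := by
  rw [mo, mo, mo, ← Finset.prod_mul_distrib]
  refine Finset.prod_congr rfl fun i _ => ?_
  simp only [Pi.add_apply, pow_add]; ring

lemma mo_single_x (k : Fin m) (n : ℕ) : (mo (Pi.single k n) 0 : RR K m) = Xc k ^ n := by
  rw [mo, Finset.prod_eq_single k]
  · simp
  · intro b _ hb; simp [Pi.single_eq_of_ne hb]
  · simp

lemma mo_single_y (k : Fin m) (n : ℕ) : (mo 0 (Pi.single k n) : RR K m) = Yc k ^ n := by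
  rw [mo, Finset.prod_eq_single k]
  · simp
  · intro b _ hb; simp [Pi.single_eq_of_ne hb]
  · simp

lemma mo_sub_x (a b : Fin m → ℕ) (k : Fin m) : (mo (a - Pi.single k 1) b : RR K m) =
    (∏ i ∈ Finset.univ.erase k, (Xc i ^ a i * Yc i ^ b i)) * (Xc k ^ (a k - 1) * Yc k ^ b k) := by
  rw [mo_erase _ _ k]
  congr 1
  · refine Finset.prod_congr rfl fun i hi => ?_
    simp [Pi.single_eq_of_ne (Finset.ne_of_mem_erase hi)]
  · simp

lemma mo_sub_y (a b : Fin m → ℕ) (k : Fin m) : (mo a (b - Pi.single k 1) : RR K m) =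
    (∏ i ∈ Finset.univ.erase k, (Xc i ^ a i * Yc i ^ b i)) * (Xc k ^ a k * Yc k ^ (b k - 1)) := by
  rw [mo_erase _ _ k]
  congr 1
  · refine Finset.prod_congr rfl fun i hi => ?_
    simp [Pi.single_eq_of_ne (Finset.ne_of_mem_erase hi)]
  · simp

lemma Pmo_coeff_one' (u v : Fin m → RR K m) (a b : Fin m → ℕ) :
    (Pmo u v a b).coeff 1 = ∑ k, ((a k : K) • (mo (a - Pi.single k 1) b * u k) +
      (b k : K) • (mo a (b - Pi.single k 1) * v k)) := by
  rw [Pmo_coeff_one]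
  refine Finset.sum_congr rfl fun k _ => ?_
  rw [mo_sub_x, mo_sub_y, Algebra.smul_def, Algebra.smul_def, map_natCast, map_natCast]
  ring

/-- graded pieces of lifts -/
def HH (Lam : RR K m) (lam n : ℕ) : Submodule K (RR K m) :=
  if n ≤ lam then Submodule.span K {Lam ^ n} * MM K m ^ (lam - n) else ⊥

lemma HH_mul {Lam : RR K m} {a b n k : ℕ} {f g : RR K m} (hf : f ∈ HH Lam a n)
    (hg : g ∈ HH Lam b k) : f * g ∈ HH Lam (a + b) (n + k) := by
  unfold HH at *
  split_ifs at hf hg with h1 h2 h3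
  · rw [if_pos (by omega)]
    have h4 : Submodule.span K {Lam ^ (n + k)} * MM K m ^ (a + b - (n + k)) =
      (Submodule.span K {Lam ^ n} * MM K m ^ (a - n)) *
        (Submodule.span K {Lam ^ k} * MM K m ^ (b - k)) := by
      rw [show a + b - (n + k) = (a - n) + (b - k) by omega, pow_add, pow_add,
        ← Set.singleton_mul_singleton, ← Submodule.span_mul_span]
      ac_rfl
    rw [h4]
    exact Submodule.mul_mem_mul hf hg
  · rw [(Submodule.mem_bot K).1 hg, mul_zero]; exact Submodule.zero_mem _
  · rw [(Submodule.mem_bot K).1 hf, zero_mul]; exact Submodule.zero_mem _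
  · rw [(Submodule.mem_bot K).1 hf, zero_mul]; exact Submodule.zero_mem _

def QQ (Lam : RR K m) (lam : ℕ) (P : (RR K m)[X]) : Prop := ∀ n, P.coeff n ∈ HH Lam lam n

lemma QQ.mul {Lam : RR K m} {a b : ℕ} {P Q : (RR K m)[X]} (hP : QQ Lam a P) (hQ : QQ Lam b Q) :
    QQ Lam (a + b) (P * Q) := by
  intro n
  rw [coeff_mul]
  refine Submodule.sum_mem _ fun x hx => ?_
  rw [← (Finset.HasAntidiagonal.mem_antidiagonal).1 hx]
  exact HH_mul (hP _) (hQ _)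

lemma QQ.one {Lam : RR K m} : QQ Lam 0 1 := by
  intro n
  rw [coeff_one]
  split_ifs with h
  · subst h
    have : (1 : RR K m) ∈ (1 : Submodule K (RR K m)) := Submodule.one_le.1 le_rfl
    simpa [HH, ← Submodule.one_eq_span] using this
  · exact Submodule.zero_mem _

lemma QQ.pow {Lam : RR K m} {P : (RR K m)[X]} (hP : QQ Lam 1 P) (n : ℕ) : QQ Lam n (P ^ n) := by
  induction n with
  | zero => simpa using QQ.one
  | succ n ih => rw [pow_succ]; exact ih.mul hP

lemma QQ.add {Lam : RR K m} {a : ℕ} {P Q : (RR K m)[X]} (hP : QQ Lam a P) (hQ : QQ Lam a Q) :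
    QQ Lam a (P + Q) := by
  intro n; rw [coeff_add]; exact Submodule.add_mem _ (hP n) (hQ n)

lemma QQ.smul {Lam : RR K m} {a : ℕ} {P : (RR K m)[X]} (c : K) (hP : QQ Lam a P) :
    QQ Lam a (c • P) := by
  intro n; rw [coeff_smul]; exact Submodule.smul_mem _ _ (hP n)

lemma QQ.lin {Lam z : RR K m} (hz : z ∈ MM K m) (c : K) : QQ Lam 1 (C z + X * C (c • Lam)) := by
  intro n
  match n with
  | 0 =>
    simp only [coeff_add, coeff_C_zero, mul_coeff_zero, coeff_X_zero, zero_mul, add_zero]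
    simpa [HH, ← Submodule.one_eq_span] using hz
  | 1 =>
    simp only [coeff_add, coeff_X_mul, coeff_C_zero, coeff_C_succ, zero_add]
    simpa [HH] using Submodule.smul_mem _ _ (Submodule.mem_span_singleton_self Lam)
  | n + 2 =>
    simp [coeff_X_mul, coeff_C_succ]

lemma Pmo_QQ {Lam : RR K m} (u v : Fin m → RR K m) (hu : ∀ k, ∃ c : K, u k = c • Lam)
    (hv : ∀ k, ∃ c : K, v k = c • Lam) (a b : Fin m → ℕ) :
    QQ Lam (∑ i, (a i + b i)) (Pmo u v a b) := by
  unfold Pmo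
  have : ∀ s : Finset (Fin m), QQ Lam (∑ i ∈ s, (a i + b i)) (∏ k ∈ s,
      ((C (Xc k) + X * C (u k)) ^ a k * (C (Yc k) + X * C (v k)) ^ b k)) := by
    intro s
    induction s using Finset.induction_on with
    | empty => simpa using QQ.one
    | insert i s hi ih =>
      rw [Finset.prod_insert hi, Finset.sum_insert hi]
      obtain ⟨c, hc⟩ := hu i
      obtain ⟨d, hd⟩ := hv i
      rw [hc, hd]
      exact (((QQ.lin (X_mem i) c).pow _).mul ((QQ.lin (Y_mem i) d).pow _)).mul ih
  exact this _

end polys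

section ops
variable {K : Type*} [Field K] {m : ℕ} {p : ℕ} [Fact p.Prime] [CharP K p]

lemma HH_frob {Lam : RR K m} (hL : Lam ∈ MM K m) {lam n : ℕ} {f : RR K m} (hf : f ∈ HH Lam lam n)
    (j : ℕ) : f ^ p ^ j ∈ NN K m p (lam + 1) := by
  unfold HH at hf
  split_ifs at hf with h
  · apply frob_mem_pow
    have : MM K m ^ lam = MM K m ^ n * MM K m ^ (lam - n) := by
      rw [← pow_add]; congr 1; omega
    rw [this]
    refine (mul_le_mul' (?_ : _ ≤ MM K m ^ n) le_rfl) hf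
    rw [Submodule.span_singleton_le_iff_mem]
    exact Submodule.pow_mem_pow _ hL n
  · rw [(Submodule.mem_bot K).1 hf, zero_pow (pow_pos (Fact.out : p.Prime).pos j).ne']
    exact Submodule.zero_mem _

lemma HH_frob_lt {Lam : RR K m} (hL : Lam ∈ MM K m) {lam n : ℕ} {f : RR K m}
    (hf : f ∈ HH Lam lam n) (hn : p ≤ n) (j : ℕ) : f ^ p ^ j ∈ NN K m p lam := by
  unfold HH at hf
  have hp2 := (Fact.out : p.Prime).two_le
  split_ifs at hf with h
  · obtain ⟨g, hg, rfl⟩ := Submodule.mem_span_singleton_mul.1 hf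
    have : (Lam ^ n * g) ^ p ^ j = Lam ^ p ^ (j + 1) * ((Lam ^ (n - p)) * g) ^ p ^ j := by
      have : Lam ^ n = Lam ^ p * Lam ^ (n - p) := by rw [← pow_add]; congr 1; omega
      rw [this, mul_assoc, mul_pow, ← pow_mul, pow_succ']
    rw [this]
    have h1 : Lam ^ (n - p) * g ∈ MM K m ^ (lam - p) := by
      have : MM K m ^ (lam - p) = MM K m ^ (n - p) * MM K m ^ (lam - n) := by
        rw [← pow_add]; congr 1; omega
      rw [this]
      exact Submodule.mul_mem_mul (Submodule.pow_mem_pow _ hL _) hg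
    have h2 : Lam ^ p ^ (j + 1) * ((Lam ^ (n - p)) * g) ^ p ^ j ∈ NN K m p ((1 + (lam - p)) + 1) := by
      change _ ∈ LL K m p ^ (1 + (lam - p))
      rw [pow_add, pow_one]
      exact Submodule.mul_mem_mul (frob_mem_LL hL _) (frob_mem_pow h1 j)
    exact NN_mono (by omega) h2
  · rw [(Submodule.mem_bot K).1 hf, zero_pow (pow_pos (Fact.out : p.Prime).pos j).ne']
    exact Submodule.zero_mem _

variable [Fintype K] {t : ℕ}

lemma op_gen (hK : Fintype.card K = p ^ t) (hp3 : 3 ≤ p) (j0 : Fin t)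
    (G : Submodule K (RR K m)) (g : K → VV K m →ₗ[K] VV K m)
    (hG : ∀ x, ∀ f ∈ G, cmp (g x) f ∈ G)
    (φ : Fin t → RR K m) (P : Fin t → (RR K m)[X])
    (hφ : ∀ j x, cmp (g x) (φ j) = (P j).eval (algebraMap K _ x))
    (hN : ∀ f : Fin t → ℕ, (∃ j, p ≤ f j) → ∏ j, ((P j).coeff (f j)) ^ p ^ (j : ℕ) ∈ G)
    (h : ∏ j, φ j ^ p ^ (j : ℕ) ∈ G) :
    ∏ j, ((P j).coeff (if j = j0 then 1 else 0)) ^ p ^ (j : ℕ) ∈ G := by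
  have h1 := core_extract hK hp3 j0 P G hN
  refine (Submodule.add_mem_iff_right G ?_).1 h1
  refine Submodule.sum_mem _ fun x _ => Submodule.smul_mem _ _ ?_
  have := hG x _ h
  rw [map_prod] at this
  simpa only [map_pow, hφ] using this

/-- graded version -/
lemma op_graded (hK : Fintype.card K = p ^ t) (hp3 : 3 ≤ p) (j0 : Fin t)
    (g : K → VV K m →ₗ[K] VV K m) (hg : ∀ x, IsIsom (g x))
    (φ : Fin t → RR K m) (P : Fin t → (RR K m)[X])
    (hφ : ∀ j x, cmp (g x) (φ j) = (P j).eval (algebraMap K _ x))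
    (Lam : RR K m) (hL : Lam ∈ MM K m) (lam : Fin t → ℕ) (hQ : ∀ j, QQ Lam (lam j) (P j))
    (h : ∏ j, φ j ^ p ^ (j : ℕ) ∈ UU K m ⊔ NN K m p (∑ j, lam j)) :
    ∏ j, ((P j).coeff (if j = j0 then 1 else 0)) ^ p ^ (j : ℕ) ∈
      UU K m ⊔ NN K m p (∑ j, lam j) := by
  refine op_gen hK hp3 j0 _ g ?_ φ P hφ ?_ h
  · intro x f hf
    obtain ⟨y, hy, z, hz, rfl⟩ := Submodule.mem_sup.1 hf
    rw [map_add]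
    exact Submodule.add_mem_sup ((hg x).cmp_mem hy) (cmp_NN _ hz)
  · rintro f ⟨j, hj⟩
    refine Submodule.mem_sup_right ?_
    exact NN_prod_lt _ _ lam (fun i _ => HH_frob hL (hQ i _) i) j (Finset.mem_univ j)
      (HH_frob_lt hL (hQ j _) hj j)

end ops
end PR

/-! ### Part 4 : exact monomials in the code -/
namespace PR
set_option linter.unusedVariables false
set_option linter.unusedSectionVars false
open Polynomial

section base
variable {K : Type*} [Field K] [Fintype K] {m : ℕ}

def lineDir : Option K → K × K
  | none => (0, 1)
  | some c => (1, c)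

def onLine : Option K → K → K → Prop
  | none, x, y => x = 0
  | some c, x, y => y = c * x

lemma onLine_iff (o : Option K) (x y : K) :
    onLine o x y ↔ ∃ s : K, x = s * (lineDir o).1 ∧ y = s * (lineDir o).2 := by
  cases o with
  | none => simp [onLine, lineDir]
  | some c =>
    simp only [onLine, lineDir]
    constructor
    · intro h; exact ⟨x, by ring, by rw [h]; ring⟩
    · rintro ⟨s, rfl, rfl⟩; ring

def lineMap (f : Fin m → Option K) : (Fin m → K) →ₗ[K] VV K m where
  toFun s := (fun i => s i * (lineDir (f i)).1, fun i => s i * (lineDir (f i)).2)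
  map_add' := by intro a b; ext i <;> simp [add_mul]
  map_smul' := by intro c a; ext i <;> simp [mul_assoc]

lemma lineDir_ne (o : Option K) : (lineDir o).1 ≠ 0 ∨ (lineDir o).2 ≠ 0 := by
  cases o <;> simp [lineDir]

lemma lineMap_inj (f : Fin m → Option K) : Function.Injective (lineMap f) := by
  rw [← LinearMap.ker_eq_bot, LinearMap.ker_eq_bot']
  intro s hs
  funext i
  have h1 : s i * (lineDir (f i)).1 = 0 := congrFun (congrArg Prod.fst hs) i
  have h2 : s i * (lineDir (f i)).2 = 0 := congrFun (congrArg Prod.snd hs) i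
  rcases lineDir_ne (f i) with h | h
  · exact (mul_eq_zero.1 h1).resolve_right h
  · exact (mul_eq_zero.1 h2).resolve_right h

lemma lineMap_lag (f : Fin m → Option K) : IsLag (LinearMap.range (lineMap f)) := by
  constructor
  · rintro _ ⟨s, rfl⟩ _ ⟨s', rfl⟩
    refine Finset.sum_eq_zero fun i _ => ?_
    simp only [lineMap, LinearMap.coe_mk, AddHom.coe_mk]; ring
  · rw [LinearMap.finrank_range_of_inj (lineMap_inj f)]; simp

def ind (o : Option K) (i : Fin m) : RR K m := fun v => if onLine o (v.1 i) (v.2 i) then 1 else 0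

lemma prod_ind_mem (f : Fin m → Option K) : ∏ i, ind (f i) i ∈ UU K m := by
  refine Submodule.subset_span ⟨_, lineMap_lag f, ?_⟩
  funext v
  rw [Finset.prod_apply]
  simp only [ind, chi]
  rw [Finset.prod_boole]
  congr 1
  simp only [Finset.mem_univ, true_implies, LinearMap.mem_range, onLine_iff]
  apply propext
  constructor
  · intro h
    choose s h1 h2 using h
    exact ⟨s, by ext i <;> simp [lineMap, h1, h2]⟩
  · rintro ⟨s, rfl⟩ i
    exact ⟨s i, rfl, rfl⟩

lemma X_pow_eq (i : Fin m) : (Xc i : RR K m) ^ (Fintype.card K - 1) = ∑ c : K, ind (some c) i := by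
  have hq : 1 < Fintype.card K := Fintype.one_lt_card
  funext v
  rw [Finset.sum_apply]
  simp only [ind, onLine, Pi.pow_apply, Xc]
  by_cases h : v.1 i = 0
  · rw [h, zero_pow (by omega)]
    simp
  · rw [FiniteField.pow_card_sub_one_eq_one _ h]
    have : ∀ c : K, v.2 i = c * v.1 i ↔ c = v.2 i / v.1 i := by
      intro c; rw [eq_div_iff h, eq_comm]
    simp [this]

lemma one_eq_ind (i : Fin m) : (1 : RR K m) = ∑ o : Option K, ind o i := by
  rw [Fintype.sum_option, ← X_pow_eq]
  have hq : 1 < Fintype.card K := Fintype.one_lt_card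
  funext v
  simp only [ind, onLine, Pi.pow_apply, Xc, Pi.add_apply, Pi.one_apply]
  by_cases h : v.1 i = 0
  · rw [h, zero_pow (by omega)]; simp
  · rw [FiniteField.pow_card_sub_one_eq_one _ h]; simp [h]

lemma base_mem (I : Finset (Fin m)) :
    ∏ i, (if i ∈ I then (Xc i : RR K m) ^ (Fintype.card K - 1) else 1) ∈ UU K m := by
  have : ∀ i, (if i ∈ I then (Xc i : RR K m) ^ (Fintype.card K - 1) else 1) =
      ∑ o ∈ (if i ∈ I then Finset.univ.image some else (Finset.univ : Finset (Option K))),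
        ind o i := by
    intro i
    by_cases h : i ∈ I
    · rw [if_pos h, if_pos h, X_pow_eq, Finset.sum_image]
      intro a _ b _ hab
      exact Option.some_injective _ hab
    · rw [if_neg h, if_neg h, ← one_eq_ind]
  simp_rw [this]
  rw [Finset.prod_univ_sum]
  exact Submodule.sum_mem _ fun f _ => prod_ind_mem f

lemma one_mem_UU : (1 : RR K m) ∈ UU K m := by
  simpa using base_mem (K := K) (m := m) ∅

end base

section mons
variable {K : Type*} [Field K] {m : ℕ} {p : ℕ} {t : ℕ}

variable (K p) in
def mon (a b : Fin t → Fin m → ℕ) : RR K m := ∏ j, (mo (a j) (b j)) ^ p ^ (j : ℕ)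

lemma cmp_swp_mo (J : Finset (Fin m)) (a b : Fin m → ℕ) : cmp (swp J) (mo a b : RR K m) =
    ((-1 : K) ^ (∑ i ∈ J, b i)) • mo (fun i => if i ∈ J then b i else a i)
      (fun i => if i ∈ J then a i else b i) := by
  have : ((-1 : K) ^ (∑ i ∈ J, b i)) • (mo (fun i => if i ∈ J then b i else a i)
      (fun i => if i ∈ J then a i else b i) : RR K m) = ∏ i, ((if i ∈ J then (-1) ^ b i else 1) *
        (Xc i ^ (if i ∈ J then b i else a i) * Yc i ^ (if i ∈ J then a i else b i))) := by
    rw [Finset.prod_mul_distrib, ← Finset.prod_pow_eq_pow_sum, Algebra.smul_def, map_prod, mo]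
    congr 1
    rw [Finset.prod_ite_mem]
    simp
  rw [this, mo, map_prod]
  refine Finset.prod_congr rfl fun i _ => ?_
  rw [map_mul, map_pow, map_pow, cmp_swp_X, cmp_swp_Y]
  by_cases h : i ∈ J
  · simp only [if_pos h, neg_pow (Xc i : RR K m)]; ring
  · simp only [if_neg h]; ring

lemma mon_swap {a b : Fin t → Fin m → ℕ} (h : mon K p a b ∈ UU K m) : mon K p b a ∈ UU K m := by
  have h1 := (swp_isom (K := K) Finset.univ).cmp_mem h
  rw [mon, map_prod] at h1
  simp only [map_pow, cmp_swp_mo, _root_.smul_pow, Finset.mem_univ, if_true] at h1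
  have h2 : (∏ j : Fin t, ((-1 : K) ^ (∑ i, b j i)) ^ p ^ (j : ℕ)) • mon K p b a ∈ UU K m := by
    convert h1 using 1
    rw [mon, Finset.prod_smul]
  have h3 : (∏ j : Fin t, ((-1 : K) ^ (∑ i, b j i)) ^ p ^ (j : ℕ)) ≠ 0 := by
    refine Finset.prod_ne_zero_iff.2 fun j _ => pow_ne_zero _ (pow_ne_zero _ (by simp))
  exact (Submodule.smul_mem_iff _ h3).1 h2

end mons

section exact
variable {K : Type*} [Field K] [Fintype K] {m : ℕ} {p : ℕ} [Fact p.Prime] [CharP K p] {t : ℕ}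

lemma base_mon (hK : Fintype.card K = p ^ t) (I : Finset (Fin m)) :
    mon K p (fun (_ : Fin t) i => if i ∈ I then p - 1 else 0) 0 ∈ UU K m := by
  convert base_mem (K := K) I using 1
  unfold mon mo
  simp_rw [← Finset.prod_pow]
  rw [Finset.prod_comm]
  refine Finset.prod_congr rfl fun i _ => ?_
  by_cases h : i ∈ I
  · simp only [if_pos h, Pi.zero_apply, pow_zero, mul_one, ← pow_mul]
    rw [Finset.prod_pow_eq_pow_sum, hK]
    congr 1
    rw [Fin.sum_univ_eq_sum_range (fun j => (p - 1) * p ^ j), ← Finset.mul_sum,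
      mul_comm]
    obtain ⟨r, rfl⟩ : ∃ r, p = r + 1 := ⟨p - 1, by have := (Fact.out : p.Prime).pos; omega⟩
    have := geom_sum_mul_add r t
    simp only [Nat.add_sub_cancel]
    omega
  · simp [h]

lemma natDegree_Pmo (u : Fin m → RR K m) (S : Finset (Fin m)) (hu : ∀ k, k ∉ S → u k = 0)
    (a b : Fin m → ℕ) : (Pmo u 0 a b).natDegree ≤ ∑ k ∈ S, a k := by
  unfold Pmo
  refine (natDegree_prod_le _ _).trans ?_
  have h : ∀ k, ((C (Xc k) + X * C (u k)) ^ a k *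
      (C (Yc k) + X * C ((0 : Fin m → RR K m) k)) ^ b k).natDegree ≤ if k ∈ S then a k else 0 := by
    intro k
    refine natDegree_mul_le.trans ?_
    have h2 : ((C (Yc k : RR K m) + X * C ((0 : Fin m → RR K m) k)) ^ b k).natDegree = 0 := by
      simp only [Pi.zero_apply, C_0, mul_zero, add_zero, ← C_pow, natDegree_C]
    rw [h2, add_zero]
    by_cases hk : k ∈ S
    · rw [if_pos hk]
      refine natDegree_pow_le.trans ?_
      have : (C (Xc k) + X * C (u k)).natDegree ≤ 1 := by
        refine natDegree_add_le_of_degree_le (by simp) ?_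
        exact (natDegree_mul_C_le _ _).trans natDegree_X_le
      nlinarith
    · rw [if_neg hk, hu k hk]
      simp only [C_0, mul_zero, add_zero, ← C_pow, natDegree_C, le_refl]
  refine (Finset.sum_le_sum fun k _ => h k).trans ?_
  rw [Finset.sum_ite_mem, Finset.univ_inter]

def Bil (i l : Fin m) : Matrix (Fin m) (Fin m) K :=
  fun x y => if (x = i ∧ y = l) ∨ (x = l ∧ y = i) then 1 else 0

lemma Bil_symm (i l : Fin m) : (Bil i l : Matrix (Fin m) (Fin m) K).IsSymm := by
  ext x y
  simp only [Bil, Matrix.transpose_apply]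
  congr 1
  apply propext
  tauto

lemma Bil_u (i l k : Fin m) : ∑ y, (Bil i l : Matrix (Fin m) (Fin m) K) k y • (Yc y : RR K m) =
    if k = i then Yc l else if k = l then Yc i else 0 := by
  by_cases h1 : k = i
  · rw [if_pos h1, Finset.sum_eq_single l]
    · simp [Bil, h1]
    · intro y _ hy
      have : ¬ ((k = i ∧ y = l) ∨ (k = l ∧ y = i)) := by
        rintro (⟨_, h⟩ | ⟨h, h'⟩)
        · exact hy h
        · exact hy (by rw [h', ← h1, h])
      simp [Bil, this]
    · simp
  · rw [if_neg h1]
    by_cases h2 : k = l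
    · rw [if_pos h2, Finset.sum_eq_single i]
      · simp [Bil, h2]
      · intro y _ hy
        have : ¬ ((k = i ∧ y = l) ∨ (k = l ∧ y = i)) := by
          rintro (⟨h, _⟩ | ⟨_, h⟩)
          · exact h1 h
          · exact hy h
        simp [Bil, this]
      · simp
    · rw [if_neg h2]
      exact Finset.sum_eq_zero fun y _ => by simp [Bil, h1, h2]

lemma cast_ne_zero_of_lt {n : ℕ} (h0 : n ≠ 0) (h : n < p) : (n : K) ≠ 0 := by
  rw [Ne, CharP.cast_eq_zero_iff K p]
  intro hd
  have := Nat.le_of_dvd (Nat.pos_of_ne_zero h0) hd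
  omega

lemma exact_move (hK : Fintype.card K = p ^ t) (hp3 : 3 ≤ p) (j0 : Fin t) (i l : Fin m)
    {a b : Fin t → Fin m → ℕ} (h : mon K p a b ∈ UU K m)
    (hdeg : ∀ j, (if i = l then a j i else a j i + a j l) < p)
    (h0 : i ≠ l → a j0 l = 0) (h1 : 1 ≤ a j0 i) :
    mon K p (Function.update a j0 (a j0 - Pi.single i 1))
      (Function.update b j0 (b j0 + Pi.single l 1)) ∈ UU K m := by
  set u : Fin m → RR K m := fun k => if k = i then Yc l else if k = l then Yc i else 0 with hu
  have hnd : ∀ j, (Pmo u 0 (a j) (b j)).natDegree < p := by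
    intro j
    refine (natDegree_Pmo u {i, l} ?_ _ _).trans_lt ?_
    · intro k hk
      simp only [Finset.mem_insert, Finset.mem_singleton, not_or] at hk
      simp [hu, hk.1, hk.2]
    · have := hdeg j
      by_cases hil : i = l
      · subst hil; simpa using this
      · rw [if_neg hil] at this
        rwa [Finset.sum_pair hil]
  have key := op_gen hK hp3 j0 (UU K m) (fun x => shx (x • Bil i l))
    (fun x f hf => (shx_isom (by
      have := Bil_symm (K := K) i l
      unfold Matrix.IsSymm at *
      rw [Matrix.transpose_smul, this])).cmp_mem hf)
    (fun j => mo (a j) (b j)) (fun j => Pmo u 0 (a j) (b j))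
    (by
      intro j x
      apply Pmo_eval
      · intro k
        rw [cmp_shx_X, hu]
        simp only [← Bil_u, Finset.smul_sum, Matrix.smul_apply, smul_assoc]
      · intro k; rw [cmp_shx_Y]; simp)
    (by
      rintro f ⟨j, hj⟩
      have : ∏ j, ((Pmo u 0 (a j) (b j)).coeff (f j)) ^ p ^ (j : ℕ) = 0 := by
        apply Finset.prod_eq_zero (Finset.mem_univ j)
        rw [coeff_eq_zero_of_natDegree_lt ((hnd j).trans_le hj),
          zero_pow (pow_pos (Fact.out : p.Prime).pos _).ne']
      rw [this]; exact Submodule.zero_mem _) h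
  have hc1 : (Pmo u 0 (a j0) (b j0)).coeff 1 =
      (a j0 i : K) • mo (a j0 - Pi.single i 1) (b j0 + Pi.single l 1) := by
    rw [Pmo_coeff_one', Finset.sum_eq_single i]
    · simp only [hu, if_true, Pi.zero_apply, mul_zero, smul_zero, add_zero]
      congr 1
      rw [← pow_one (Yc l), ← mo_single_y, mo_mul, add_zero]
    · intro k _ hk
      by_cases hkl : k = l
      · subst hkl
        rw [h0 (Ne.symm hk)]; simp
      · simp [hu, hk, hkl]
    · simp
  have hai : (a j0 i : K) ≠ 0 := by
    refine cast_ne_zero_of_lt (p := p) (by omega) ?_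
    have := hdeg j0
    split_ifs at this <;> omega
  have hfin : ∏ j, ((Pmo u 0 (a j) (b j)).coeff (if j = j0 then 1 else 0)) ^ p ^ (j : ℕ) =
      ((a j0 i : K) ^ p ^ (j0 : ℕ)) • mon K p (Function.update a j0 (a j0 - Pi.single i 1))
      (Function.update b j0 (b j0 + Pi.single l 1)) := by
    rw [mon, ← Finset.mul_prod_erase _ _ (Finset.mem_univ j0),
      ← Finset.mul_prod_erase _ _ (Finset.mem_univ j0), if_pos rfl, hc1, Function.update_self,
      Function.update_self, _root_.smul_pow, smul_mul_assoc]
    congr 2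
    refine Finset.prod_congr rfl fun j hj => ?_
    have hj := Finset.ne_of_mem_erase hj
    rw [if_neg hj, Pmo_coeff_zero, Function.update_of_ne hj, Function.update_of_ne hj]
  rw [hfin] at key
  exact (Submodule.smul_mem_iff _ (pow_ne_zero _ hai)).1 key

end exact
end PR

/-! ### Part 5 : exact monomials, carries and the starting arrays -/
namespace PR
set_option linter.unusedVariables false
set_option linter.unusedSectionVars false

section five
variable {K : Type*} [Field K] [Fintype K] {m : ℕ} {p : ℕ} [Fact p.Prime] [CharP K p] {t : ℕ}

/-- unit array -/
def eu (j : Fin t) (i : Fin m) : Fin t → Fin m → ℕ :=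
  fun j' i' => if j' = j ∧ i' = i then 1 else 0

lemma eu_self (j : Fin t) (i : Fin m) : eu j i j i = 1 := by simp [eu]

lemma eu_row (j : Fin t) (i : Fin m) : eu j i j = Pi.single i 1 := by
  funext k; simp [eu, Pi.single_apply]

lemma eu_row_ne {j j' : Fin t} (h : j' ≠ j) (i : Fin m) : eu j i j' = 0 := by
  funext k; simp [eu, h]

lemma sum_eu (j j' : Fin t) (i : Fin m) : ∑ k, eu j i j' k = if j' = j then 1 else 0 := by
  by_cases h : j' = j
  · simp [eu, h]
  · simp [eu, h]

lemma mon_mul (a b a' b' : Fin t → Fin m → ℕ) :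
    mon K p a b * mon K p a' b' = mon K p (a + a') (b + b') := by
  unfold mon
  rw [← Finset.prod_mul_distrib]
  refine Finset.prod_congr rfl fun j _ => ?_
  rw [← mul_pow, mo_mul]; rfl

lemma mo_zero : (mo 0 0 : RR K m) = 1 := by simp [mo]

lemma mon_nsmul_eu_y (j : Fin t) (i : Fin m) (n : ℕ) :
    mon K p 0 (n • eu j i) = (Yc i ^ n) ^ p ^ (j : ℕ) := by
  unfold mon
  rw [Finset.prod_eq_single j]
  · rw [← mo_single_y]
    congr 2
    funext k
    simp [eu, Pi.single_apply]
  · intro j' _ h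
    have : (n • eu j i) j' = (0 : Fin m → ℕ) := by funext k; simp [eu, h]
    rw [this, Pi.zero_apply, mo_zero, one_pow]
  · simp

lemma mon_nsmul_eu_x (j : Fin t) (i : Fin m) (n : ℕ) :
    mon K p (n • eu j i) 0 = (Xc i ^ n) ^ p ^ (j : ℕ) := by
  unfold mon
  rw [Finset.prod_eq_single j]
  · rw [← mo_single_x]
    congr 2
    funext k
    simp [eu, Pi.single_apply]
  · intro j' _ h
    have : (n • eu j i) j' = (0 : Fin m → ℕ) := by funext k; simp [eu, h]
    rw [this, Pi.zero_apply, mo_zero, one_pow]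
  · simp

lemma frob_succ [NeZero t] (hK : Fintype.card K = p ^ t) (f : RR K m) (j : Fin t) :
    (f ^ p) ^ p ^ (j : ℕ) = f ^ p ^ ((j + 1 : Fin t) : ℕ) := by
  rw [← pow_mul, ← pow_succ']
  have hj := j.2
  have hv : ((j + 1 : Fin t) : ℕ) = (j + 1) % t := by
    rw [Fin.val_add]; simp
  by_cases h : (j : ℕ) + 1 < t
  · rw [hv, Nat.mod_eq_of_lt h]
  · have h1 : (j : ℕ) + 1 = t := by omega
    rw [hv, h1, Nat.mod_self, pow_zero, pow_one, ← hK]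
    funext v
    exact FiniteField.pow_card _

lemma carry_y [NeZero t] (hK : Fintype.card K = p ^ t) (a b : Fin t → Fin m → ℕ) (j : Fin t) (i : Fin m) :
    mon K p a (b + p • eu j i) = mon K p a (b + eu (j + 1) i) := by
  have h1 := mon_mul (K := K) (p := p) a b 0 (p • eu j i)
  have h2 := mon_mul (K := K) (p := p) a b 0 (1 • eu (j + 1) i)
  rw [add_zero] at h1 h2
  rw [one_smul] at h2
  rw [← h1, ← h2]
  conv_rhs => rw [← one_smul ℕ (eu (j + 1) i)]
  rw [mon_nsmul_eu_y, mon_nsmul_eu_y, frob_succ hK, pow_one]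

lemma carry_x [NeZero t] (hK : Fintype.card K = p ^ t) (a b : Fin t → Fin m → ℕ) (j : Fin t) (i : Fin m) :
    mon K p (a + p • eu j i) b = mon K p (a + eu (j + 1) i) b := by
  have h1 := mon_mul (K := K) (p := p) a b (p • eu j i) 0
  have h2 := mon_mul (K := K) (p := p) a b (1 • eu (j + 1) i) 0
  rw [add_zero] at h1 h2
  rw [one_smul] at h2
  rw [← h1, ← h2]
  conv_rhs => rw [← one_smul ℕ (eu (j + 1) i)]
  rw [mon_nsmul_eu_x, mon_nsmul_eu_x, frob_succ hK, pow_one]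

lemma mv (hK : Fintype.card K = p ^ t) (hp3 : 3 ≤ p) (j : Fin t) (i l : Fin m)
    {a b : Fin t → Fin m → ℕ} (h : mon K p (a + eu j i) b ∈ UU K m)
    (hdeg : ∀ j', (if i = l then a j' i else a j' i + a j' l) + (if j' = j then 1 else 0) < p)
    (h0 : i ≠ l → a j l = 0) : mon K p a (b + eu j l) ∈ UU K m := by
  have := exact_move hK hp3 j i l h ?_ ?_ ?_
  · convert this using 1
    congr 1
    · funext j'
      by_cases hj : j' = j
      · subst hj; rw [Function.update_self, Pi.add_apply, eu_row, add_tsub_cancel_right]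
      · rw [Function.update_of_ne hj, Pi.add_apply, eu_row_ne hj, add_zero]
    · funext j'
      by_cases hj : j' = j
      · subst hj; rw [Function.update_self, Pi.add_apply, eu_row]
      · rw [Function.update_of_ne hj, Pi.add_apply, eu_row_ne hj, add_zero]
  · intro j'
    have := hdeg j'
    by_cases hil : i = l
    · subst hil
      simp only [if_true] at this ⊢
      simpa [eu] using this
    · rw [if_neg hil] at this ⊢
      simp only [Pi.add_apply, eu, and_true, (Ne.symm hil : ¬ l = i), and_false, if_false]
      omega
  · intro hil
    simp [h0 hil, eu, Ne.symm hil]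
  · simp [eu]

variable (K p) in
/-- all centrally positioned monomials with pair degrees `n` lie in the code -/
def Good (n : Fin t → Fin m → ℕ) : Prop :=
  ∀ a b : Fin t → Fin m → ℕ, a + b = n → (∀ j i, a j i < p) → (∀ j i, b j i < p) →
    mon K p a b ∈ UU K m

lemma sub_eu {a : Fin t → Fin m → ℕ} {j : Fin t} {i : Fin m} (h : 1 ≤ a j i) :
    (a - eu j i) + eu j i = a := by
  funext j' i'
  simp only [Pi.add_apply, Pi.sub_apply, eu]
  split_ifs with hh
  · obtain ⟨rfl, rfl⟩ := hh; omega
  · omega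

lemma dist_lt {a a0 : Fin t → Fin m → ℕ} {a1 : Fin t → Fin m → ℕ} (j : Fin t) (i : Fin m)
    (h : (a1 j i - a j i) + (a j i - a1 j i) < (a0 j i - a j i) + (a j i - a0 j i))
    (h' : ∀ j' i', (a1 j' i' - a j' i') + (a j' i' - a1 j' i') ≤
      (a0 j' i' - a j' i') + (a j' i' - a0 j' i')) :
    ∑ j, ∑ i, ((a1 j i - a j i) + (a j i - a1 j i)) <
      ∑ j, ∑ i, ((a0 j i - a j i) + (a j i - a0 j i)) := by
  apply Finset.sum_lt_sum
  · intro j' _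
    exact Finset.sum_le_sum fun i' _ => h' j' i'
  · exact ⟨j, Finset.mem_univ j, Finset.sum_lt_sum (fun i' _ => h' j i') ⟨i, Finset.mem_univ i, h⟩⟩

lemma connect (hK : Fintype.card K = p ^ t) (hp3 : 3 ≤ p) (a b : Fin t → Fin m → ℕ)
    (ha : ∀ j i, a j i < p) (hb : ∀ j i, b j i < p) (N : ℕ) :
    ∀ a0 b0 : Fin t → Fin m → ℕ, a0 + b0 = a + b → (∀ j i, a0 j i < p) → (∀ j i, b0 j i < p) →
      ∑ j, ∑ i, ((a0 j i - a j i) + (a j i - a0 j i)) = N → mon K p a0 b0 ∈ UU K m →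
      mon K p a b ∈ UU K m := by
  induction N using Nat.strong_induction_on with
  | _ N ih =>
  intro a0 b0 hab ha0 hb0 hN h
  have hsum : ∀ j i, a0 j i + b0 j i = a j i + b j i := fun j i => congrFun (congrFun hab j) i
  by_cases h1 : ∃ j i, a j i < a0 j i
  · obtain ⟨j, i, hji⟩ := h1
    have hs := sub_eu (a := a0) (j := j) (i := i) (by omega)
    have h2 : mon K p (a0 - eu j i) (b0 + eu j i) ∈ UU K m := by
      refine mv hK hp3 j i i (by rwa [hs]) ?_ (by simp)
      intro j'
      have h4 := ha0 j' i
      simp only [if_true, Pi.sub_apply, eu, and_true]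
      split_ifs with h5
      · subst h5; omega
      · omega
    refine ih _ ?_ (a0 - eu j i) (b0 + eu j i) ?_ ?_ ?_ rfl h2
    · rw [← hN]
      apply dist_lt j i
      · simp only [Pi.sub_apply, eu_self]; omega
      · intro j' i'
        simp only [Pi.sub_apply, eu]
        split_ifs with hh
        · obtain ⟨rfl, rfl⟩ := hh; omega
        · omega
    · rw [← hab, add_comm b0, ← add_assoc, hs]
    · intro j' i'
      have := ha0 j' i'
      simp only [Pi.sub_apply]; omega
    · intro j' i'
      have := hb0 j' i'
      simp only [Pi.add_apply, eu]
      split_ifs with hh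
      · obtain ⟨rfl, rfl⟩ := hh
        have := hsum j' i'; have := hb j' i'; omega
      · omega
  · push Not at h1
    by_cases h2 : ∃ j i, a0 j i < a j i
    · obtain ⟨j, i, hji⟩ := h2
      have hji' := hsum j i
      have hs := sub_eu (a := b0) (j := j) (i := i) (by omega)
      have h2 : mon K p (a0 + eu j i) (b0 - eu j i) ∈ UU K m := by
        apply mon_swap
        refine mv hK hp3 j i i (by rw [hs]; exact mon_swap h) ?_ (by simp)
        intro j'
        have h4 := hb0 j' i
        simp only [if_true, Pi.sub_apply, eu, and_true]
        split_ifs with h5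
        · subst h5; omega
        · omega
      refine ih _ ?_ (a0 + eu j i) (b0 - eu j i) ?_ ?_ ?_ rfl h2
      · rw [← hN]
        apply dist_lt j i
        · simp only [Pi.add_apply, eu_self]; omega
        · intro j' i'
          simp only [Pi.add_apply, eu]
          split_ifs with hh
          · obtain ⟨rfl, rfl⟩ := hh; omega
          · omega
      · rw [← hab, add_assoc, add_comm (eu j i), hs]
      · intro j' i'
        have := ha0 j' i'
        simp only [Pi.add_apply, eu]
        split_ifs with hh
        · obtain ⟨rfl, rfl⟩ := hh
          have := ha j' i'; omega
        · omega
      · intro j' i'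
        have := hb0 j' i'
        simp only [Pi.sub_apply]; omega
    · push Not at h2
      have e1 : a0 = a := by
        funext j i; exact le_antisymm (h1 j i) (h2 j i)
      have e2 : b0 = b := by
        funext j i; have := hsum j i; rw [e1] at this; omega
      rwa [e1, e2] at h

lemma Good.of_one (hK : Fintype.card K = p ^ t) (hp3 : 3 ≤ p) {a0 b0 : Fin t → Fin m → ℕ}
    (ha0 : ∀ j i, a0 j i < p) (hb0 : ∀ j i, b0 j i < p) (h : mon K p a0 b0 ∈ UU K m) :
    Good K p (a0 + b0) := by
  intro a b hab ha hb
  exact connect hK hp3 a b ha hb _ a0 b0 hab.symm ha0 hb0 rfl h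


lemma good_pos (hK : Fintype.card K = p ^ t) (hp3 : 3 ≤ p) {n : Fin t → Fin m → ℕ}
    (hn : ∀ j i, n j i ≤ p) (hg : Good K p n) (j : Fin t) (i l : Fin m) (h1 : 1 ≤ n j i)
    (h2 : i ≠ l → n j l ≤ p - 1) :
    ∃ a b : Fin t → Fin m → ℕ, a + b + eu j i = n ∧ (∀ j i, a j i < p) ∧ (∀ j i, b j i < p) ∧
      a j l = 0 ∧ (∀ j' i', j' ≠ j → n j' i' ≤ p - 1 → b j' i' ≤ p - 2) ∧
      mon K p a (b + eu j l) ∈ UU K m := by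
  set a : Fin t → Fin m → ℕ := fun j' i' => if j' = j ∧ (i' = i ∨ i' = l) then 0 else
    if p - 1 ≤ n j' i' then 1 else 0 with ha
  set b : Fin t → Fin m → ℕ := fun j' i' => n j' i' - a j' i' - eu j i j' i' with hb
  have ha1 : ∀ j' i', a j' i' ≤ 1 := by
    intro j' i'; simp only [ha]; split_ifs <;> omega
  have hjl : a j l = 0 := by simp [ha]
  have hji : a j i = 0 := by simp [ha]
  have hsum : a + b + eu j i = n := by
    funext j' i'
    have h3 := hn j' i'
    simp only [Pi.add_apply, hb, ha, eu]
    by_cases hh : j' = j ∧ i' = i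
    · obtain ⟨rfl, rfl⟩ := hh
      simp; omega
    · rw [if_neg hh]
      split_ifs <;> omega
  have hbp : ∀ j' i', b j' i' < p := by
    intro j' i'
    have h3 := hn j' i'
    simp only [hb, ha, eu]
    by_cases hh : j' = j ∧ i' = i
    · rw [if_pos hh]; omega
    · rw [if_neg hh]
      by_cases hh2 : j' = j ∧ i' = l
      · obtain ⟨rfl, rfl⟩ := hh2
        have := h2 (fun h => hh ⟨rfl, h.symm⟩)
        omega
      · have : ¬ (j' = j ∧ (i' = i ∨ i' = l)) := by tauto
        rw [if_neg this]
        split_ifs <;> omega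
  refine ⟨a, b, hsum, fun j' i' => by have := ha1 j' i'; omega, hbp, hjl, ?_, ?_⟩
  · intro j' i' hj h
    have : ¬ (j' = j ∧ (i' = i ∨ i' = l)) := by tauto
    simp only [hb, ha, eu]
    rw [if_neg this]
    split_ifs <;> omega
  · refine mv hK hp3 j i l ?_ ?_ (fun _ => hjl)
    · apply hg _ _ _ _ hbp
      · rw [← hsum]; abel
      · intro j' i'
        have h5 := ha1 j' i'
        simp only [Pi.add_apply, eu]
        split_ifs <;> omega
    · intro j'
      by_cases hj : j' = j
      · subst hj; simp [hjl, hji]; omega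
      · have h5 := ha1 j' i
        have h6 := ha1 j' l
        rw [if_neg hj]
        split_ifs <;> omega

lemma Good.transfer (hK : Fintype.card K = p ^ t) (hp3 : 3 ≤ p) {n n2 : Fin t → Fin m → ℕ}
    (hn : ∀ j i, n j i ≤ p) (hg : Good K p n) (j : Fin t) (i l : Fin m) (hil : i ≠ l)
    (h1 : 1 ≤ n j i) (h2 : n j l ≤ p - 2) (h3 : n2 + eu j i = n + eu j l) : Good K p n2 := by
  obtain ⟨a, b, hs, ha, hb, hjl, -, hm⟩ := good_pos hK hp3 hn hg j i l h1 (fun _ => by omega)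
  have h4 : n2 = a + (b + eu j l) := by
    have : n2 + eu j i = a + (b + eu j l) + eu j i := by rw [h3, ← hs]; abel
    exact add_right_cancel this
  rw [h4]
  refine Good.of_one hK hp3 ha ?_ hm
  intro j' i'
  simp only [Pi.add_apply, eu]
  split_ifs with hh
  · obtain ⟨rfl, rfl⟩ := hh
    have := congrFun (congrFun hs j') i'
    simp only [Pi.add_apply] at this
    omega
  · have := hb j' i'; omega

lemma Good.carry [NeZero t] (hK : Fintype.card K = p ^ t) (hp3 : 3 ≤ p) {n n2 : Fin t → Fin m → ℕ}
    (hn : ∀ j i, n j i ≤ p) (hg : Good K p n) (j : Fin t) (hj : j + 1 ≠ j) (i l : Fin m)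
    (h1 : 1 ≤ n j i) (h2 : n j l + (if i = l then 0 else 1) = p) (h2' : n (j + 1) l ≤ p - 1)
    (h3 : n2 + eu j i + p • eu j l = n + eu j l + eu (j + 1) l) : Good K p n2 := by
  obtain ⟨a, b, hs, ha, hb, hjl, hb2, hm⟩ := good_pos hK hp3 hn hg j i l h1
    (fun h => by rw [if_neg h] at h2; omega)
  have hbl : b j l = p - 1 := by
    have := congrFun (congrFun hs j) l
    simp only [Pi.add_apply, hjl, eu] at this
    by_cases hil : i = l
    · subst hil; simp at this h2; omega
    · simp [hil, Ne.symm hil] at this h2; omega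
  set b3 : Fin t → Fin m → ℕ := b - (p - 1) • eu j l with hb3
  have hb3' : b + eu j l = b3 + p • eu j l := by
    funext j' i'
    simp only [hb3, Pi.add_apply, Pi.sub_apply, Pi.smul_apply, smul_eq_mul, eu]
    split_ifs with hh
    · obtain ⟨rfl, rfl⟩ := hh; omega
    · omega
  rw [hb3', carry_y hK] at hm
  have h4 : n2 = a + (b3 + eu (j + 1) l) := by
    have : n2 + (eu j i + p • eu j l) = a + (b3 + eu (j + 1) l) + (eu j i + p • eu j l) := by
      calc n2 + (eu j i + p • eu j l) = n + eu j l + eu (j + 1) l := by rw [← h3]; abel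
        _ = a + (b + eu j l) + eu j i + eu (j + 1) l := by rw [← hs]; abel
        _ = _ := by rw [hb3']; abel
    exact add_right_cancel this
  rw [h4]
  refine Good.of_one hK hp3 ha ?_ hm
  intro j' i'
  have h5 := hb j' i'
  simp only [Pi.add_apply, hb3, Pi.sub_apply]
  by_cases hh : j' = j + 1 ∧ i' = l
  · obtain ⟨rfl, rfl⟩ := hh
    have := hb2 (j + 1) i' hj h2'
    rw [eu_self]; omega
  · simp only [eu, if_neg hh]; omega

lemma exists_other {f : Fin m → ℕ} {l : Fin m} {c : ℕ} (h : f l + c ≤ ∑ i, f i) (hc : 1 ≤ c) :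
    ∃ i, i ≠ l ∧ 1 ≤ f i := by
  by_contra hcon
  push Not at hcon
  have : ∑ i, f i = f l := Finset.sum_eq_single l (fun i _ hi => by have := hcon i hi; omega) (by simp)
  omega

lemma Good.big_carry [NeZero t] (hK : Fintype.card K = p ^ t) (hp3 : 3 ≤ p) (j : Fin t)
    (hj : j + 1 ≠ j) (l : Fin m) (d : ℕ) :
    ∀ n : Fin t → Fin m → ℕ, (∀ j i, n j i ≤ p) → Good K p n → p ≤ ∑ i, n j i →
      n (j + 1) l ≤ p - 1 → p - n j l = d →
      ∃ n2 : Fin t → Fin m → ℕ, (∀ j i, n2 j i ≤ p) ∧ Good K p n2 ∧ n2 j l = 0 ∧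
        ∑ i, n2 j i + p = ∑ i, n j i ∧ n2 (j + 1) = n (j + 1) + Pi.single l 1 ∧
        ∀ h, h ≠ j → h ≠ j + 1 → n2 h = n h := by
  have fin : ∀ n : Fin t → Fin m → ℕ, (∀ j i, n j i ≤ p) → Good K p n →
      n (j + 1) l ≤ p - 1 → ∀ i, 1 ≤ n j i → n j l + (if i = l then 0 else 1) = p →
      ∃ n2 : Fin t → Fin m → ℕ, (∀ j i, n2 j i ≤ p) ∧ Good K p n2 ∧ n2 j l = 0 ∧
        ∑ i, n2 j i + p = ∑ i, n j i ∧ n2 (j + 1) = n (j + 1) + Pi.single l 1 ∧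
        ∀ h, h ≠ j → h ≠ j + 1 → n2 h = n h := by
    intro n hn hg hgl i h1 h2
    set n2 : Fin t → Fin m → ℕ := n + eu j l + eu (j + 1) l - eu j i - p • eu j l with hn2
    have h3 : n2 + eu j i + p • eu j l = n + eu j l + eu (j + 1) l := by
      funext j' i'
      simp only [hn2, Pi.add_apply, Pi.sub_apply, Pi.smul_apply, smul_eq_mul, eu]
      by_cases hj' : j' = j
      · subst hj'
        simp only [true_and, Ne.symm hj, false_and, if_false]
        by_cases hil : i = l
        · subst hil
          simp only [if_true] at h2
          by_cases hi : i' = i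
          · subst hi; simp only [if_true]; omega
          · simp only [hi, if_false]; omega
        · simp only [hil, if_false] at h2
          by_cases hi : i' = i
          · subst hi; simp only [hil, if_true, if_false]; omega
          · by_cases hi2 : i' = l
            · subst hi2; simp only [hi, if_true, if_false]; omega
            · simp only [hi, hi2, if_false]; omega
      · simp only [hj', false_and, if_false]; omega
    have hrow : ∀ h, h ≠ j → n2 h = n h + eu (j + 1) l h := by
      intro h hh
      have := congrFun h3 h
      simp only [Pi.add_apply, Pi.smul_apply, eu_row_ne hh, smul_zero, add_zero] at this
      exact this
    have hrowj : n2 j + Pi.single i 1 + p • Pi.single l 1 = n j + Pi.single l 1 := by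
      have := congrFun h3 j
      simpa only [Pi.add_apply, Pi.smul_apply, eu_row, eu_row_ne (Ne.symm hj), add_zero] using this
    refine ⟨n2, ?_, Good.carry hK hp3 hn hg j hj i l h1 h2 hgl h3, ?_, ?_, ?_, ?_⟩
    · intro j' i'
      by_cases hj' : j' = j
      · subst hj'
        have := congrFun hrowj i'
        have h5 := hn j' i'
        simp only [Pi.add_apply, Pi.smul_apply, smul_eq_mul] at this
        by_cases hil : i' = l
        · subst hil; simp at this; omega
        · rw [Pi.single_eq_of_ne hil] at this; omega
      · rw [hrow j' hj']
        have h5 := hn j' i'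
        simp only [Pi.add_apply, eu]
        split_ifs with hh
        · obtain ⟨rfl, rfl⟩ := hh; omega
        · omega
    · have := congrFun hrowj l
      simp only [Pi.add_apply, Pi.smul_apply, smul_eq_mul, Pi.single_eq_same] at this
      by_cases hil : i = l
      · subst hil; simp at this h2; omega
      · simp [Pi.single_apply, hil, Ne.symm hil] at this h2; omega
    · have := congrArg (fun f : Fin m → ℕ => ∑ k, f k) hrowj
      simp only [Pi.add_apply, Pi.smul_apply, smul_eq_mul, Finset.sum_add_distrib,
        ← Finset.mul_sum, Finset.sum_pi_single', Finset.mem_univ, if_true] at this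
      omega
    · rw [hrow _ hj, eu_row]
    · intro h hh hh2
      rw [hrow _ hh, eu_row_ne hh2, add_zero]
  induction d using Nat.strong_induction_on with
  | _ d ih =>
  intro n hn hg hsum hgl hd
  have hnl := hn j l
  by_cases h1 : n j l = p
  · exact fin n hn hg hgl l (by omega) (by simp [h1])
  · obtain ⟨i, hil, hi⟩ := exists_other (f := n j) (l := l) (c := 1) (by omega) le_rfl
    by_cases h2 : n j l = p - 1
    · exact fin n hn hg hgl i hi (by rw [if_neg hil]; omega)
    · set n1 : Fin t → Fin m → ℕ := n + eu j l - eu j i with hn1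
      have h3 : n1 + eu j i = n + eu j l := by
        apply sub_eu
        simp only [Pi.add_apply]; omega
      have hg1 := Good.transfer hK hp3 hn hg j i l hil hi (by omega) h3
      have e : ∀ j' i', n1 j' i' + eu j i j' i' = n j' i' + eu j l j' i' :=
        fun j' i' => congrFun (congrFun h3 j') i'
      have hsum1 : ∑ k, n1 j k = ∑ k, n j k := by
        have := Finset.sum_congr (rfl : (Finset.univ : Finset (Fin m)) = _) (fun k _ => e j k)
        rw [Finset.sum_add_distrib, Finset.sum_add_distrib, sum_eu, sum_eu] at this
        omega
      have hrow : ∀ h, h ≠ j → n1 h = n h := by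
        intro h hh
        have := congrFun h3 h
        simpa only [Pi.add_apply, eu_row_ne hh, add_zero] using this
      have ejl := e j l
      simp only [eu, Ne.symm hil, and_false, if_false, and_self, if_true] at ejl
      obtain ⟨n2, k1, k2, k3, k4, k5, k6⟩ := ih (p - n1 j l) (by omega) n1 (by
          intro j' i'
          have h5 := hn j' i'
          have h6 := e j' i'
          simp only [eu] at h6
          by_cases hh : j' = j ∧ i' = l
          · obtain ⟨rfl, rfl⟩ := hh
            omega
          · rw [if_neg hh] at h6; omega) hg1 (by omega) (by rw [hrow _ hj]; exact hgl) rfl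
      refine ⟨n2, k1, k2, k3, by omega, by rw [k5, hrow _ hj], fun h hh hh2 => ?_⟩
      rw [k6 h hh hh2, hrow h hh]

end five
end PR

/-! ### Part 6 : starting arrays of every type -/
namespace PR
set_option linter.unusedVariables false
set_option linter.unusedSectionVars false

section six
variable {K : Type*} [Field K] [Fintype K] {m : ℕ} {p : ℕ} [Fact p.Prime] [CharP K p] {t : ℕ}

variable (K p) in
/-- starting array of type `s` -/
def IsStart [NeZero t] (s : Fin t → ℕ) (n : Fin t → Fin m → ℕ) : Prop :=
  (∀ j i, n j i ≤ p) ∧ Good K p n ∧ (∀ j, ∑ i, n j i + s j = p * s (j + 1)) ∧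
    ∀ j, n j = (fun _ => p - 1) ↔ (s j = m ∧ s (j + 1) = m)

lemma start_const [NeZero t] (hK : Fintype.card K = p ^ t) (hp3 : 3 ≤ p) (r : ℕ) (hr : r ≤ m) :
    ∃ n : Fin t → Fin m → ℕ, IsStart K p (fun _ => r) n := by
  set I : Finset (Fin m) := Finset.univ.filter fun i => (i : ℕ) < r with hI
  have hc : I.card = r := by
    have := Fin.card_filter_val_lt (n := m) (m := r)
    rw [hI, this]; omega
  refine ⟨fun _ i => if i ∈ I then p - 1 else 0, ?_, ?_, ?_, ?_⟩
  · intro j i; dsimp only; split_ifs <;> omega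
  · have := Good.of_one (K := K) (p := p) (t := t) hK hp3
      (a0 := fun _ i => if i ∈ I then p - 1 else 0) (b0 := 0) ?_ ?_ (base_mon hK I)
    · simpa using this
    · intro j i; split_ifs <;> omega
    · intro j i; simp only [Pi.zero_apply]; omega
  · intro j
    rw [Finset.sum_ite_mem, Finset.univ_inter, Finset.sum_const, hc, smul_eq_mul]
    obtain ⟨q, rfl⟩ : ∃ q, p = q + 1 := ⟨p - 1, by omega⟩
    simp; ring
  · intro j
    constructor
    · intro h
      rcases Nat.lt_or_ge r m with h1 | h1
      · have := congrFun h ⟨r, h1⟩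
        simp [hI] at this; omega
      · dsimp only; omega
    · rintro ⟨h, -⟩
      funext i
      have := i.2
      simp [hI, h]

theorem start_exists [NeZero t] (hK : Fintype.card K = p ^ t) (hp3 : 3 ≤ p) (hm : 2 ≤ m)
    (r : ℕ) (hr : r ≤ m) (D : ℕ) :
    ∀ s : Fin t → ℕ, (∀ j, 1 ≤ s j) → (∀ j, s j ≤ r) → (∀ j, s j ≤ p * s (j + 1)) →
      (∃ j, s j = r) → ∑ j, (r - s j) = D → ∃ n : Fin t → Fin m → ℕ, IsStart K p s n := by
  induction D with
  | zero =>
    intro s h1 h2 h3 h4 h5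
    have : s = fun _ => r := by
      funext j
      have := (Finset.sum_eq_zero_iff.mp h5) j (Finset.mem_univ j)
      have := h2 j
      omega
    rw [this]
    exact start_const hK hp3 r hr
  | succ D ih =>
    intro s h1 h2 h3 h4 h5
    obtain ⟨g, hg⟩ := Finite.exists_min s
    have hgr : s g < r := by
      by_contra hcon
      have : ∑ j, (r - s j) = 0 := Finset.sum_eq_zero fun j _ => by have := hg j; omega
      omega
    obtain ⟨h0, hh0⟩ := h4
    have hg0 : h0 ≠ g := by rintro rfl; omega
    set j := g - 1 with hj
    have hjg : j + 1 = g := by rw [hj]; simp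
    have hjne : j + 1 ≠ j := by
      intro hc
      have h10 : (1 : Fin t) = 0 := by
        have : j + 1 = j + 0 := by rw [hc, add_zero]
        exact add_left_cancel this
      have : ∀ x : Fin t, x = 0 := by
        intro x
        have h6 : (x : ℕ) < t := x.2
        have h7 : ((1 : Fin t) : ℕ) = ((0 : Fin t) : ℕ) := by rw [h10]
        rcases Nat.lt_or_ge 1 t with h8 | h8
        · rw [Fin.val_one'] at h7
          rw [Nat.mod_eq_of_lt h8] at h7
          simp at h7
        · apply Fin.ext
          rw [Fin.val_zero]
          omega
      exact hg0 ((this h0).trans (this g).symm)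
    have hg1ne : g + 1 ≠ g := by
      intro hc
      apply hjne
      have h10 : (1 : Fin t) = 0 := by
        have : g + 1 = g + 0 := by rw [hc, add_zero]
        exact add_left_cancel this
      rw [h10, add_zero]
    have hjgne : j ≠ g := by rw [← hjg]; exact hjne.symm
    set s' : Fin t → ℕ := Function.update s g (s g + 1) with hs'
    have sg : s' g = s g + 1 := by simp [hs']
    have sne : ∀ x, x ≠ g → s' x = s x := fun x hx => by simp [hs', hx]
    have hle : ∀ x, s x ≤ s' x := by
      intro x
      by_cases hx : x = g
      · subst hx; omega
      · rw [sne x hx]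
    obtain ⟨n', k1, k2, k3, k4⟩ := ih s' (fun x => (h1 x).trans (hle x)) (by
        intro x
        by_cases hx : x = g
        · subst hx; omega
        · rw [sne x hx]; exact h2 x) (by
        intro x
        by_cases hx : x = g
        · subst hx
          rw [sg, sne _ hg1ne]
          have a1 := hg (x + 1)
          have a2 := h1 (x + 1)
          have : 3 * s (x + 1) ≤ p * s (x + 1) := Nat.mul_le_mul_right _ hp3
          omega
        · rw [sne x hx]
          exact (h3 x).trans (Nat.mul_le_mul_left _ (hle _)))
        ⟨h0, by rw [sne _ hg0, hh0]⟩ (by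
        have e : ∀ x, r - s x = (r - s' x) + if x = g then 1 else 0 := by
          intro x
          by_cases hx : x = g
          · subst hx; rw [sg]; simp; omega
          · rw [sne x hx]; simp [hx]
        rw [Finset.sum_congr rfl (fun x _ => e x), Finset.sum_add_distrib] at h5
        simp at h5
        exact h5)
    -- choose `l`
    have kg := k3 g
    rw [sg, sne _ hg1ne] at kg
    have kj := k3 j
    rw [hjg, sg, sne _ hjgne] at kj
    have hl : ∃ l, n' g l ≤ p - 1 ∧ n' g + Pi.single l 1 ≠ fun _ => p - 1 := by
      have h6 : ∃ l, n' g l ≤ p - 1 := by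
        by_contra hcon
        push Not at hcon
        have : ∑ i : Fin m, p ≤ ∑ i, n' g i := Finset.sum_le_sum fun i _ => by
          have := hcon i; omega
        rw [Finset.sum_const, Finset.card_univ, Fintype.card_fin, smul_eq_mul] at this
        have h7 : p * s (g + 1) ≤ p * m := Nat.mul_le_mul_left _ ((h2 _).trans hr)
        rw [mul_comm] at this
        have := h1 g
        omega
      obtain ⟨l, hl⟩ := h6
      by_cases hc : n' g + Pi.single l 1 = fun _ => p - 1
      · haveI : Nontrivial (Fin m) := Fin.nontrivial_iff_two_le.mpr hm
        obtain ⟨i, hi⟩ := exists_ne l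
        have h8 := congrFun hc i
        simp [hi] at h8
        refine ⟨i, by omega, fun hc2 => ?_⟩
        have := congrFun hc2 i
        simp [h8] at this
      · exact ⟨l, hl, hc⟩
    obtain ⟨l, hl1, hl2⟩ := hl
    obtain ⟨n, q1, q2, q3, q4, q5, q6⟩ := Good.big_carry hK hp3 j hjne l _ n' k1 k2 (by
      have := h3 j
      rw [hjg] at this
      nlinarith) (by rw [hjg]; exact hl1) rfl
    rw [hjg] at q5
    refine ⟨n, q1, q2, ?_, ?_⟩
    · intro x
      by_cases hxg : x = g
      · subst hxg
        rw [q5]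
        simp only [Pi.add_apply, Finset.sum_add_distrib, Finset.sum_pi_single', Finset.mem_univ, if_true]
        omega
      · by_cases hxj : x = j
        · rw [hxj, hjg]
          nlinarith
        · rw [q6 x hxj (by rw [hjg]; exact hxg)]
          have := k3 x
          have hx1 : x + 1 ≠ g := by
            rw [← hjg]; intro hc; exact hxj (add_right_cancel hc)
          rwa [sne x hxg, sne _ hx1] at this
    · intro x
      by_cases hxg : x = g
      · subst hxg
        rw [q5]
        constructor
        · intro h; exact absurd h hl2
        · rintro ⟨h, -⟩; omega
      · by_cases hxj : x = j
        · subst hxj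
          rw [hjg]
          constructor
          · intro h; have := congrFun h l; rw [q3] at this; omega
          · rintro ⟨-, h⟩; omega
        · rw [q6 x hxj (by rw [hjg]; exact hxg)]
          have := k4 x
          have hx1 : x + 1 ≠ g := by
            rw [← hjg]; intro hc; exact hxj (add_right_cancel hc)
          rwa [sne x hxg, sne _ hx1] at this

theorem start_exists' [NeZero t] (hK : Fintype.card K = p ^ t) (hp3 : 3 ≤ p) (hm : 2 ≤ m)
    (s : Fin t → ℕ) (h1 : ∀ j, 1 ≤ s j) (h2 : ∀ j, s j ≤ m) (h3 : ∀ j, s j ≤ p * s (j + 1)) :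
    ∃ n : Fin t → Fin m → ℕ, IsStart K p s n := by
  obtain ⟨g, hg⟩ := Finite.exists_max s
  exact start_exists hK hp3 hm (s g) (h2 g) _ s h1 hg h3 ⟨g, rfl⟩ rfl

end six
end PR

/-! ### Part 7 : graded operators on one digit -/
namespace PR
set_option linter.unusedVariables false
set_option linter.unusedSectionVars false
open Polynomial

section seven
variable {K : Type*} [Field K] [Fintype K] {m : ℕ} {p : ℕ} [Fact p.Prime] [CharP K p] {t : ℕ}

variable (K) in
/-- product of factorials -/
def pf (a : Fin m → ℕ) : K := ∏ i, ((a i).factorial : K)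

variable (K p) in
/-- normalised digit monomial -/
def ev (a α : Fin m → ℕ) : RR K m := (pf K a)⁻¹ • mo a (fun i => p - 1 - α i)

variable (p) in
/-- digit element -/
def psi (ε : K) (a α : Fin m → ℕ) : RR K m := ev K p a α + ε • ev K p α a

variable (p) in
/-- lift of a digit element -/
def PP (u v : Fin m → RR K m) (ε : K) (a α : Fin m → ℕ) : (RR K m)[X] :=
  (pf K a)⁻¹ • Pmo u v a (fun i => p - 1 - α i) +
    (ε * (pf K α)⁻¹) • Pmo u v α (fun i => p - 1 - a i)

variable (p) in
/-- degree of a state -/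
def ldeg (a α : Fin m → ℕ) : ℕ := ∑ i, (a i + (p - 1 - α i))

/-- homogeneous states -/
def Hst (p : ℕ) (ε : K) (a α : Fin m → ℕ) : Prop :=
  (∀ i, a i ≤ p - 1) ∧ (∀ i, α i ≤ p - 1) ∧ (ε = 0 ∨ ∑ i, a i = ∑ i, α i)

lemma ldeg_eq {a α : Fin m → ℕ} (hα : ∀ i, α i ≤ p - 1) :
    (ldeg p a α : ℤ) = ∑ i, (a i : ℤ) + m * ((p - 1 : ℕ) : ℤ) - ∑ i, (α i : ℤ) := by
  unfold ldeg
  push_cast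
  rw [Finset.sum_add_distrib]
  have : ∀ i : Fin m, ((p - 1 - α i : ℕ) : ℤ) = ((p - 1 : ℕ) : ℤ) - α i := fun i => by
    have := hα i; omega
  rw [Finset.sum_congr rfl (fun i _ => this i), Finset.sum_sub_distrib]
  simp; ring

lemma ldeg_swap {a α : Fin m → ℕ} (ha : ∀ i, a i ≤ p - 1) (hα : ∀ i, α i ≤ p - 1)
    (h : ∑ i, a i = ∑ i, α i) : ldeg p α a = ldeg p a α := by
  have h1 := ldeg_eq (p := p) (a := a) hα
  have h2 := ldeg_eq (p := p) (a := α) ha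
  have h3 : (∑ i, (a i : ℤ)) = ∑ i, (α i : ℤ) := by exact_mod_cast h
  zify
  rw [h1, h2, h3]

lemma PP_QQ {Lam : RR K m} (u v : Fin m → RR K m) (hu : ∀ k, ∃ c : K, u k = c • Lam)
    (hv : ∀ k, ∃ c : K, v k = c • Lam) {ε : K} {a α : Fin m → ℕ} (h : Hst p ε a α) :
    QQ Lam (ldeg p a α) (PP p u v ε a α) := by
  obtain ⟨ha, hα, h3⟩ := h
  unfold PP
  refine QQ.add ((Pmo_QQ u v hu hv _ _).smul _) ?_
  rcases h3 with h3 | h3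
  · rw [h3, zero_mul, zero_smul]
    intro n; simp
  · rw [← ldeg_swap ha hα h3]
    exact (Pmo_QQ u v hu hv _ _).smul _

lemma PP_coeff_zero (u v : Fin m → RR K m) (ε : K) (a α : Fin m → ℕ) :
    (PP p u v ε a α).coeff 0 = psi p ε a α := by
  rw [PP, coeff_add, coeff_smul, coeff_smul, Pmo_coeff_zero, Pmo_coeff_zero, psi, ev, ev, mul_smul]

lemma PP_eval (u v : Fin m → RR K m) (ε : K) (a α : Fin m → ℕ) (g : VV K m →ₗ[K] VV K m) (x : K)
    (hX : ∀ k, cmp g (Xc k) = Xc k + x • u k) (hY : ∀ k, cmp g (Yc k) = Yc k + x • v k) :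
    cmp g (psi p ε a α) = (PP p u v ε a α).eval (algebraMap K (RR K m) x) := by
  rw [PP, psi, ev, ev, eval_add, eval_smul, eval_smul, ← Pmo_eval u v _ _ g x hX hY,
    ← Pmo_eval u v _ _ g x hX hY, map_add, map_smul, map_smul, map_smul, mul_smul]

/-- digit elements completing the others to a member of `G` -/
def GS (p : ℕ) [Fact p.Prime] [CharP K p] (j0 : Fin t) (φ : Fin t → RR K m)
    (G : Submodule K (RR K m)) : Submodule K (RR K m) where
  carrier := {f | (∏ j ∈ Finset.univ.erase j0, φ j ^ p ^ (j : ℕ)) * f ^ p ^ (j0 : ℕ) ∈ G}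
  add_mem' := by
    intro f g hf hg
    simp only [Set.mem_ofPred_eq] at *
    rw [add_pow_char_pow, mul_add]
    exact G.add_mem hf hg
  zero_mem' := by
    simp only [Set.mem_ofPred_eq]
    rw [zero_pow (pow_pos (Fact.out : p.Prime).pos _).ne', mul_zero]
    exact G.zero_mem
  smul_mem' := by
    intro c f hf
    simp only [Set.mem_ofPred_eq] at *
    rw [_root_.smul_pow, mul_smul_comm]
    exact G.smul_mem _ hf

lemma mem_GS {j0 : Fin t} {φ : Fin t → RR K m} {G : Submodule K (RR K m)} {f : RR K m} :
    f ∈ GS p j0 φ G ↔ (∏ j ∈ Finset.univ.erase j0, φ j ^ p ^ (j : ℕ)) * f ^ p ^ (j0 : ℕ) ∈ G := Iff.rfl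

lemma mem_GS_update {j0 : Fin t} {φ : Fin t → RR K m} {G : Submodule K (RR K m)} {f : RR K m} :
    f ∈ GS p j0 φ G ↔ ∏ j, (Function.update φ j0 f) j ^ p ^ (j : ℕ) ∈ G := by
  rw [mem_GS, ← Finset.mul_prod_erase _ _ (Finset.mem_univ j0), Function.update_self, mul_comm]
  rw [Finset.prod_congr rfl (fun j hj => ?_)]
  rw [Function.update_of_ne (Finset.ne_of_mem_erase hj)]

variable (K m p t) in
/-- context: the states of all digits -/
structure Ctx where
  ε : Fin t → K
  a : Fin t → Fin m → ℕ
  α : Fin t → Fin m → ℕ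

/-- total degree -/
def Ctx.w (c : Ctx K m t) (p : ℕ) : ℕ := ∑ j, ldeg p (c.a j) (c.α j)

/-- total element -/
def Ctx.tot (p : ℕ) (c : Ctx K m t) : RR K m :=
  ∏ j, psi p (c.ε j) (c.a j) (c.α j) ^ p ^ (j : ℕ)

/-- digit space for a context -/
def Ctx.gs (p : ℕ) [Fact p.Prime] [CharP K p] (c : Ctx K m t) (j0 : Fin t) : Submodule K (RR K m) :=
  GS p j0 (fun j => psi p (c.ε j) (c.a j) (c.α j)) (UU K m ⊔ NN K m p (c.w p))

/-- all states homogeneous -/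
def Ctx.ok (p : ℕ) (c : Ctx K m t) : Prop := ∀ j, Hst p (c.ε j) (c.a j) (c.α j)

lemma Ctx.op {c : Ctx K m t} (hc : c.ok p) (hK : Fintype.card K = p ^ t) (hp3 : 3 ≤ p) (j0 : Fin t)
    (g : K → VV K m →ₗ[K] VV K m) (hg : ∀ x, IsIsom (g x)) (u v : Fin m → RR K m)
    (hX : ∀ x k, cmp (g x) (Xc k) = Xc k + x • u k) (hY : ∀ x k, cmp (g x) (Yc k) = Yc k + x • v k)
    (Lam : RR K m) (hL : Lam ∈ MM K m)
    (hu : ∀ k, ∃ c : K, u k = c • Lam) (hv : ∀ k, ∃ c : K, v k = c • Lam)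
    {a α : Fin m → ℕ} (hst : Hst p (c.ε j0) a α) (hdeg : ldeg p a α = ldeg p (c.a j0) (c.α j0))
    (h : psi p (c.ε j0) a α ∈ c.gs p j0) : (PP p u v (c.ε j0) a α).coeff 1 ∈ c.gs p j0 := by
  set φ : Fin t → RR K m := fun j => psi p (c.ε j) (c.a j) (c.α j) with hφ
  set P0 : Fin t → (RR K m)[X] := fun j => PP p u v (c.ε j) (c.a j) (c.α j) with hP0
  have key := op_graded hK hp3 j0 g hg (Function.update φ j0 (psi p (c.ε j0) a α))
    (Function.update P0 j0 (PP p u v (c.ε j0) a α)) ?_ Lam hL (fun j => ldeg p (c.a j) (c.α j)) ?_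
    (mem_GS_update.1 h)
  · refine mem_GS_update.2 ?_
    convert key using 2 with j
    congr 1
    by_cases hj : j = j0
    · subst hj; simp
    · rw [Function.update_of_ne hj, Function.update_of_ne hj, if_neg hj, hP0, PP_coeff_zero]
  · intro j x
    by_cases hj : j = j0
    · subst hj
      rw [Function.update_self, Function.update_self]
      exact PP_eval u v _ _ _ _ x (hX x) (hY x)
    · rw [Function.update_of_ne hj, Function.update_of_ne hj]
      exact PP_eval u v _ _ _ _ x (hX x) (hY x)
  · intro j
    by_cases hj : j = j0
    · subst hj
      rw [Function.update_self]
      have := PP_QQ u v hu hv hst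
      rwa [hdeg] at this
    · rw [Function.update_of_ne hj]
      exact PP_QQ u v hu hv (hc j)

lemma psi_frob {ε : K} {a α : Fin m → ℕ} (h : Hst p ε a α) (j : ℕ) :
    psi p ε a α ^ p ^ j ∈ NN K m p (ldeg p a α + 1) := by
  obtain ⟨ha, hα, h3⟩ := h
  refine frob_mem_pow ?_ j
  unfold psi ev
  refine Submodule.add_mem _ (Submodule.smul_mem _ _ (mo_mem _ _)) ?_
  rcases h3 with h3 | h3
  · rw [h3, zero_smul]; exact Submodule.zero_mem _
  · rw [← ldeg_swap ha hα h3]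
    exact Submodule.smul_mem _ _ (Submodule.smul_mem _ _ (mo_mem _ _))

lemma Ctx.lower {c : Ctx K m t} (hc : c.ok p) (j0 : Fin t) {f : RR K m}
    (hf : f ^ p ^ (j0 : ℕ) ∈ NN K m p (ldeg p (c.a j0) (c.α j0))) : f ∈ c.gs p j0 := by
  refine mem_GS_update.2 (Submodule.mem_sup_right ?_)
  refine NN_prod_lt _ _ (fun j => ldeg p (c.a j) (c.α j)) (fun j _ => ?_) j0 (Finset.mem_univ _) ?_
  · by_cases hj : j = j0
    · subst hj
      rw [Function.update_self]
      exact NN_mono (Nat.le_succ _) hf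
    · rw [Function.update_of_ne hj]
      exact psi_frob (hc j) j
  · rwa [Function.update_self]

lemma mo_frob_lt {a b : Fin m → ℕ} (l : Fin m) (hl : p ≤ b l) (j : ℕ) :
    (mo a b : RR K m) ^ p ^ j ∈ NN K m p (∑ i, (a i + b i)) := by
  have h : mo a b ∈ HH (Yc l : RR K m) (∑ i, (a i + b i)) p := by
    have hle : p ≤ ∑ i, (a i + b i) := by
      have := Finset.single_le_sum (f := fun i => a i + b i) (fun i _ => Nat.zero_le _) (Finset.mem_univ l)
      omega
    unfold HH
    rw [if_pos hle]
    have e : b = Pi.single l p + (b - Pi.single l p) := by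
      funext i
      by_cases hi : i = l
      · subst hi; simp; omega
      · simp [hi]
    have e2 : (mo a b : RR K m) = Yc l ^ p * mo a (b - Pi.single l p) := by
      rw [← mo_single_y, mo_mul, zero_add, ← e]
    rw [e2]
    refine Submodule.mul_mem_mul (Submodule.mem_span_singleton_self _) ?_
    have h3 := mo_mem (K := K) a (b - Pi.single l p)
    convert h3 using 2
    have : ∑ i, (a i + b i) = ∑ i, (a i + ((b - Pi.single l p : Fin m → ℕ)) i) + p := by
      conv_lhs => rw [e]
      simp only [Pi.add_apply, Finset.sum_add_distrib, Finset.sum_pi_single', Finset.mem_univ, if_true]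
      omega
    omega
  exact HH_frob_lt (Y_mem l) h le_rfl j

variable (K p) in
/-- the summand `X_k ↦ Y_l` of a shear operator -/
def Mkl (k l : Fin m) (a α : Fin m → ℕ) : RR K m :=
  ((pf K a)⁻¹ * (a k : K)) • mo (a - Pi.single k 1) ((fun i => p - 1 - α i) + Pi.single l 1)

variable (p) in
def Tkl (ε : K) (k l : Fin m) (a α : Fin m → ℕ) : RR K m :=
  Mkl K p k l a α + ε • Mkl K p l k α a

/-- rank one symmetric matrix of a set -/
def BS (S : Finset (Fin m)) : Matrix (Fin m) (Fin m) K := fun x y => if x ∈ S ∧ y ∈ S then 1 else 0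

lemma BS_symm (x : K) (S : Finset (Fin m)) : (x • BS S : Matrix (Fin m) (Fin m) K).IsSymm := by
  ext i j
  simp only [BS, Matrix.transpose_apply, Matrix.smul_apply]
  congr 2
  exact propext (by tauto)

lemma Ctx.op_x {c : Ctx K m t} (hc : c.ok p) (hK : Fintype.card K = p ^ t) (hp3 : 3 ≤ p) (j0 : Fin t)
    (S : Finset (Fin m))
    {a α : Fin m → ℕ} (hst : Hst p (c.ε j0) a α) (hdeg : ldeg p a α = ldeg p (c.a j0) (c.α j0))
    (h : psi p (c.ε j0) a α ∈ c.gs p j0) :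
    ∑ k ∈ S, ∑ l ∈ S, Tkl p (c.ε j0) k l a α ∈ c.gs p j0 := by
  set Lam : RR K m := ∑ l ∈ S, Yc l with hLam
  set u : Fin m → RR K m := fun k => if k ∈ S then Lam else 0 with hu
  have key := Ctx.op hc hK hp3 j0 (fun x => shx (x • BS S)) (fun x => shx_isom (BS_symm x S)) u 0
    (by
      intro x k
      rw [cmp_shx_X]
      congr 1
      simp only [hu, hLam, Matrix.smul_apply, BS]
      by_cases hk : k ∈ S
      · simp only [hk, true_and, if_true, Finset.smul_sum, smul_eq_mul, mul_ite, mul_one, mul_zero, ite_smul, zero_smul]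
        rw [Finset.sum_ite_mem, Finset.univ_inter]
      · simp [hk])
    (by intro x k; rw [cmp_shx_Y]; simp)
    Lam (Submodule.sum_mem _ fun l _ => Y_mem l)
    (by
      intro k
      by_cases hk : k ∈ S
      · exact ⟨1, by simp [hu, hk]⟩
      · exact ⟨0, by simp [hu, hk]⟩)
    (fun k => ⟨0, by simp⟩) hst hdeg h
  have hone : ∀ a b : Fin m → ℕ, (Pmo u 0 a b).coeff 1 =
      ∑ k ∈ S, ∑ l ∈ S, (a k : K) • (mo (a - Pi.single k 1) (b + Pi.single l 1) : RR K m) := by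
    intro a b
    rw [Pmo_coeff_one']
    simp only [hu, Pi.zero_apply, mul_zero, smul_zero, add_zero, mul_ite, smul_ite]
    rw [Finset.sum_ite_mem, Finset.univ_inter]
    refine Finset.sum_congr rfl fun k _ => ?_
    rw [hLam, Finset.mul_sum, Finset.smul_sum]
    refine Finset.sum_congr rfl fun l _ => ?_
    rw [← pow_one (Yc l), ← mo_single_y, mo_mul, add_zero]
  convert key using 1
  rw [PP, coeff_add, coeff_smul, coeff_smul, hone, hone, Finset.smul_sum, Finset.smul_sum]
  conv_rhs => 
    rhs
    simp only [Finset.smul_sum]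
    rw [Finset.sum_comm]
  rw [← Finset.sum_add_distrib]
  refine Finset.sum_congr rfl fun k _ => ?_
  rw [Finset.smul_sum, ← Finset.sum_add_distrib]
  refine Finset.sum_congr rfl fun l _ => ?_
  simp only [Tkl, Mkl, mul_smul]

end seven
end PR

/-! ### Part 8 : changing one digit -/
namespace PR
set_option linter.unusedVariables false
set_option linter.unusedSectionVars false
open Polynomial

section eight
variable {K : Type*} [Field K] [Fintype K] {m : ℕ} {p : ℕ} [Fact p.Prime] [CharP K p] {t : ℕ}

lemma pf_ne {a : Fin m → ℕ} (ha : ∀ i, a i ≤ p - 1) : pf K a ≠ 0 := by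
  unfold pf
  rw [Finset.prod_ne_zero_iff]
  intro i _
  have hp := (Fact.out : p.Prime)
  have := ha i
  have hpos := hp.pos
  rw [Ne, CharP.cast_eq_zero_iff K p, hp.dvd_factorial]
  omega

lemma pf_add (a : Fin m → ℕ) (k : Fin m) : pf K (a + Pi.single k 1) = (a k + 1 : ℕ) * pf K a := by
  unfold pf
  rw [← Finset.mul_prod_erase _ _ (Finset.mem_univ k), ← Finset.mul_prod_erase _ _ (Finset.mem_univ k)]
  simp only [Pi.add_apply, Pi.single_eq_same, Nat.factorial_succ]
  push_cast
  rw [mul_assoc]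
  congr 2
  refine Finset.prod_congr rfl fun i hi => ?_
  rw [Pi.single_eq_of_ne (Finset.ne_of_mem_erase hi), add_zero]

lemma sub_single {a : Fin m → ℕ} {k : Fin m} (h : 1 ≤ a k) : (a - Pi.single k 1) + Pi.single k 1 = a := by
  funext i
  by_cases hi : i = k
  · subst hi; simp; omega
  · simp [hi]

lemma Mkl_eval {k l : Fin m} {a α : Fin m → ℕ} (ha : ∀ i, a i ≤ p - 1) (hα : ∀ i, α i ≤ p - 1)
    (hk : 1 ≤ a k) (hl : 1 ≤ α l) :
    Mkl K p k l a α = ev K p (a - Pi.single k 1) (α - Pi.single l 1) := by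
  unfold Mkl ev
  have hpp := (Fact.out : p.Prime).pos
  have h1 : (a k : K) ≠ 0 := cast_ne_zero_of_lt (p := p) (by omega) (by have := ha k; omega)
  have h2 : pf K a = (a k : K) * pf K (a - Pi.single k 1) := by
    conv_lhs => rw [← sub_single hk]
    rw [pf_add]
    congr 2
    simp; omega
  congr 1
  · rw [h2, mul_inv, mul_comm, ← mul_assoc, mul_inv_cancel₀ h1, one_mul]
  · congr 1
    funext i
    have := hα i
    by_cases hi : i = l
    · subst hi; simp; omega
    · simp [hi]

lemma Tkl_eval {ε : K} {k l : Fin m} {a α : Fin m → ℕ} (ha : ∀ i, a i ≤ p - 1) (hα : ∀ i, α i ≤ p - 1)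
    (hk : 1 ≤ a k) (hl : 1 ≤ α l) :
    Tkl p ε k l a α = psi p ε (a - Pi.single k 1) (α - Pi.single l 1) := by
  rw [Tkl, psi, Mkl_eval ha hα hk hl, Mkl_eval hα ha hl hk]

lemma Mkl_lower {c : Ctx K m t} (hc : c.ok p) (j0 : Fin t) {k l : Fin m} {a α : Fin m → ℕ}
    (hdeg : ldeg p a α = ldeg p (c.a j0) (c.α j0))
    (h : a k = 0 ∨ α l = 0) : Mkl K p k l a α ∈ c.gs p j0 := by
  unfold Mkl
  by_cases hk : a k = 0
  · rw [hk, Nat.cast_zero, mul_zero, zero_smul]; exact Submodule.zero_mem _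
  · have hl : α l = 0 := by tauto
    refine Submodule.smul_mem _ _ (Ctx.lower hc j0 ?_)
    have hpp := (Fact.out : p.Prime).pos
    have h3 := mo_frob_lt (K := K) (p := p) (a := a - Pi.single k 1)
      (b := (fun i => p - 1 - α i) + Pi.single l 1) l (by simp [hl]; omega) j0
    convert h3 using 2
    rw [← hdeg, ldeg]
    conv_lhs => rw [← sub_single (a := a) (k := k) (by omega)]
    simp only [Pi.add_apply, Finset.sum_add_distrib, Finset.sum_pi_single', Finset.mem_univ, if_true]
    omega

lemma Tkl_lower {c : Ctx K m t} (hc : c.ok p) (j0 : Fin t) {k l : Fin m} {a α : Fin m → ℕ}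
    (hst : Hst p (c.ε j0) a α) (hdeg : ldeg p a α = ldeg p (c.a j0) (c.α j0))
    (h : a k = 0 ∨ α l = 0) : Tkl p (c.ε j0) k l a α ∈ c.gs p j0 := by
  unfold Tkl
  refine Submodule.add_mem _ (Mkl_lower hc j0 hdeg h) ?_
  rcases hst.2.2 with h0 | h0
  · rw [h0, zero_smul]; exact Submodule.zero_mem _
  · exact Submodule.smul_mem _ _ (Mkl_lower hc j0 (by rw [← hdeg, ldeg_swap hst.1 hst.2.1 h0]) h.symm)

lemma Ctx.op_T {c : Ctx K m t} (hc : c.ok p) (hK : Fintype.card K = p ^ t) (hp3 : 3 ≤ p) (j0 : Fin t)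
    {i l : Fin m} (hil : i ≠ l)
    {a α : Fin m → ℕ} (hst : Hst p (c.ε j0) a α) (hdeg : ldeg p a α = ldeg p (c.a j0) (c.α j0))
    (h : psi p (c.ε j0) a α ∈ c.gs p j0) :
    Tkl p (c.ε j0) i l a α + Tkl p (c.ε j0) l i a α ∈ c.gs p j0 := by
  have h1 := Ctx.op_x hc hK hp3 j0 {i, l} hst hdeg h
  have h2 := Ctx.op_x hc hK hp3 j0 {i} hst hdeg h
  have h3 := Ctx.op_x hc hK hp3 j0 {l} hst hdeg h
  simp only [Finset.sum_pair hil] at h1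
  simp only [Finset.sum_singleton] at h2 h3
  have := Submodule.sub_mem _ (Submodule.sub_mem _ h1 h2) h3
  convert this using 1
  abel

lemma Ctx.op_F {c : Ctx K m t} (hc : c.ok p) (hK : Fintype.card K = p ^ t) (hp3 : 3 ≤ p) (j0 : Fin t)
    {i : Fin m} {a α : Fin m → ℕ} (hst : Hst p (c.ε j0) a α)
    (hdeg : ldeg p a α = ldeg p (c.a j0) (c.α j0)) (h1 : 1 ≤ a i) (h2 : 1 ≤ α i)
    (h : psi p (c.ε j0) a α ∈ c.gs p j0) :
    psi p (c.ε j0) (a - Pi.single i 1) (α - Pi.single i 1) ∈ c.gs p j0 := by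
  have h3 := Ctx.op_x hc hK hp3 j0 {i} hst hdeg h
  simp only [Finset.sum_singleton] at h3
  rwa [Tkl_eval hst.1 hst.2.1 h1 h2] at h3

lemma Ctx.op_E {c : Ctx K m t} (hc : c.ok p) (hK : Fintype.card K = p ^ t) (hp3 : 3 ≤ p) (j0 : Fin t)
    {i : Fin m} {a α : Fin m → ℕ} (hst : Hst p (c.ε j0) a α)
    (hdeg : ldeg p a α = ldeg p (c.a j0) (c.α j0)) (h1 : a i < p - 1) (h2 : α i < p - 1)
    (h : psi p (c.ε j0) a α ∈ c.gs p j0) :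
    psi p (c.ε j0) (a + Pi.single i 1) (α + Pi.single i 1) ∈ c.gs p j0 := by
  set v : Fin m → RR K m := fun k => if k = i then Xc i else 0 with hv
  have key := Ctx.op hc hK hp3 j0 (fun x => shy (x • BS {i})) (fun x => shy_isom (BS_symm x {i})) 0 v
    (by intro x k; rw [cmp_shy_X]; simp)
    (by
      intro x k
      rw [cmp_shy_Y]
      congr 1
      simp only [hv, Matrix.smul_apply, BS]
      by_cases hk : k = i
      · simp [hk]
      · simp [hk])
    (Xc i) (X_mem i) (fun k => ⟨0, by simp⟩)
    (by
      intro k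
      by_cases hk : k = i
      · exact ⟨1, by simp [hv, hk]⟩
      · exact ⟨0, by simp [hv, hk]⟩) hst hdeg h
  have hone : ∀ a b : Fin m → ℕ, (Pmo 0 v a b).coeff 1 =
      (b i : K) • (mo (a + Pi.single i 1) (b - Pi.single i 1) : RR K m) := by
    intro a b
    rw [Pmo_coeff_one']
    simp only [hv, Pi.zero_apply, mul_zero, smul_zero, zero_add, mul_ite, smul_ite]
    rw [Finset.sum_ite_eq' Finset.univ i, if_pos (Finset.mem_univ _)]
    rw [← pow_one (Xc i), ← mo_single_x, mo_mul, add_zero]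
  have hstep : ∀ a α : Fin m → ℕ, a i < p - 1 → α i < p - 1 → (∀ k, a k ≤ p - 1) → (∀ k, α k ≤ p - 1) →
      (pf K a)⁻¹ • (Pmo 0 v a (fun i => p - 1 - α i)).coeff 1 =
      (-(((α i + 1 : ℕ) : K) * ((a i + 1 : ℕ) : K))) • ev K p (a + Pi.single i 1) (α + Pi.single i 1) := by
    intro a α h1 h2 ha hα
    rw [hone, ev, smul_smul, smul_smul, pf_add]
    have h5 : ((a i + 1 : ℕ) : K) ≠ 0 := cast_ne_zero_of_lt (p := p) (by omega) (by omega)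
    congr 1
    · have h3 : ((p - 1 - α i : ℕ) : K) = -((α i + 1 : ℕ) : K) := by
        rw [eq_neg_iff_add_eq_zero, ← Nat.cast_add, CharP.cast_eq_zero_iff K p]
        have : p - 1 - α i + (α i + 1) = p := by omega
        rw [this]
      rw [h3, mul_inv]
      field_simp
    · congr 1
      funext k
      by_cases hk : k = i
      · subst hk; simp; omega
      · simp [hk]
  have e : (PP p 0 v (c.ε j0) a α).coeff 1 = (-(((α i + 1 : ℕ) : K) * ((a i + 1 : ℕ) : K))) •
      psi p (c.ε j0) (a + Pi.single i 1) (α + Pi.single i 1) := by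
    rw [PP, coeff_add, coeff_smul, coeff_smul, mul_smul, hstep a α h1 h2 hst.1 hst.2.1,
      hstep α a h2 h1 hst.2.1 hst.1, psi, smul_add, smul_comm (c.ε j0)]
    congr 2
    rw [mul_comm]
  rw [e] at key
  refine (Submodule.smul_mem_iff _ ?_).1 key
  rw [neg_ne_zero]
  exact mul_ne_zero (cast_ne_zero_of_lt (p := p) (by omega) (by omega))
    (cast_ne_zero_of_lt (p := p) (by omega) (by omega))

/-- all states with difference `d` belong to the digit space -/
def St (p : ℕ) [Fact p.Prime] [CharP K p] (c : Ctx K m t) (j0 : Fin t) (d : Fin m → ℤ) : Prop :=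
  ∀ a α : Fin m → ℕ, (∀ i, a i ≤ p - 1) → (∀ i, α i ≤ p - 1) → (∀ i, (a i : ℤ) - α i = d i) →
    psi p (c.ε j0) a α ∈ c.gs p j0

/-- degree of a difference -/
def SumOK (p : ℕ) (c : Ctx K m t) (j0 : Fin t) (d : Fin m → ℤ) : Prop :=
  ∑ i, d i = ∑ i, ((c.a j0 i : ℤ) - c.α j0 i)

lemma SumOK.spec {c : Ctx K m t} (hc : c.ok p) {j0 : Fin t} {d : Fin m → ℤ} (h : SumOK p c j0 d)
    {a α : Fin m → ℕ} (ha : ∀ i, a i ≤ p - 1) (hα : ∀ i, α i ≤ p - 1)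
    (hd : ∀ i, (a i : ℤ) - α i = d i) :
    Hst p (c.ε j0) a α ∧ ldeg p a α = ldeg p (c.a j0) (c.α j0) := by
  obtain ⟨c1, c2, c3⟩ := hc j0
  have h1 : ∑ i, ((a i : ℤ) - α i) = ∑ i, ((c.a j0 i : ℤ) - c.α j0 i) := by
    rw [← h]; exact Finset.sum_congr rfl fun i _ => hd i
  rw [Finset.sum_sub_distrib, Finset.sum_sub_distrib] at h1
  refine ⟨⟨ha, hα, ?_⟩, ?_⟩
  · rcases c3 with c3 | c3
    · exact Or.inl c3
    · right
      have : (∑ i, (c.a j0 i : ℤ)) = ∑ i, (c.α j0 i : ℤ) := by exact_mod_cast c3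
      have h2 : (∑ i, (a i : ℤ)) = ∑ i, (α i : ℤ) := by omega
      exact_mod_cast h2
  · zify
    rw [ldeg_eq hα, ldeg_eq c2]
    omega

lemma St.of_one {c : Ctx K m t} (hc : c.ok p) (hK : Fintype.card K = p ^ t) (hp3 : 3 ≤ p) {j0 : Fin t}
    {d : Fin m → ℤ} (hS : SumOK p c j0 d) {a1 α1 : Fin m → ℕ} (ha1 : ∀ i, a1 i ≤ p - 1)
    (hα1 : ∀ i, α1 i ≤ p - 1) (hd1 : ∀ i, (a1 i : ℤ) - α1 i = d i) 
    (N : ℕ) : ∀ a α : Fin m → ℕ, (∀ i, a i ≤ p - 1) → (∀ i, α i ≤ p - 1) → (∀ i, (a i : ℤ) - α i = d i) →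
      ∑ i, ((a i - a1 i) + (a1 i - a i)) = N →
      psi p (c.ε j0) a α ∈ c.gs p j0 → psi p (c.ε j0) a1 α1 ∈ c.gs p j0 := by
  induction N using Nat.strong_induction_on with
  | _ N ih =>
  intro a α ha hα hd hN h
  obtain ⟨hst, hdeg⟩ := hS.spec hc ha hα hd
  by_cases h1 : ∃ i, a1 i ≠ a i
  · obtain ⟨i, hi⟩ := h1
    have e1 := hd i
    have e2 := hd1 i
    rcases Nat.lt_or_gt_of_ne hi with hi | hi
    · have h2 := Ctx.op_F hc hK hp3 j0 (i := i) hst hdeg (by omega) (by omega) h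
      refine ih _ ?_ _ _ ?_ ?_ ?_ rfl h2
      · rw [← hN]
        apply Finset.sum_lt_sum
        · intro k _
          by_cases hk : k = i
          · subst hk; simp; omega
          · simp [hk]
        · refine ⟨i, Finset.mem_univ _, ?_⟩
          simp; omega
      · intro k; have := ha k; simp only [Pi.sub_apply]; omega
      · intro k; have := hα k; simp only [Pi.sub_apply]; omega
      · intro k
        have := hd k
        by_cases hk : k = i
        · subst hk; simp; omega
        · simpa [hk] using this
    · have b1 := ha1 i
      have b2 := hα1 i
      have h2 := Ctx.op_E hc hK hp3 j0 (i := i) hst hdeg (by omega) (by omega) h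
      refine ih _ ?_ _ _ ?_ ?_ ?_ rfl h2
      · rw [← hN]
        apply Finset.sum_lt_sum
        · intro k _
          by_cases hk : k = i
          · subst hk; simp; omega
          · simp [hk]
        · refine ⟨i, Finset.mem_univ _, ?_⟩
          simp; omega
      · intro k
        have := ha k
        by_cases hk : k = i
        · subst hk; simp; omega
        · simpa [hk] using this
      · intro k
        have := hα k
        by_cases hk : k = i
        · subst hk; simp; omega
        · simpa [hk] using this
      · intro k
        have := hd k
        by_cases hk : k = i
        · subst hk; simp; omega
        · simpa [hk] using this
  · push Not at h1
    have e1 : a1 = a := funext h1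
    have e2 : α1 = α := by
      funext i
      have := hd i; have := hd1 i; have := h1 i; omega
    rwa [e1, e2]

end eight
end PR

/-! ### Part 9 : transfers between differences -/
namespace PR
set_option linter.unusedVariables false
set_option linter.unusedSectionVars false
open Polynomial

section nine
variable {K : Type*} [Field K] [Fintype K] {m : ℕ} {p : ℕ} [Fact p.Prime] [CharP K p] {t : ℕ}

/-- move one unit from `i` to `l` -/
def mvd (d : Fin m → ℤ) (i l : Fin m) : Fin m → ℤ :=
  fun k => d k - (if k = i then 1 else 0) + (if k = l then 1 else 0)

lemma mvd_i {d : Fin m → ℤ} {i l : Fin m} (h : i ≠ l) : mvd d i l i = d i - 1 := by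
  simp [mvd, h]
lemma mvd_l {d : Fin m → ℤ} {i l : Fin m} (h : i ≠ l) : mvd d i l l = d l + 1 := by
  simp [mvd, h.symm]
lemma mvd_k {d : Fin m → ℤ} {i l k : Fin m} (h : k ≠ i) (h' : k ≠ l) : mvd d i l k = d k := by
  simp [mvd, h, h']

lemma SumOK.mvd {c : Ctx K m t} {j0 : Fin t} {d : Fin m → ℤ} (h : SumOK p c j0 d) (i l : Fin m) :
    SumOK p c j0 (mvd d i l) := by
  unfold SumOK PR.mvd at *
  rw [Finset.sum_add_distrib, Finset.sum_sub_distrib]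
  simp [h]

/-- box condition -/
def Box (p : ℕ) (d : Fin m → ℤ) : Prop := ∀ i, -((p : ℤ) - 1) ≤ d i ∧ d i ≤ (p : ℤ) - 1

lemma Box.mvd {d : Fin m → ℤ} (h : Box p d) {i l : Fin m} (hil : i ≠ l)
    (h1 : -((p : ℤ) - 1) < d i) (h2 : d l < (p : ℤ) - 1) : Box p (mvd d i l) := by
  intro k
  have hk := h k
  by_cases hi : k = i
  · subst hi; rw [mvd_i hil]; omega
  · by_cases hl : k = l
    · subst hl; rw [mvd_l hil]; omega
    · rw [mvd_k hi hl]; exact hk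

lemma St.move {c : Ctx K m t} (hc : c.ok p) (hK : Fintype.card K = p ^ t) (hp3 : 3 ≤ p) {j0 : Fin t}
    {d : Fin m → ℤ} (hS : SumOK p c j0 d) (hd : St p c j0 d) {i l : Fin m} (hil : i ≠ l)
    {a α : Fin m → ℕ} (ha : ∀ i, a i ≤ p - 1) (hα : ∀ i, α i ≤ p - 1)
    (had : ∀ i, (a i : ℤ) - α i = d i) (h1 : 1 ≤ a i) (h2 : 1 ≤ α l)
    (hT : Tkl p (c.ε j0) l i a α ∈ c.gs p j0) : St p c j0 (mvd d i l) := by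
  obtain ⟨hst, hdeg⟩ := hS.spec hc ha hα had
  have h3 := Ctx.op_T hc hK hp3 j0 hil hst hdeg (hd a α ha hα had)
  have h4 := (Submodule.add_mem_iff_left _ hT).1 h3
  rw [Tkl_eval ha hα h1 h2] at h4
  intro a1 α1 ha1 hα1 hd1
  refine St.of_one hc hK hp3 (hS.mvd i l) ha1 hα1 hd1 _ _ _ ?_ ?_ ?_ rfl h4
  · intro k; have := ha k; simp only [Pi.sub_apply]; omega
  · intro k; have := hα k; simp only [Pi.sub_apply]; omega
  · intro k
    have := had k
    by_cases hi : k = i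
    · subst hi; rw [mvd_i hil]; simp [hil]; omega
    · by_cases hl : k = l
      · subst hl; rw [mvd_l hil]; simp [hi]; omega
      · rw [mvd_k hi hl]; simp [hi, hl]; omega

/-- a state with a given difference, raised where `r` says so -/
lemma exists_state {d : Fin m → ℤ} (hb : Box p d) (hp3 : 3 ≤ p) (r : Fin m → Prop)
    (hr : ∀ k, r k → -((p : ℤ) - 1) < d k ∧ d k < (p : ℤ) - 1) :
    ∃ a α : Fin m → ℕ, (∀ i, a i ≤ p - 1) ∧ (∀ i, α i ≤ p - 1) ∧ (∀ i, (a i : ℤ) - α i = d i) ∧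
      (∀ i, r i → 1 ≤ a i ∧ 1 ≤ α i) ∧ (∀ i, ¬ r i → (0 ≤ d i → α i = 0) ∧ (d i ≤ 0 → a i = 0)) := by
  refine ⟨fun k => (d k).toNat + if r k then 1 else 0, fun k => (- d k).toNat + if r k then 1 else 0,
    ?_, ?_, ?_, ?_, ?_⟩
  · intro k
    have := hb k
    dsimp only
    split_ifs with h
    · have := hr k h; omega
    · omega
  · intro k
    have := hb k
    dsimp only
    split_ifs with h
    · have := hr k h; omega
    · omega
  · intro k
    dsimp only
    split_ifs with h <;> omega
  · intro k h
    dsimp only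
    rw [if_pos h]; omega
  · intro k h
    dsimp only
    rw [if_neg h]; omega

lemma St.iso {c : Ctx K m t} (hc : c.ok p) (hK : Fintype.card K = p ^ t) (hp3 : 3 ≤ p) {j0 : Fin t}
    {d : Fin m → ℤ} (hb : Box p d) (hS : SumOK p c j0 d) (hd : St p c j0 d) {i l : Fin m} (hil : i ≠ l)
    (h1 : -((p : ℤ) - 1) < d i) (h2 : d l < (p : ℤ) - 1) (h : d l < 0 ∨ 0 < d i) :
    St p c j0 (mvd d i l) := by
  rcases h with h | h
  · obtain ⟨a, α, ha, hα, had, hr1, hr2⟩ := exists_state hb hp3 (fun k => k = i ∧ d i ≤ 0) (by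
      rintro k ⟨rfl, hk⟩; omega)
    obtain ⟨hst, hdeg⟩ := hS.spec hc ha hα had
    have e1 := had i
    have e2 := had l
    have f2 := hr2 l (fun hh => hil hh.1.symm)
    refine St.move hc hK hp3 hS hd hil ha hα had ?_ (by omega)
      (Tkl_lower hc j0 hst hdeg (Or.inl (by omega)))
    by_cases h0 : d i ≤ 0
    · exact (hr1 i ⟨rfl, h0⟩).1
    · omega
  · obtain ⟨a, α, ha, hα, had, hr1, hr2⟩ := exists_state hb hp3 (fun k => k = l ∧ 0 ≤ d l) (by
      rintro k ⟨rfl, hk⟩; omega)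
    obtain ⟨hst, hdeg⟩ := hS.spec hc ha hα had
    have e1 := had i
    have e2 := had l
    have f2 := hr2 i (fun hh => hil hh.1)
    refine St.move hc hK hp3 hS hd hil ha hα had (by omega) ?_
      (Tkl_lower hc j0 hst hdeg (Or.inr (by omega)))
    by_cases h0 : 0 ≤ d l
    · exact (hr1 l ⟨rfl, h0⟩).2
    · omega

lemma St.basic {c : Ctx K m t} (hc : c.ok p) (hK : Fintype.card K = p ^ t) (hp3 : 3 ≤ p) {j0 : Fin t}
    {d : Fin m → ℤ} (hb : Box p d) (hS : SumOK p c j0 d) (hd : St p c j0 d) {i l : Fin m} (hil : i ≠ l)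
    (h1 : -((p : ℤ) - 1) < d i) (h2 : d l < (p : ℤ) - 1) (h : ¬ (d i = 0 ∧ d l = 0)) :
    St p c j0 (mvd d i l) := by
  by_cases h3 : d l < 0 ∨ 0 < d i
  · exact St.iso hc hK hp3 hb hS hd hil h1 h2 h3
  · have h4 := St.iso hc hK hp3 hb hS hd hil.symm (by omega) (by omega) (by omega)
    obtain ⟨a, α, ha, hα, had, hr1, hr2⟩ := exists_state hb hp3 (fun k => k = i ∨ k = l) (by
      rintro k (rfl | rfl) <;> omega)
    obtain ⟨hst, hdeg⟩ := hS.spec hc ha hα had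
    have ri := hr1 i (Or.inl rfl)
    have rl := hr1 l (Or.inr rfl)
    refine St.move hc hK hp3 hS hd hil ha hα had ri.1 rl.2 ?_
    rw [Tkl_eval ha hα rl.1 ri.2]
    apply h4
    · intro k; have := ha k; simp only [Pi.sub_apply]; omega
    · intro k; have := hα k; simp only [Pi.sub_apply]; omega
    · intro k
      have := had k
      by_cases hi : k = i
      · subst hi; rw [mvd_l hil.symm]; simp [hil]; omega
      · by_cases hl : k = l
        · subst hl; rw [mvd_i hil.symm]; simp [hi]; omega
        · rw [mvd_k hl hi]; simp [hi, hl]; omega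

lemma mvd_mvd (d : Fin m → ℤ) (l k i : Fin m) : mvd (mvd d l k) k i = mvd d l i := by
  funext x; simp only [mvd]; ring

lemma mvd_mvd' (d : Fin m → ℤ) (l k i : Fin m) : mvd (mvd d k i) l k = mvd d l i := by
  funext x; simp only [mvd]; ring

theorem St.transfer {c : Ctx K m t} (hc : c.ok p) (hK : Fintype.card K = p ^ t) (hp3 : 3 ≤ p) {j0 : Fin t}
    {d : Fin m → ℤ} (hb : Box p d) (hS : SumOK p c j0 d) (hd : St p c j0 d) {l i : Fin m} (hil : l ≠ i)
    (h1 : -((p : ℤ) - 1) < d l) (h2 : d i < (p : ℤ) - 1) (h : d ≠ 0 ∨ c.ε j0 = 1) :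
    St p c j0 (mvd d l i) := by
  by_cases h0 : d l = 0 ∧ d i = 0
  swap
  · exact St.basic hc hK hp3 hb hS hd hil h1 h2 h0
  by_cases hd0 : d = 0
  · have hε : c.ε j0 = 1 := by tauto
    subst hd0
    obtain ⟨a, α, ha, hα, had, hr1, hr2⟩ := exists_state hb hp3 (fun k => k = i ∨ k = l) (by
      rintro k (rfl | rfl) <;> simp <;> omega)
    have haα : a = α := by
      funext k
      have := had k
      simp only [Pi.zero_apply] at this
      omega
    subst haα
    obtain ⟨hst, hdeg⟩ := hS.spec hc ha hα had
    have h3 := Ctx.op_T hc hK hp3 j0 hil hst hdeg (hd a a ha hα had)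
    have h4 : Tkl p (c.ε j0) i l a a = Tkl p (c.ε j0) l i a a := by
      rw [hε]; simp only [Tkl, one_smul]; rw [add_comm]
    rw [h4, ← two_smul K] at h3
    have h5 : (2 : K) ≠ 0 := by
      have := cast_ne_zero_of_lt (K := K) (p := p) (n := 2) (by omega) (by omega)
      exact_mod_cast this
    have h6 := (Submodule.smul_mem_iff _ h5).1 h3
    refine St.move hc hK hp3 hS hd hil ha hα had (hr1 l (Or.inr rfl)).1 (hr1 i (Or.inl rfl)).2 ?_
    rw [h4]; exact h6
  · obtain ⟨k, hk⟩ : ∃ k, d k ≠ 0 := by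
      by_contra hcon
      push Not at hcon
      exact hd0 (funext hcon)
    have hkl : k ≠ l := by rintro rfl; exact hk h0.1
    have hki : k ≠ i := by rintro rfl; exact hk h0.2
    have hbk := hb k
    by_cases h7 : (0 < d k ∧ d k < (p : ℤ) - 1) ∨ d k = -((p : ℤ) - 1)
    · -- first `l → k`
      have s1 := St.basic hc hK hp3 hb hS hd hkl.symm h1 (by omega) (by tauto)
      have b1 := hb.mvd hkl.symm h1 (by omega)
      have s2 := St.basic hc hK hp3 b1 (hS.mvd l k) s1 hki (by rw [mvd_l hkl.symm]; omega)
        (by rw [mvd_k hil.symm hki.symm]; omega) (by rw [mvd_l hkl.symm]; omega)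
      rwa [mvd_mvd] at s2
    · have s1 := St.basic hc hK hp3 hb hS hd hki (by omega) h2 (by tauto)
      have b1 := hb.mvd hki (by omega) h2
      have s2 := St.basic hc hK hp3 b1 (hS.mvd k i) s1 hkl.symm (by rw [mvd_k hkl.symm hil]; omega)
        (by rw [mvd_i hki]; omega) (by rw [mvd_i hki]; omega)
      rwa [mvd_mvd'] at s2

/-- straight paths avoiding zero -/
lemma St.path {c : Ctx K m t} (hc : c.ok p) (hK : Fintype.card K = p ^ t) (hp3 : 3 ≤ p) {j0 : Fin t}
    {e : Fin m → ℤ} (he : Box p e) (heS : SumOK p c j0 e)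
    (N : ℕ) : ∀ d : Fin m → ℤ, Box p d → SumOK p c j0 d → St p c j0 d →
      (c.ε j0 = 1 ∨ ∑ k, e k ≠ 0 ∨ (∃ x, 1 ≤ d x ∧ 1 ≤ e x)) →
      ∑ k, (d k - e k).natAbs = N → St p c j0 e := by
  induction N using Nat.strong_induction_on with
  | _ N ih =>
  intro d hb hS hd hz hN
  by_cases hde : d = e
  · rwa [hde] at hd
  have hsum : ∑ k, d k = ∑ k, e k := by rw [hS, heS]
  have hi : ∃ i, e i < d i := by
    by_contra hcon
    push Not at hcon
    apply hde
    have := (Finset.sum_eq_sum_iff_of_le (fun k _ => hcon k)).1 hsum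
    funext k; exact this k (Finset.mem_univ k)
  have hl : ∃ l, d l < e l := by
    by_contra hcon
    push Not at hcon
    apply hde
    have := (Finset.sum_eq_sum_iff_of_le (fun k _ => hcon k)).1 hsum.symm
    funext k; exact (this k (Finset.mem_univ k)).symm
  obtain ⟨i, hi⟩ := hi
  obtain ⟨l, hl⟩ := hl
  have hil : i ≠ l := by rintro rfl; omega
  have bi := he i
  have bl := he l
  have h1 := St.transfer hc hK hp3 hb hS hd hil (by omega) (by omega) (by
    rcases hz with hz | hz | ⟨x, hx, -⟩
    · exact Or.inr hz
    · left; rintro rfl; apply hz; rw [← hsum]; simp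
    · left; rintro rfl; simp at hx)
  refine ih _ ?_ _ (hb.mvd hil (by omega) (by omega)) (hS.mvd i l) h1 ?_ rfl
  · rw [← hN]
    apply Finset.sum_lt_sum
    · intro k _
      by_cases hki : k = i
      · subst hki; rw [mvd_i hil]; omega
      · by_cases hkl : k = l
        · subst hkl; rw [mvd_l hil]; omega
        · rw [mvd_k hki hkl]
    · exact ⟨i, Finset.mem_univ _, by rw [mvd_i hil]; omega⟩
  · rcases hz with hz | hz | ⟨x, hx, hx2⟩
    · exact Or.inl hz
    · exact Or.inr (Or.inl hz)
    · refine Or.inr (Or.inr ⟨x, ?_, hx2⟩)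
      by_cases hki : x = i
      · subst hki; rw [mvd_i hil]; omega
      · by_cases hkl : x = l
        · subst hkl; rw [mvd_l hil]; omega
        · rwa [mvd_k hki hkl]

lemma exists_pos_of_sum {d : Fin m → ℤ} (h : ∑ k, d k = 0) (h0 : d ≠ 0) : ∃ x, 1 ≤ d x := by
  by_contra hcon
  push Not at hcon
  apply h0
  have := (Finset.sum_eq_zero_iff_of_nonpos (fun k _ => by have := hcon k; omega)).1 h
  funext k; exact this k (Finset.mem_univ k)

/-- change of one digit -/
theorem St.change {c : Ctx K m t} (hc : c.ok p) (hK : Fintype.card K = p ^ t) (hp3 : 3 ≤ p) {j0 : Fin t}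
    {d e : Fin m → ℤ} (hb : Box p d) (hS : SumOK p c j0 d) (hd : St p c j0 d)
    (he : Box p e) (heS : SumOK p c j0 e)
    (hz : c.ε j0 = 1 ∨ ∑ k, e k ≠ 0 ∨ (d ≠ 0 ∧ 3 ≤ m)) : St p c j0 e := by
  have hsum : ∑ k, d k = ∑ k, e k := by rw [hS, heS]
  by_cases hz1 : c.ε j0 = 1
  · exact St.path hc hK hp3 he heS _ d hb hS hd (Or.inl hz1) rfl
  by_cases hz2 : ∑ k, e k ≠ 0
  · exact St.path hc hK hp3 he heS _ d hb hS hd (Or.inr (Or.inl hz2)) rfl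
  push Not at hz2
  obtain ⟨hd0, hm3⟩ : d ≠ 0 ∧ 3 ≤ m := by tauto
  -- roots
  have zS : SumOK p c j0 0 := by unfold SumOK; rw [← heS, hz2]; simp
  have zB : Box p (0 : Fin m → ℤ) := by intro k; simp; omega
  have rS : ∀ x y : Fin m, SumOK p c j0 (mvd 0 y x) := fun x y => zS.mvd y x
  have rB : ∀ x y : Fin m, y ≠ x → Box p (mvd (0 : Fin m → ℤ) y x) := fun x y h =>
    zB.mvd h (by simp; omega) (by simp; omega)
  have third : ∀ x y : Fin m, ∃ z, z ≠ x ∧ z ≠ y := by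
    intro x y
    by_contra hcon
    push Not at hcon
    have : (Finset.univ : Finset (Fin m)) ⊆ {x, y} := by
      intro z _
      by_cases h : z = x
      · simp [h]
      · simp [hcon z h]
    have := Finset.card_le_card this
    have h2 := Finset.card_le_two (a := x) (b := y)
    rw [Finset.card_univ, Fintype.card_fin] at this
    omega
  -- from a class positive at `x` to a root positive at `x`
  have step : ∀ (d : Fin m → ℤ) (x y : Fin m), y ≠ x → Box p d → SumOK p c j0 d → St p c j0 d →
      1 ≤ d x → St p c j0 (mvd 0 y x) := by
    intro d x y hyx hb hS hd hx
    refine St.path hc hK hp3 (rB x y hyx) (rS x y) _ d hb hS hd (Or.inr (Or.inr ⟨x, hx, ?_⟩)) rfl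
    rw [mvd_l hyx]; simp
  obtain ⟨x0, hx0⟩ := exists_pos_of_sum (hsum.trans hz2) hd0
  have roots : ∀ x y, y ≠ x → St p c j0 (mvd 0 y x) := by
    intro x y hyx
    by_cases hx : x = x0
    · subst hx
      exact step d x y hyx hb hS hd hx0
    · -- move the positive part from `x0` to `x` along a third index
      obtain ⟨z, hz1, hz2⟩ := third x0 x
      have s1 := step d x0 z hz1 hb hS hd hx0
      have s2 := St.transfer hc hK hp3 (rB x0 z hz1) (rS x0 z) s1 (l := x0) (i := x) (Ne.symm hx)
        (by rw [mvd_l hz1]; simp; omega) (by rw [mvd_k hz2.symm hx]; simp; omega)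
        (Or.inl (fun hh => by
          have := congrFun hh x0
          rw [mvd_l hz1] at this; simp at this))
      rw [mvd_mvd] at s2
      exact step _ x y hyx (rB x z hz2) (rS x z) s2 (by rw [mvd_l hz2]; simp)
  by_cases he0 : e = 0
  · obtain ⟨z, hz1, -⟩ := third x0 x0
    have s1 := roots x0 z hz1
    have s2 := St.transfer hc hK hp3 (rB x0 z hz1) (rS x0 z) s1 (l := x0) (i := z) hz1.symm
        (by rw [mvd_l hz1]; simp; omega) (by rw [mvd_i hz1]; simp; omega)
        (Or.inl (fun hh => by
          have := congrFun hh x0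
          rw [mvd_l hz1] at this; simp at this))
    rw [mvd_mvd] at s2
    convert s2 using 1
    rw [he0]; funext k; simp [mvd]
  · obtain ⟨x, hx⟩ := exists_pos_of_sum hz2 he0
    obtain ⟨z, hz1, -⟩ := third x x
    refine St.path hc hK hp3 he heS _ _ (rB x z hz1) (rS x z) (roots x z hz1)
      (Or.inr (Or.inr ⟨x, ?_, hx⟩)) rfl
    rw [mvd_l hz1]; simp

end nine
end PR

/-! ### Part 10 : the leading terms of the code -/
namespace PR
set_option linter.unusedVariables false
set_option linter.unusedSectionVars false
open Polynomial

section ten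
variable {K : Type*} [Field K] [Fintype K] {m : ℕ} {p : ℕ} [Fact p.Prime] [CharP K p] {t : ℕ}

variable (K m) in
/-- symmetry parameter of a digit type -/
def epsl (A B : ℕ) : K := if A = m ∧ B = m then 1 else 0

/-- digit state of type `(A, B)` -/
def Dst (p : ℕ) (A B : ℕ) (a α : Fin m → ℕ) : Prop :=
  (∀ i, a i ≤ p - 1) ∧ (∀ i, α i ≤ p - 1) ∧ ldeg p a α + A = p * B

lemma Dst.hst {A B : ℕ} {a α : Fin m → ℕ} (h : Dst p A B a α) : Hst p (epsl K m A B) a α := by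
  obtain ⟨h1, h2, h3⟩ := h
  refine ⟨h1, h2, ?_⟩
  by_cases hh : A = m ∧ B = m
  · right
    have h4 := ldeg_eq (p := p) (a := a) h2
    rw [hh.1, hh.2] at h3
    have hpp := (Fact.out : p.Prime).pos
    have h5 : (ldeg p a α : ℤ) = m * ((p - 1 : ℕ) : ℤ) := by
      have : (ldeg p a α : ℤ) + m = p * m := by exact_mod_cast h3
      push_cast [Nat.cast_sub hpp]
      linarith
    have h6 : (∑ i, (a i : ℤ)) = ∑ i, (α i : ℤ) := by omega
    exact_mod_cast h6
  · left; simp [epsl, hh]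

/-- context of a type -/
def tctx (K : Type*) [Field K] [NeZero t] (s : Fin t → ℕ) (a α : Fin t → Fin m → ℕ) : Ctx K m t :=
  ⟨fun j => epsl K m (s j) (s (j + 1)), a, α⟩

lemma mem_gs_tot {c : Ctx K m t} (j0 : Fin t) (a α : Fin m → ℕ) :
    psi p (c.ε j0) a α ∈ c.gs p j0 ↔
      Ctx.tot p ⟨c.ε, Function.update c.a j0 a, Function.update c.α j0 α⟩ ∈ UU K m ⊔ NN K m p (c.w p) := by
  rw [Ctx.gs, mem_GS_update, Ctx.tot]
  have : ∀ j, Function.update (fun j => psi p (c.ε j) (c.a j) (c.α j)) j0 (psi p (c.ε j0) a α) j =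
      psi p (c.ε j) (Function.update c.a j0 a j) (Function.update c.α j0 α j) := by
    intro j
    by_cases hj : j = j0
    · subst hj; simp
    · simp [hj]
  simp only [this]

theorem digit_change [NeZero t] (hK : Fintype.card K = p ^ t) (hp3 : 3 ≤ p) {s : Fin t → ℕ}
    (hs : ∀ j, s j ≤ m)
    {a α : Fin t → Fin m → ℕ} (hD : ∀ j, Dst p (s j) (s (j + 1)) (a j) (α j)) (j0 : Fin t)
    {a1 α1 : Fin m → ℕ} (hD1 : Dst p (s j0) (s (j0 + 1)) a1 α1)
    (hne : ¬ (s j0 = m ∧ s (j0 + 1) = m) → a j0 ≠ α j0)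
    (h : (tctx K s a α).tot p ∈ UU K m ⊔ NN K m p ((tctx K s a α).w p)) :
    (tctx K s (Function.update a j0 a1) (Function.update α j0 α1)).tot p ∈
      UU K m ⊔ NN K m p ((tctx K s a α).w p) := by
  set c := tctx K s a α with hcdef
  have hc : c.ok p := fun j => (hD j).hst
  have h0 : psi p (c.ε j0) (a j0) (α j0) ∈ c.gs p j0 := by
    rw [mem_gs_tot]
    have e1 : Function.update c.a j0 (a j0) = c.a := Function.update_eq_self _ _
    have e2 : Function.update c.α j0 (α j0) = c.α := Function.update_eq_self _ _
    rw [e1, e2]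
    exact h
  have hS : SumOK p c j0 (fun i => (a j0 i : ℤ) - α j0 i) := rfl
  obtain ⟨d1, d2, d3⟩ := hD j0
  obtain ⟨e1, e2, e3⟩ := hD1
  have f1 := ldeg_eq (p := p) (a := a j0) d2
  have f2 := ldeg_eq (p := p) (a := a1) e2
  have hS1 : SumOK p c j0 (fun i => (a1 i : ℤ) - α1 i) := by
    change ∑ i, ((a1 i : ℤ) - α1 i) = ∑ i, ((a j0 i : ℤ) - α j0 i)
    rw [Finset.sum_sub_distrib, Finset.sum_sub_distrib]
    omega
  have hSt : St p c j0 (fun i => (a j0 i : ℤ) - α j0 i) := by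
    intro a2 α2 ha2 hα2 hd2
    exact St.of_one hc hK hp3 hS ha2 hα2 hd2 _ (a j0) (α j0) d1 d2 (fun i => rfl) rfl h0
  have hpp := (Fact.out : p.Prime).pos
  have key := St.change hc hK hp3 (e := fun i => (a1 i : ℤ) - α1 i) (fun i => by
      have := d1 i; have := d2 i; omega) hS hSt (fun i => by
      have := e1 i; have := e2 i; dsimp only; omega) hS1 (by
      by_cases hh : s j0 = m ∧ s (j0 + 1) = m
      · left; simp [hcdef, tctx, epsl, hh]
      · by_cases hz : ∑ k, ((a1 k : ℤ) - α1 k) ≠ 0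
        · exact Or.inr (Or.inl hz)
        · push Not at hz
          refine Or.inr (Or.inr ⟨?_, ?_⟩)
          · intro h0
            apply hne hh
            funext k
            have := congrFun h0 k
            simp only [Pi.zero_apply] at this
            omega
          · rw [Finset.sum_sub_distrib] at hz
            have g1 := hs j0
            have g2 := hs (j0 + 1)
            have g3 : (ldeg p a1 α1 : ℤ) = m * ((p - 1 : ℕ) : ℤ) := by omega
            have g4 : (ldeg p a1 α1 : ℤ) + s j0 = p * s (j0 + 1) := by exact_mod_cast e3
            rw [Nat.cast_sub hpp] at g3
            push_cast at g3
            have g5 : (p : ℤ) * (m - s (j0 + 1)) = m - s j0 := by linarith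
            have g6 : s (j0 + 1) < m := by
              rcases Nat.lt_or_ge (s (j0 + 1)) m with g | g
              · exact g
              · exfalso
                have : s (j0 + 1) = m := le_antisymm g2 g
                rw [this, sub_self, mul_zero] at g5
                exact hh ⟨by omega, this⟩
            have g7 : (3 : ℤ) ≤ p := by exact_mod_cast hp3
            have g8 : (1 : ℤ) ≤ m - s (j0 + 1) := by omega
            have : (3 : ℤ) ≤ m := by nlinarith
            exact_mod_cast this)
  have := key a1 α1 e1 e2 (fun i => rfl)
  rw [mem_gs_tot] at this
  exact this

theorem lead_mem [NeZero t] (hK : Fintype.card K = p ^ t) (hp3 : 3 ≤ p) (hm : 2 ≤ m)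
    (s : Fin t → ℕ) (h1 : ∀ j, 1 ≤ s j) (h2 : ∀ j, s j ≤ m)
    {a α : Fin t → Fin m → ℕ} (hD : ∀ j, Dst p (s j) (s (j + 1)) (a j) (α j)) :
    (tctx K s a α).tot p ∈ UU K m ⊔ NN K m p ((tctx K s a α).w p) := by
  obtain ⟨n, n1, n2, n3, n4⟩ := start_exists' (K := K) hK hp3 hm s h1 h2
    (fun j => by have := (hD j).2.2; omega)
  have hpp := (Fact.out : p.Prime).pos
  set a0 : Fin t → Fin m → ℕ := fun j i => min (n j i) (p - 1) with ha0
  set α0 : Fin t → Fin m → ℕ := fun j i => p - 1 - (n j i - a0 j i) with hα0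
  have hD0 : ∀ j, Dst p (s j) (s (j + 1)) (a0 j) (α0 j) := by
    intro j
    refine ⟨fun i => by simp [ha0], fun i => by simp [hα0], ?_⟩
    rw [← n3 j, ldeg]
    congr 1
    refine Finset.sum_congr rfl fun i _ => ?_
    have := n1 j i
    simp only [hα0, ha0]
    omega
  have hw : ∀ b β : Fin t → Fin m → ℕ, (∀ j, Dst p (s j) (s (j + 1)) (b j) (β j)) →
      (tctx K s b β).w p = (tctx K s a α).w p := by
    intro b β hb
    unfold Ctx.w
    refine Finset.sum_congr rfl fun j _ => ?_
    have e1 := (hb j).2.2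
    have e2 := (hD j).2.2
    simp only [tctx]
    omega
  have h2K : (2 : K) ≠ 0 := by
    have := cast_ne_zero_of_lt (K := K) (p := p) (n := 2) (by omega) (by omega)
    exact_mod_cast this
  have hstart : (tctx K s a0 α0).tot p ∈ UU K m := by
    have hmon : mon K p a0 (n - a0) ∈ UU K m := by
      apply n2
      · funext j i; simp [ha0]
      · intro j i; simp only [ha0]; omega
      · intro j i
        have := n1 j i
        simp only [ha0, Pi.sub_apply]; omega
    have hpsi : ∀ j, ∃ k : K, psi p (epsl K m (s j) (s (j + 1))) (a0 j) (α0 j) =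
        k • mo (a0 j) ((n - a0) j) := by
      intro j
      have e : (fun i => p - 1 - α0 j i) = (n - a0) j := by
        funext i
        have := n1 j i
        simp only [hα0, ha0, Pi.sub_apply]; omega
      by_cases hh : s j = m ∧ s (j + 1) = m
      · have hn := (n4 j).2 hh
        have e2 : α0 j = a0 j := by
          funext i
          simp [hα0, ha0, hn]
        refine ⟨2 * (pf K (a0 j))⁻¹, ?_⟩
        rw [psi, epsl, if_pos hh, one_smul, ev, ev, e, e2, mul_smul, two_smul]
        congr 3
        rw [← e2]; exact e
      · refine ⟨(pf K (a0 j))⁻¹, ?_⟩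
        rw [psi, epsl, if_neg hh, zero_smul, add_zero, ev, e]
    choose k hk using hpsi
    have : (tctx K s a0 α0).tot p = (∏ j : Fin t, k j ^ p ^ (j : ℕ)) • mon K p a0 (n - a0) := by
      unfold Ctx.tot mon tctx
      simp only [hk, _root_.smul_pow]
      rw [Finset.prod_smul]
    rw [this]
    exact Submodule.smul_mem _ _ hmon
  have main : ∀ J : Finset (Fin t),
      (tctx K s (fun j => if j ∈ J then a j else a0 j) (fun j => if j ∈ J then α j else α0 j)).tot p ∈
        UU K m ⊔ NN K m p ((tctx K s a α).w p) := by
    intro J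
    induction J using Finset.induction_on with
    | empty => simpa using Submodule.mem_sup_left hstart
    | insert j0 J hj0 ih =>
      have hDJ : ∀ j, Dst p (s j) (s (j + 1)) ((fun j => if j ∈ J then a j else a0 j) j)
          ((fun j => if j ∈ J then α j else α0 j) j) := by
        intro j
        by_cases hj : j ∈ J
        · simpa [hj] using hD j
        · simpa [hj] using hD0 j
      have := digit_change hK hp3 h2 hDJ j0 (hD j0) (by
        intro hh
        simp only [hj0, if_false]
        intro e
        apply hh
        apply (n4 j0).1
        funext i
        have := congrFun e i
        simp only [ha0, hα0] at this
        omega) (by rw [hw _ _ hDJ]; exact ih)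
      rw [hw _ _ hDJ] at this
      have e : ∀ f f0 : Fin t → Fin m → ℕ, Function.update (fun j => if j ∈ J then f j else f0 j) j0 (f j0) =
          fun j => if j ∈ insert j0 J then f j else f0 j := by
        intro f f0
        funext j
        by_cases hj : j = j0
        · subst hj; simp
        · simp [hj]
      rwa [e, e] at this
  simpa using main Finset.univ

end ten
end PR

/-! ### Part 11 : upper bound, reduction of products -/
namespace PR
set_option linter.unusedVariables false
set_option linter.unusedSectionVars false

section eleven
variable {K : Type*} [Field K] [Fintype K] {m : ℕ} {p : ℕ} [Fact p.Prime] [CharP K p] {t : ℕ}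

variable (K m p t) in
/-- span of the constant function and of the digit elements -/
def TT [NeZero t] : Submodule K (RR K m) :=
  Submodule.span K ({1} ∪ {f | ∃ (s : Fin t → ℕ) (a α : Fin t → Fin m → ℕ), (∀ j, 1 ≤ s j) ∧
    (∀ j, s j ≤ m) ∧ (∀ j, Dst p (s j) (s (j + 1)) (a j) (α j)) ∧ f = (tctx K s a α).tot p})

variable (K m p) in
/-- homogeneous functions of a type -/
def HD (A B : ℕ) : Submodule K (RR K m) :=
  Submodule.span K {f | ∃ a b : Fin m → ℕ, ∑ i, (a i + b i) + A = p * B ∧ f = mo a b}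

variable (K m p) in
/-- generators of the admissible functions of a digit -/
def SS (A B : ℕ) : Set (RR K m) :=
  {f | (∃ a b : Fin m → ℕ, ∑ i, (a i + b i) + A = p * B ∧ f = mo a b ∧
      ((A = m ∧ B = m) → ∃ i, p ≤ a i ∨ p ≤ b i)) ∨
    ((A = m ∧ B = m) ∧ ∃ a α : Fin m → ℕ, Dst p A B a α ∧ f = psi p 1 a α)}

variable (K m p) in
/-- admissible functions of a digit -/
def FF (A B : ℕ) : Submodule K (RR K m) := Submodule.span K (SS K m p A B)

lemma FF_eq_HD {A B : ℕ} (h : ¬ (A = m ∧ B = m)) : FF K m p A B = HD K m p A B := by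
  unfold FF HD SS
  congr 1
  ext f
  simp only [Set.mem_ofPred_eq]
  constructor
  · rintro (⟨a, b, h1, h2, -⟩ | ⟨h1, -⟩)
    · exact ⟨a, b, h1, h2⟩
    · exact absurd h1 h
  · rintro ⟨a, b, h1, h2⟩
    exact Or.inl ⟨a, b, h1, h2, fun h3 => absurd h3 h⟩

lemma FF_le_HD (A B : ℕ) : FF K m p A B ≤ HD K m p A B := by
  by_cases h : A = m ∧ B = m
  · unfold FF
    rw [Submodule.span_le]
    rintro f (⟨a, b, h1, h2, -⟩ | ⟨h1, a, α, h2, rfl⟩)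
    · exact Submodule.subset_span ⟨a, b, h1, h2⟩
    · have hh := h2.hst (K := K)
      obtain ⟨e1, e2, e3⟩ := h2
      have h3 : ∑ i, a i = ∑ i, α i := by
        rcases hh.2.2 with h0 | h0
        · simp [epsl, h] at h0
        · exact h0
      have h4 := ldeg_swap (p := p) e1 e2 h3
      rw [psi, ev, ev]
      refine Submodule.add_mem _ (Submodule.smul_mem _ _ (Submodule.subset_span ⟨_, _, e3, rfl⟩))
        (Submodule.smul_mem _ _ (Submodule.smul_mem _ _ (Submodule.subset_span ⟨_, _, ?_, rfl⟩)))
      rw [← e3, ← h4, ldeg]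
  · rw [FF_eq_HD h]

lemma HD_mul_X {A B : ℕ} (hA : 1 ≤ A) (i : Fin m) {f : RR K m} (hf : f ∈ HD K m p A B) :
    f * Xc i ∈ HD K m p (A - 1) B := by
  have : HD K m p A B ≤ (HD K m p (A - 1) B).comap (LinearMap.mulRight K (Xc i : RR K m)) := by
    conv_lhs => rw [HD]
    rw [Submodule.span_le]
    rintro _ ⟨a, b, h1, rfl⟩
    refine Submodule.subset_span ⟨a + Pi.single i 1, b, ?_, ?_⟩
    · rw [← h1]
      simp only [Pi.add_apply, Finset.sum_add_distrib, Finset.sum_pi_single', Finset.mem_univ, if_true]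
      omega
    · rw [LinearMap.mulRight_apply, ← add_zero b, ← mo_mul, mo_single_x, pow_one, add_zero]
  exact this hf

lemma HD_mul_Y {A B : ℕ} (hA : 1 ≤ A) (i : Fin m) {f : RR K m} (hf : f ∈ HD K m p A B) :
    f * Yc i ∈ HD K m p (A - 1) B := by
  have : HD K m p A B ≤ (HD K m p (A - 1) B).comap (LinearMap.mulRight K (Yc i : RR K m)) := by
    conv_lhs => rw [HD]
    rw [Submodule.span_le]
    rintro _ ⟨a, b, h1, rfl⟩
    refine Submodule.subset_span ⟨a, b + Pi.single i 1, ?_, ?_⟩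
    · rw [← h1]
      simp only [Pi.add_apply, Finset.sum_add_distrib, Finset.sum_pi_single', Finset.mem_univ, if_true]
      omega
    · rw [LinearMap.mulRight_apply, ← add_zero a, ← mo_mul, mo_single_y, pow_one, add_zero]
  exact this hf

/-- multi-semilinearity -/
lemma prod_span {T : Submodule K (RR K m)} (S : Fin t → Set (RR K m))
    (h : ∀ g : Fin t → RR K m, (∀ j, g j ∈ S j) → ∏ j, g j ^ p ^ (j : ℕ) ∈ T)
    (f : Fin t → RR K m) (hf : ∀ j, f j ∈ Submodule.span K (S j)) :
    ∏ j, f j ^ p ^ (j : ℕ) ∈ T := by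
  have key : ∀ D : Finset (Fin t), ∀ f : Fin t → RR K m, (∀ j ∈ D, f j ∈ Submodule.span K (S j)) →
      (∀ j, j ∉ D → f j ∈ S j) → ∏ j, f j ^ p ^ (j : ℕ) ∈ T := by
    intro D
    induction D using Finset.induction_on with
    | empty => intro f _ hf; exact h f (fun j => hf j (by simp))
    | insert j0 D hj0 ih =>
      intro f h1 h2
      have h3 : Submodule.span K (S j0) ≤ GS p j0 f T := by
        rw [Submodule.span_le]
        intro g hg
        change g ∈ GS p j0 f T
        rw [mem_GS_update]
        apply ih
        · intro j hj
          have : j ≠ j0 := fun h => hj0 (h ▸ hj)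
          rw [Function.update_of_ne this]
          exact h1 j (Finset.mem_insert_of_mem hj)
        · intro j hj
          by_cases hh : j = j0
          · subst hh; simpa using hg
          · rw [Function.update_of_ne hh]
            exact h2 j (by simp [hh, hj])
      have h4 := h3 (h1 j0 (Finset.mem_insert_self _ _))
      rw [mem_GS_update, Function.update_eq_self] at h4
      exact h4
  exact key Finset.univ f (fun j _ => hf j) (fun j hj => absurd (Finset.mem_univ j) hj)

lemma Fin_cycle [NeZero t] {P : Fin t → Prop} (h : ∀ j, P (j + 1) → P j) (j0 : Fin t) (h0 : P j0)
    (j : Fin t) : P j := by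
  have key : ∀ n : ℕ, ∀ k : Fin t, P (k + Fin.ofNat t n) → P k := by
    intro n
    induction n with
    | zero =>
      intro k hk
      have : Fin.ofNat t 0 = 0 := by ext; simp
      rwa [this, add_zero] at hk
    | succ n ih =>
      intro k hk
      apply ih
      apply h
      have : Fin.ofNat t (n + 1) = Fin.ofNat t n + 1 := by
        ext
        simp [Fin.val_add]
      rw [this, ← add_assoc] at hk
      exact hk
  apply key ((j0 - j : Fin t) : ℕ)
  have e : Fin.ofNat t ((j0 - j : Fin t) : ℕ) = j0 - j := by
    ext; simp [Nat.mod_eq_of_lt]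
  rw [e]
  simpa using h0

lemma prod_reduce [NeZero t] (hK : Fintype.card K = p ^ t) (hm : 1 ≤ m) : ∀ (n : ℕ) (s : Fin t → ℕ),
    ∑ j, s j = n → (∀ j, s j ≤ m) → ∀ f : Fin t → RR K m, (∀ j, f j ∈ FF K m p (s j) (s (j + 1))) →
      ∏ j, f j ^ p ^ (j : ℕ) ∈ TT K m p t := by
  intro n
  induction n using Nat.strong_induction_on with
  | _ n ih =>
  intro s hsn hs f hf
  have hpp := (Fact.out : p.Prime).pos
  refine prod_span (fun j => SS K m p (s j) (s (j + 1))) ?_ f hf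
  clear hf f
  intro g hg
  by_cases hz : ∃ j, s j = 0
  · obtain ⟨j0, hj0⟩ := hz
    have hall : ∀ j, s j = 0 := by
      refine fun j => Fin_cycle (P := fun j => s j = 0) ?_ j0 hj0 j
      intro j hj
      rcases hg j with ⟨a, b, h1, -⟩ | ⟨⟨h1, h2⟩, -⟩
      · rw [hj] at h1; omega
      · omega
    have h1 : ∀ j, g j = 1 := by
      intro j
      rcases hg j with ⟨a, b, h1, h2, -⟩ | ⟨⟨h1, h2⟩, -⟩
      · rw [hall, hall, mul_zero, add_zero, Finset.sum_eq_zero_iff] at h1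
        rw [h2, ← mo_zero]
        congr 1
        · funext i; have := h1 i (Finset.mem_univ _); simp; omega
        · funext i; have := h1 i (Finset.mem_univ _); simp; omega
      · rw [hall] at h1; omega
    simp only [h1, one_pow, Finset.prod_const_one]
    exact Submodule.subset_span (Or.inl rfl)
  · push Not at hz
    by_cases hr : ∃ j, ∃ z h : RR K m, ((∃ i, z = Xc i) ∨ ∃ i, z = Yc i) ∧ g j = z ^ p * h ∧
        h ∈ HD K m p (s j) (s (j + 1) - 1)
    · obtain ⟨j, z, h, hz2, hgj, hh⟩ := hr
      have hmul : ∀ {A B : ℕ} (hA : 1 ≤ A) {f : RR K m} (hf : f ∈ HD K m p A B),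
          f * z ∈ HD K m p (A - 1) B := by
        intro A B hA f hf
        rcases hz2 with ⟨i, rfl⟩ | ⟨i, rfl⟩
        · exact HD_mul_X hA i hf
        · exact HD_mul_Y hA i hf
      have hprod : ∏ k, g k ^ p ^ (k : ℕ) = ∏ k, ((if k = j then h else g k) *
          (if k = j + 1 then z else 1)) ^ p ^ (k : ℕ) := by
        simp only [mul_pow, Finset.prod_mul_distrib]
        rw [← Finset.mul_prod_erase _ _ (Finset.mem_univ j), hgj, mul_pow, frob_succ hK,
          ← Finset.mul_prod_erase Finset.univ (fun k => (if k = j then h else g k) ^ p ^ (k : ℕ))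
            (Finset.mem_univ j), if_pos rfl]
        have e1 : ∏ k : Fin t, (if k = j + 1 then z else 1) ^ p ^ (k : ℕ) = z ^ p ^ ((j + 1 : Fin t) : ℕ) := by
          rw [Finset.prod_eq_single (j + 1)]
          · simp
          · intro k _ hk; simp [hk]
          · simp
        have e2 : ∏ k ∈ Finset.univ.erase j, (if k = j then h else g k) ^ p ^ (k : ℕ) =
            ∏ k ∈ Finset.univ.erase j, g k ^ p ^ (k : ℕ) :=
          Finset.prod_congr rfl fun k hk => by rw [if_neg (Finset.ne_of_mem_erase hk)]
        rw [e1, e2]; ring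
      rw [hprod]
      have hs1 := Nat.one_le_iff_ne_zero.2 (hz (j + 1))
      set s1 : Fin t → ℕ := fun k => if k = j + 1 then s k - 1 else s k with hs1def
      have hsum : ∑ k, s1 k + 1 = ∑ k, s k := by
        rw [← Finset.add_sum_erase _ _ (Finset.mem_univ (j + 1)),
          ← Finset.add_sum_erase Finset.univ s (Finset.mem_univ (j + 1))]
        have : ∑ k ∈ Finset.univ.erase (j + 1), s1 k = ∑ k ∈ Finset.univ.erase (j + 1), s k :=
          Finset.sum_congr rfl fun k hk => by simp [hs1def, Finset.ne_of_mem_erase hk]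
        rw [this]; simp [hs1def]; omega
      refine ih (∑ k, s1 k) (by omega) s1 rfl ?_ _ ?_
      · intro k
        have := hs k
        simp only [hs1def]; split_ifs <;> omega
      · intro k
        have hs2 := hs (j + 1)
        have hk1 : s1 (k + 1) = if k = j then s (k + 1) - 1 else s (k + 1) := by
          simp [hs1def]
        have hk0 : s1 k = if k = j + 1 then s k - 1 else s k := rfl
        by_cases ha : k = j <;> by_cases hb : k = j + 1
        · rw [if_pos ha, if_pos hb, hk0, hk1, if_pos ha, if_pos hb]
          have hb' := hb ▸ hs1
          rw [FF_eq_HD (by rw [hb]; omega)]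
          refine hmul (by rw [hb]; exact hs1) ?_
          rw [ha]; exact hh
        · rw [if_pos ha, if_neg hb, hk0, hk1, if_pos ha, if_neg hb, mul_one]
          rw [FF_eq_HD (by rw [ha]; omega), ha]
          exact hh
        · rw [if_neg ha, if_pos hb, hk0, hk1, if_neg ha, if_pos hb]
          rw [FF_eq_HD (by rw [hb]; omega)]
          exact hmul (by rw [hb]; exact hs1) (FF_le_HD _ _ (Submodule.subset_span (hg k)))
        · rw [if_neg ha, if_neg hb, hk0, hk1, if_neg ha, if_neg hb, mul_one]
          exact Submodule.subset_span (hg k)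
    · push Not at hr
      -- every digit is reduced
      have hred : ∀ j, ∃ (c : K) (a α : Fin m → ℕ), Dst p (s j) (s (j + 1)) a α ∧
          g j = c • psi p (epsl K m (s j) (s (j + 1))) a α := by
        intro j
        rcases hg j with ⟨a, b, h1, h2, h3⟩ | ⟨h1, a, α, h2, h3⟩
        · have hB := Nat.one_le_iff_ne_zero.2 (hz (j + 1))
          have hp1 : p * s (j + 1) = p * (s (j + 1) - 1) + p := by
            obtain ⟨k, hk⟩ := Nat.exists_eq_add_of_le hB
            rw [hk, Nat.add_sub_cancel_left]; ring
          have ha : ∀ i, a i < p := by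
            intro i
            by_contra hi
            push Not at hi
            refine hr j (Xc i) (mo (fun k => if k = i then a k - p else a k) b) (Or.inl ⟨i, rfl⟩) ?_
              (Submodule.subset_span ⟨_, _, ?_, rfl⟩)
            · rw [h2, ← mo_single_x, mo_mul, zero_add]
              congr 1
              funext k
              by_cases hk : k = i
              · subst hk; simp; omega
              · simp [hk]
            · have : ∑ k, ((if k = i then a k - p else a k) + b k) + p = ∑ k, (a k + b k) := by
                rw [← Finset.add_sum_erase _ _ (Finset.mem_univ i),
                  ← Finset.add_sum_erase Finset.univ (fun k => a k + b k) (Finset.mem_univ i), if_pos rfl]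
                rw [Finset.sum_congr rfl (g := fun k => a k + b k) fun k hk => by
                  rw [if_neg (Finset.ne_of_mem_erase hk)]]
                omega
              omega
          have hb : ∀ i, b i < p := by
            intro i
            by_contra hi
            push Not at hi
            refine hr j (Yc i) (mo a (fun k => if k = i then b k - p else b k)) (Or.inr ⟨i, rfl⟩) ?_
              (Submodule.subset_span ⟨_, _, ?_, rfl⟩)
            · rw [h2, ← mo_single_y, mo_mul, zero_add]
              congr 1
              funext k
              by_cases hk : k = i
              · subst hk; simp; omega
              · simp [hk]
            · have : ∑ k, (a k + (if k = i then b k - p else b k)) + p = ∑ k, (a k + b k) := by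
                rw [← Finset.add_sum_erase _ _ (Finset.mem_univ i),
                  ← Finset.add_sum_erase Finset.univ (fun k => a k + b k) (Finset.mem_univ i), if_pos rfl]
                rw [Finset.sum_congr rfl (g := fun k => a k + b k) fun k hk => by
                  rw [if_neg (Finset.ne_of_mem_erase hk)]]
                omega
              omega
          have hnm : ¬ (s j = m ∧ s (j + 1) = m) := by
            intro hc
            obtain ⟨i, hi | hi⟩ := h3 hc
            · exact absurd (ha i) (by omega)
            · exact absurd (hb i) (by omega)
          have hbb : (fun i => p - 1 - (p - 1 - b i)) = b := by
            funext i; have := hb i; omega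
          refine ⟨pf K a, a, fun i => p - 1 - b i, ⟨fun i => by have := ha i; omega,
            fun i => Nat.sub_le _ _, ?_⟩, ?_⟩
          · rw [← h1, ldeg]
            congr 1
            exact Finset.sum_congr rfl fun i _ => by have := hb i; omega
          · rw [h2, psi, epsl, if_neg hnm, zero_smul, add_zero, ev, hbb, smul_smul,
              mul_inv_cancel₀ (pf_ne (p := p) fun i => by have := ha i; omega), one_smul]
        · exact ⟨1, a, α, h2, by rw [h3, epsl, if_pos h1, one_smul]⟩
      choose c a α hD hgc using hred
      have : ∏ j, g j ^ p ^ (j : ℕ) = (∏ j, c j ^ p ^ (j : ℕ)) • (tctx K s a α).tot p := by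
        rw [Ctx.tot, ← Finset.prod_smul]
        exact Finset.prod_congr rfl fun j _ => by rw [hgc, _root_.smul_pow]; rfl
      rw [this]
      refine Submodule.smul_mem _ _ (Submodule.subset_span (Or.inr ⟨s, a, α, ?_, hs, hD, rfl⟩))
      exact fun j => Nat.one_le_iff_ne_zero.2 (hz j)

end eleven
end PR

/-! ### Part 12 : upper bound, swaps and graphs -/
namespace PR
set_option linter.unusedVariables false
set_option linter.unusedSectionVars false

section twelve
variable {K : Type*} [Field K] [Fintype K] {m : ℕ} {p : ℕ} [Fact p.Prime] [CharP K p] {t : ℕ}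

lemma wil : ∀ {n : ℕ}, n ≤ p - 1 → ((p - 1 - n).factorial : K) * (n.factorial : K) * (-1) ^ n =
    ((p - 1).factorial : K) := by
  intro n
  induction n with
  | zero => intro _; simp
  | succ n ih =>
    intro hn
    rw [← ih (by omega)]
    have hpp := (Fact.out : p.Prime).pos
    have e1 : p - 1 - n = (p - 1 - (n + 1)) + 1 := by omega
    have e2 : ((p - 1 - (n + 1) + 1 : ℕ) : K) = - ((n + 1 : ℕ) : K) := by
      rw [eq_neg_iff_add_eq_zero, ← Nat.cast_add]
      have : p - 1 - (n + 1) + 1 + (n + 1) = p := by omega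
      rw [this, CharP.cast_eq_zero]
    rw [e1, Nat.factorial_succ, Nat.factorial_succ, Nat.cast_mul, Nat.cast_mul, e2, pow_succ]
    ring

lemma fact_ne {n : ℕ} (hn : n ≤ p - 1) : (n.factorial : K) ≠ 0 := by
  have := pf_ne (K := K) (p := p) (m := 1) (a := fun _ => n) (fun _ => hn)
  simpa [pf] using this

lemma pf_ite (a : Fin m → ℕ) (k : Fin m) (x : Fin m → ℕ) :
    pf K (fun i => if i ∈ ({k} : Finset (Fin m)) then x i else a i) * ((a k).factorial : K) =
      pf K a * ((x k).factorial : K) := by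
  unfold pf
  rw [← Finset.mul_prod_erase _ _ (Finset.mem_univ k),
    ← Finset.mul_prod_erase Finset.univ (fun i => ((a i).factorial : K)) (Finset.mem_univ k)]
  simp only [Finset.mem_singleton, if_true]
  rw [Finset.prod_congr rfl (g := fun i => ((a i).factorial : K)) fun i hi => by
    rw [if_neg (Finset.ne_of_mem_erase hi)]]
  ring

lemma cmp_swp_ev {k : Fin m} {a α : Fin m → ℕ} (ha : ∀ i, a i ≤ p - 1) (hα : ∀ i, α i ≤ p - 1) :
    cmp (swp {k}) (ev K p a α) = ((-1) ^ (p - 1) * ((p - 1).factorial : K) *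
        (((a k).factorial : K) * ((α k).factorial : K))⁻¹) •
      ev K p (fun i => if i ∈ ({k} : Finset (Fin m)) then p - 1 - α i else a i)
        (fun i => if i ∈ ({k} : Finset (Fin m)) then p - 1 - a i else α i) := by
  rw [ev, ev, map_smul, cmp_swp_mo, smul_smul, smul_smul]
  have h1 : (fun i => p - 1 - (if i ∈ ({k} : Finset (Fin m)) then p - 1 - a i else α i)) =
      fun i => if i ∈ ({k} : Finset (Fin m)) then a i else p - 1 - α i := by
    funext i
    have := ha i
    split_ifs
    · omega
    · rfl
  rw [h1]
  congr 1
  have h2 := pf_ite (K := K) a k (fun i => p - 1 - α i)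
  have h3 := wil (K := K) (hα k)
  have n1 := pf_ne (K := K) ha
  have n2 : pf K (fun i => if i ∈ ({k} : Finset (Fin m)) then p - 1 - α i else a i) ≠ 0 :=
    pf_ne (p := p) fun i => by
      have := ha i
      split_ifs <;> omega
  have n3 := fact_ne (K := K) (ha k)
  have n4 := fact_ne (K := K) (hα k)
  have e1 : ((-1 : K)) ^ (p - 1) = (-1) ^ (p - 1 - α k) * (-1) ^ (α k) := by
    rw [← pow_add]; congr 1; have := hα k; omega
  have e2 : ((-1 : K)) ^ (α k) * (-1) ^ (α k) = 1 := by
    rw [← pow_add, ← two_mul, pow_mul]; simp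
  rw [Finset.sum_singleton, e1, ← h3]
  generalize pf K (fun i => if i ∈ ({k} : Finset (Fin m)) then p - 1 - α i else a i) = Q at *
  rw [inv_mul_eq_iff_eq_mul₀ n1]
  have h4 : Q = pf K a * ((p - 1 - α k).factorial : K) * ((a k).factorial : K)⁻¹ := by
    rw [eq_mul_inv_iff_mul_eq₀ n3]; exact h2
  have h5 : Q * Q⁻¹ = 1 := mul_inv_cancel₀ n2
  have h6 : ((α k).factorial : K) * ((α k).factorial : K)⁻¹ = 1 := mul_inv_cancel₀ n4
  rw [mul_inv]
  calc (-1 : K) ^ (p - 1 - α k)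
      = (-1 : K) ^ (p - 1 - α k) * (Q * Q⁻¹) * ((-1) ^ (α k) * (-1) ^ (α k)) *
          (((α k).factorial : K) * ((α k).factorial : K)⁻¹) := by rw [h5, e2, h6]; ring
    _ = (-1 : K) ^ (p - 1 - α k) * ((pf K a * ((p - 1 - α k).factorial : K) * ((a k).factorial : K)⁻¹) * Q⁻¹) *
          ((-1) ^ (α k) * (-1) ^ (α k)) * (((α k).factorial : K) * ((α k).factorial : K)⁻¹) := by rw [← h4]
    _ = _ := by ring

lemma cmp_swp_psi {k : Fin m} {ε : K} {a α : Fin m → ℕ} (ha : ∀ i, a i ≤ p - 1) (hα : ∀ i, α i ≤ p - 1) :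
    cmp (swp {k}) (psi p ε a α) = ((-1) ^ (p - 1) * ((p - 1).factorial : K) *
        (((a k).factorial : K) * ((α k).factorial : K))⁻¹) •
      psi p ε (fun i => if i ∈ ({k} : Finset (Fin m)) then p - 1 - α i else a i)
        (fun i => if i ∈ ({k} : Finset (Fin m)) then p - 1 - a i else α i) := by
  rw [psi, psi, map_add, map_smul, cmp_swp_ev ha hα, cmp_swp_ev hα ha, smul_add, mul_comm ((α k).factorial : K),
    smul_comm ε]

lemma TT_swp [NeZero t] (k : Fin m) {f : RR K m} (hf : f ∈ TT K m p t) :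
    cmp (swp {k}) f ∈ TT K m p t := by
  have : TT K m p t ≤ (TT K m p t).comap (cmp (swp {k})).toLinearMap := by
    conv_lhs => rw [TT]
    rw [Submodule.span_le]
    rintro _ (rfl | ⟨s, a, α, h1, h2, h3, rfl⟩)
    · change cmp (swp {k}) (1 : RR K m) ∈ TT K m p t
      rw [map_one]
      exact Submodule.subset_span (Or.inl rfl)
    · change cmp (swp {k}) ((tctx K s a α).tot p) ∈ TT K m p t
      rw [Ctx.tot, map_prod]
      simp only [map_pow]
      simp only [tctx]
      simp only [fun j => cmp_swp_psi (k := k) (ε := epsl K m (s j) (s (j + 1))) (h3 j).1 (h3 j).2.1,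
        _root_.smul_pow]
      rw [Finset.prod_smul]
      refine Submodule.smul_mem _ _ (Submodule.subset_span (Or.inr ⟨s,
        fun j i => if i ∈ ({k} : Finset (Fin m)) then p - 1 - α j i else a j i,
        fun j i => if i ∈ ({k} : Finset (Fin m)) then p - 1 - a j i else α j i, h1, h2, ?_, ?_⟩))
      · intro j
        obtain ⟨e1, e2, e3⟩ := h3 j
        refine ⟨fun i => ?_, fun i => ?_, ?_⟩
        · have := e1 i; dsimp only; split_ifs <;> omega
        · have := e2 i; dsimp only; split_ifs <;> omega
        · rw [← e3, ldeg, ldeg]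
          congr 1
          refine Finset.sum_congr rfl fun i _ => ?_
          have := e1 i
          have := e2 i
          dsimp only
          split_ifs <;> omega
      · rfl
  exact this hf

/-- coordinates: reduction to graphs -/
lemma swp_four (k : Fin m) (f : RR K m) :
    cmp (swp {k}) (cmp (swp {k}) (cmp (swp {k}) (cmp (swp {k}) f))) = f := by
  funext v
  simp only [cmp_apply]
  congr 1
  ext i
  · by_cases h : i = k <;> simp [swp, h]
  · by_cases h : i = k <;> simp [swp, h]

/-- the subspace `y = 0` -/
def Y0 : Submodule K (VV K m) := LinearMap.ker (LinearMap.snd K (Fin m → K) (Fin m → K))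

lemma swap_reduce {T : Submodule K (RR K m)} (hT : ∀ k : Fin m, ∀ f ∈ T, cmp (swp {k}) f ∈ T)
    (hg : ∀ W : Submodule K (VV K m), IsLag W → W ⊓ Y0 = ⊥ → chi W ∈ T) :
    ∀ n : ℕ, ∀ W : Submodule K (VV K m), IsLag W → Module.finrank K (W ⊓ Y0 : Submodule K (VV K m)) = n →
      chi W ∈ T := by
  intro n
  induction n using Nat.strong_induction_on with
  | _ n ih =>
  intro W hW hn
  by_cases h0 : W ⊓ Y0 = ⊥
  · exact hg W hW h0
  obtain ⟨v, hv, hv0⟩ := Submodule.exists_mem_ne_zero_of_ne_bot h0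
  have hv2 : v.2 = 0 := hv.2
  obtain ⟨k, hk⟩ : ∃ k, v.1 k ≠ 0 := by
    by_contra h
    push Not at h
    exact hv0 (Prod.ext (funext h) hv2)
  set W1 := W.comap (swp {k}) with hW1
  have hL1 : IsLag W1 := (swp_isom {k}).lag_comap hW
  have hinj := (swp_isom (K := K) {k}).injective
  -- the image of the new intersection
  have hmap : (W1 ⊓ Y0).map (swp {k}) < W ⊓ Y0 := by
    have hle : ∀ w ∈ (W1 ⊓ Y0).map (swp {k}), w ∈ W ⊓ Y0 ∧ w.1 k = 0 := by
      rintro _ ⟨u, ⟨hu1, hu2⟩, rfl⟩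
      have hu2' : u.2 = 0 := hu2
      have hmem : swp {k} u ∈ W := hu1
      have hs := hW.1 _ hv.1 _ hmem
      have hz : u.1 k = 0 := by
        simp only [sf, hv2, swp, LinearMap.coe_mk, AddHom.coe_mk, Pi.zero_apply, zero_mul, sub_zero] at hs
        rw [Finset.sum_eq_single k] at hs
        · simp at hs
          exact hs.resolve_left hk
        · intro i _ hi; simp [hi, hu2']
        · simp
      refine ⟨⟨hmem, ?_⟩, ?_⟩
      · change (swp {k} u).2 = 0
        funext i
        by_cases h : i = k
        · simp [swp, h, hz]
        · simp [swp, h, hu2']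
      · simp [swp, hu2']
    refine lt_of_le_of_ne (fun w hw => (hle w hw).1) ?_
    intro heq
    have := (hle v (heq ▸ hv)).2
    exact hk this
  have hlt : Module.finrank K (W1 ⊓ Y0 : Submodule K (VV K m)) < n := by
    rw [← hn, LinearEquiv.finrank_eq (Submodule.equivMapOfInjective (swp {k}) hinj (W1 ⊓ Y0))]
    exact Submodule.finrank_lt_finrank_of_lt hmap
  have h1 := ih _ hlt W1 hL1 rfl
  have h2 : chi W1 = cmp (swp {k}) (chi W) := by
    funext u; rfl
  rw [h2] at h1
  have := hT k _ (hT k _ (hT k _ h1))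
  rwa [swp_four] at this

lemma graph_form {W : Submodule K (VV K m)} (hW : IsLag W) (h0 : W ⊓ Y0 = ⊥) :
    ∃ B : Matrix (Fin m) (Fin m) K, B.IsSymm ∧ ∀ v, v ∈ W ↔ ∀ i, v.1 i = ∑ k, B i k * v.2 k := by
  set e0 : W →ₗ[K] (Fin m → K) := (LinearMap.snd K (Fin m → K) (Fin m → K)) ∘ₗ W.subtype with he0
  have hinj : Function.Injective e0 := by
    rw [← LinearMap.ker_eq_bot, LinearMap.ker_eq_bot']
    intro w hw
    have : (w : VV K m) ∈ W ⊓ Y0 := ⟨w.2, hw⟩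
    rw [h0, Submodule.mem_bot] at this
    exact Subtype.ext this
  set e := LinearEquiv.ofInjectiveOfFinrankEq e0 hinj (by rw [hW.2]; simp) with hedef
  have he : ∀ w : W, e w = (w : VV K m).2 := fun w => rfl
  set L : (Fin m → K) →ₗ[K] (Fin m → K) :=
    (LinearMap.fst K (Fin m → K) (Fin m → K)) ∘ₗ W.subtype ∘ₗ (e.symm : (Fin m → K) →ₗ[K] W) with hL
  have hmem : ∀ y, ((L y, y) : VV K m) ∈ W := by
    intro y
    have h1 : ((e.symm y : W) : VV K m) = (L y, y) := by
      refine Prod.ext rfl ?_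
      rw [← he, LinearEquiv.apply_symm_apply]
    rw [← h1]; exact (e.symm y).2
  have hiff : ∀ v : VV K m, v ∈ W ↔ v.1 = L v.2 := by
    intro v
    constructor
    · intro hv
      have h1 : (⟨v, hv⟩ : W) = ⟨_, hmem v.2⟩ := by
        apply hinj; rfl
      exact congrArg (fun w : W => (w : VV K m).1) h1
    · intro h
      have := hmem v.2
      rwa [← h] at this
  refine ⟨LinearMap.toMatrix' L, ?_, ?_⟩
  · ext i k
    have h1 := hW.1 _ (hmem (Pi.single i 1)) _ (hmem (Pi.single k 1))
    simp only [sf, Finset.sum_sub_distrib] at h1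
    simp [Pi.single_apply] at h1
    rw [Matrix.transpose_apply, LinearMap.toMatrix'_apply, LinearMap.toMatrix'_apply]
    exact sub_eq_zero.1 h1
  · intro v
    rw [hiff, funext_iff]
    refine forall_congr' fun i => ?_
    have : L v.2 = Matrix.mulVec (LinearMap.toMatrix' L) v.2 := by
      rw [LinearMap.toMatrix'_mulVec]
    rw [this]; rfl

end twelve
end PR

/-! ### Part 13 : upper bound, characteristic functions of graphs -/
namespace PR
set_option linter.unusedVariables false
set_option linter.unusedSectionVars false

section thirteen
variable {K : Type*} [Field K] [Fintype K] {m : ℕ} {p : ℕ} [Fact p.Prime] [CharP K p] {t : ℕ}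

/-- linear forms of a matrix -/
def Lf (B : Matrix (Fin m) (Fin m) K) (i : Fin m) : MvPolynomial (Fin m) K :=
  ∑ k, MvPolynomial.C (B i k) * MvPolynomial.X k

/-- products of the linear forms -/
def PL (B : Matrix (Fin m) (Fin m) K) (β : Fin m → ℕ) : MvPolynomial (Fin m) K := ∏ i, Lf B i ^ β i

/-- exponent vectors as finitely supported functions -/
def fs (b : Fin m → ℕ) : Fin m →₀ ℕ := Finsupp.equivFunOnFinite.symm b

lemma fs_apply (b : Fin m → ℕ) (i : Fin m) : fs b i = b i := rfl

lemma fs_add_single (b : Fin m → ℕ) (i : Fin m) : fs (b + Pi.single i 1) = fs b + Finsupp.single i 1 := by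
  ext k
  simp [fs_apply, Finsupp.single_apply, Pi.single_apply, eq_comm]

lemma fs_sub_single (b : Fin m → ℕ) (i : Fin m) : fs (b - Pi.single i 1) = fs b - Finsupp.single i 1 := by
  ext k
  simp [fs_apply, Finsupp.single_apply, Pi.single_apply, eq_comm]

lemma PL_zero (B : Matrix (Fin m) (Fin m) K) : PL B 0 = 1 := by simp [PL]

lemma PL_add (B : Matrix (Fin m) (Fin m) K) (β : Fin m → ℕ) (k : Fin m) :
    PL B (β + Pi.single k 1) = Lf B k * PL B β := by
  unfold PL
  simp only [Pi.add_apply, pow_add, Finset.prod_mul_distrib]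
  rw [mul_comm]
  congr 1
  rw [Finset.prod_eq_single k]
  · simp
  · intro i _ hi; simp [Pi.single_eq_of_ne hi]
  · simp

lemma PL_homog (B : Matrix (Fin m) (Fin m) K) (β : Fin m → ℕ) : (PL B β).IsHomogeneous (∑ i, β i) := by
  unfold PL
  refine MvPolynomial.IsHomogeneous.prod _ _ _ fun i _ => ?_
  have : (Lf B i).IsHomogeneous 1 := by
    refine MvPolynomial.IsHomogeneous.sum _ _ _ fun k _ => ?_
    exact MvPolynomial.isHomogeneous_C_mul_X _ _
  simpa using this.pow (β i)

/-- symmetric pairing -/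
def NB (B : Matrix (Fin m) (Fin m) K) (β b : Fin m → ℕ) : K := pf K b * (PL B β).coeff (fs b)

lemma NB_zero {B : Matrix (Fin m) (Fin m) K} {β b : Fin m → ℕ} (h : ∑ i, b i ≠ ∑ i, β i) : NB B β b = 0 := by
  rw [NB, (PL_homog B β).coeff_eq_zero, mul_zero]
  rw [Finsupp.degree_eq_sum]
  exact h

lemma NB_mul (B : Matrix (Fin m) (Fin m) K) (β b : Fin m → ℕ) (k : Fin m) :
    NB B (β + Pi.single k 1) b = ∑ i, (b i : K) * B k i * NB B β (b - Pi.single i 1) := by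
  unfold NB
  rw [PL_add, Lf, Finset.sum_mul, MvPolynomial.coeff_sum, Finset.mul_sum]
  refine Finset.sum_congr rfl fun i _ => ?_
  rw [mul_assoc, MvPolynomial.coeff_C_mul, MvPolynomial.coeff_X_mul']
  by_cases hb : 1 ≤ b i
  · have h1 : i ∈ (fs b).support := by
      rw [Finsupp.mem_support_iff, fs_apply]; omega
    rw [if_pos h1, fs_sub_single]
    have h2 := pf_add (K := K) (b - Pi.single i 1) i
    rw [sub_single hb] at h2
    rw [h2]
    have : (b - Pi.single i 1 : Fin m → ℕ) i + 1 = b i := by simp; omega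
    rw [this]; ring
  · have h1 : i ∉ (fs b).support := by
      rw [Finsupp.mem_support_iff, fs_apply]; omega
    have : b i = 0 := by omega
    rw [if_neg h1, this]; simp

lemma pderiv_Lf (B : Matrix (Fin m) (Fin m) K) (i k : Fin m) :
    MvPolynomial.pderiv i (Lf B k) = MvPolynomial.C (B k i) := by
  unfold Lf
  rw [map_sum, Finset.sum_eq_single i]
  · rw [MvPolynomial.pderiv_C_mul, MvPolynomial.pderiv_X_self, mul_one]
  · intro l _ hl
    rw [MvPolynomial.pderiv_C_mul, MvPolynomial.pderiv_X_of_ne hl, mul_zero]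
  · simp

lemma exists_pos {β : Fin m → ℕ} (h : β ≠ 0) : ∃ (β' : Fin m → ℕ) (k : Fin m), β = β' + Pi.single k 1 := by
  obtain ⟨k, hk⟩ := Function.ne_iff.1 h
  exact ⟨β - Pi.single k 1, k, (sub_single (Nat.one_le_iff_ne_zero.2 hk)).symm⟩

lemma sum_add_single (β : Fin m → ℕ) (k : Fin m) : ∑ i, (β + Pi.single k 1 : Fin m → ℕ) i = ∑ i, β i + 1 := by
  simp [Finset.sum_add_distrib]

lemma pderiv_PL (B : Matrix (Fin m) (Fin m) K) (i : Fin m) : ∀ (n : ℕ) (β : Fin m → ℕ), ∑ i, β i = n →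
    MvPolynomial.pderiv i (PL B β) =
      ∑ l, MvPolynomial.C ((β l : K) * B l i) * PL B (β - Pi.single l 1) := by
  intro n
  induction n with
  | zero =>
    intro β hβ
    have : β = 0 := by
      funext l
      exact (Finset.sum_eq_zero_iff.1 hβ) l (Finset.mem_univ l)
    subst this
    simp [PL_zero]
  | succ n ih =>
    intro β hβ
    have hne : β ≠ 0 := by rintro rfl; simp at hβ
    obtain ⟨β', k, rfl⟩ := exists_pos hne
    rw [sum_add_single] at hβ
    rw [PL_add, Derivation.leibniz, pderiv_Lf, ih β' (by omega), smul_eq_mul, smul_eq_mul, Finset.mul_sum]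
    have key : ∀ l, MvPolynomial.C (((β' + Pi.single k 1 : Fin m → ℕ) l : K) * B l i) *
        PL B (β' + Pi.single k 1 - Pi.single l 1) =
        Lf B k * (MvPolynomial.C ((β' l : K) * B l i) * PL B (β' - Pi.single l 1)) +
        (if l = k then MvPolynomial.C (B k i) * PL B β' else 0) := by
      intro l
      have h1 : MvPolynomial.C ((β' l : K) * B l i) * PL B (β' + Pi.single k 1 - Pi.single l 1) =
        Lf B k * (MvPolynomial.C ((β' l : K) * B l i) * PL B (β' - Pi.single l 1)) := by
        by_cases hl : 1 ≤ β' l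
        · have : β' + Pi.single k 1 - Pi.single l 1 = (β' - Pi.single l 1) + Pi.single k 1 := by
            funext x
            by_cases hx : x = l
            · subst hx
              simp only [Pi.add_apply, Pi.sub_apply, Pi.single_eq_same]; omega
            · simp [Pi.single_eq_of_ne hx]
          rw [this, PL_add]; ring
        · have : β' l = 0 := by omega
          simp [this]
      by_cases hlk : l = k
      · subst hlk
        have e : β' + Pi.single l 1 - Pi.single l 1 = β' := by
          funext x; simp
        rw [if_pos rfl, ← h1, e]
        simp only [Pi.add_apply, Pi.single_eq_same, Nat.cast_add, Nat.cast_one, add_mul, one_mul, map_add]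
      · rw [if_neg hlk, add_zero, ← h1]
        simp [Pi.single_eq_of_ne hlk]
    rw [Finset.sum_congr rfl fun l _ => key l, Finset.sum_add_distrib]
    simp
    ring

lemma NB_der (B : Matrix (Fin m) (Fin m) K) (β b : Fin m → ℕ) (i : Fin m) :
    NB B β (b + Pi.single i 1) = ∑ l, (β l : K) * B l i * NB B (β - Pi.single l 1) b := by
  have h1 := congrArg (MvPolynomial.coeff (fs b)) (pderiv_PL B i _ β rfl)
  rw [MvPolynomial.coeff_pderiv, MvPolynomial.coeff_sum] at h1
  simp only [MvPolynomial.coeff_C_mul] at h1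
  unfold NB
  rw [pf_add, fs_add_single]
  rw [fs_apply] at h1
  have : ((b i + 1 : ℕ) : K) * pf K b * (PL B β).coeff (fs b + Finsupp.single i 1) =
      pf K b * ((PL B β).coeff (fs b + Finsupp.single i 1) * (b i + 1)) := by push_cast; ring
  rw [this, h1, Finset.mul_sum]
  exact Finset.sum_congr rfl fun l _ => by ring

lemma NB_symm {B : Matrix (Fin m) (Fin m) K} (hB : B.IsSymm) : ∀ (n : ℕ) (β b : Fin m → ℕ), ∑ i, β i = n →
    NB B β b = NB B b β := by
  intro n
  induction n with
  | zero =>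
    intro β b hβ
    have : β = 0 := by
      funext l
      exact (Finset.sum_eq_zero_iff.1 hβ) l (Finset.mem_univ l)
    subst this
    by_cases hb : b = 0
    · rw [hb]
    · have h1 : ∑ i, b i ≠ ∑ i, (0 : Fin m → ℕ) i := by
        intro h
        apply hb
        funext l
        simp only [Pi.zero_apply, Finset.sum_const_zero] at h
        exact (Finset.sum_eq_zero_iff.1 h) l (Finset.mem_univ l)
      rw [NB_zero h1, NB_zero h1.symm]
  | succ n ih =>
    intro β b hβ
    have hne : β ≠ 0 := by rintro rfl; simp at hβ
    obtain ⟨β', k, rfl⟩ := exists_pos hne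
    rw [sum_add_single] at hβ
    rw [NB_mul, NB_der]
    refine Finset.sum_congr rfl fun i _ => ?_
    rw [ih β' _ (by omega), hB.apply i k]

lemma sub_pow_pred (x y : K) : (x - y) ^ (p - 1) = ∑ i : Fin p, x ^ (p - 1 - (i : ℕ)) * y ^ (i : ℕ) := by
  have hpp := (Fact.out : p.Prime)
  rw [Fin.sum_univ_eq_sum_range (fun i => x ^ (p - 1 - i) * y ^ i)]
  by_cases h : x = y
  · subst h
    have : ∀ i ∈ Finset.range p, x ^ (p - 1 - i) * x ^ i = x ^ (p - 1) := by
      intro i hi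
      rw [← pow_add]; congr 1
      have := Finset.mem_range.1 hi; omega
    rw [Finset.sum_congr rfl this, sub_self, Finset.sum_const, Finset.card_range, nsmul_eq_mul,
      CharP.cast_eq_zero, zero_mul, zero_pow (by have := hpp.two_le; omega)]
  · have h1 : x - y ≠ 0 := sub_ne_zero.2 h
    apply mul_right_cancel₀ h1
    have h2 := geom_sum₂_mul y x p
    have h3 : (x - y) ^ (p - 1) * (x - y) = x ^ p - y ^ p := by
      rw [← pow_succ, Nat.sub_add_cancel hpp.pos, sub_pow_char]
    rw [h3]
    have h4 : ∑ i ∈ Finset.range p, x ^ (p - 1 - i) * y ^ i = ∑ i ∈ Finset.range p, y ^ i * x ^ (p - 1 - i) :=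
      Finset.sum_congr rfl fun i _ => mul_comm _ _
    rw [h4]
    linear_combination h2

end thirteen
end PR

/-! ### Part 14 : upper bound, conclusion -/
namespace PR
set_option linter.unusedVariables false
set_option linter.unusedSectionVars false

section fourteen
variable {K : Type*} [Field K] [Fintype K] {m : ℕ} {p : ℕ} [Fact p.Prime] [CharP K p] {t : ℕ}

/-- linear forms as functions -/
def Lr (B : Matrix (Fin m) (Fin m) K) (i : Fin m) : RR K m := ∑ k, B i k • Yc k

lemma aeval_PL (B : Matrix (Fin m) (Fin m) K) (β : Fin m → ℕ) :
    MvPolynomial.aeval (Yc : Fin m → RR K m) (PL B β) = ∏ i, Lr B i ^ β i := by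
  rw [PL, map_prod]
  refine Finset.prod_congr rfl fun i _ => ?_
  rw [map_pow, Lf, Lr, map_sum]
  congr 1
  refine Finset.sum_congr rfl fun k _ => ?_
  rw [map_mul, MvPolynomial.aeval_C, MvPolynomial.aeval_X, Algebra.smul_def]

lemma Lr_prod (B : Matrix (Fin m) (Fin m) K) (a β : Fin m → ℕ) :
    mo a 0 * ∏ i, Lr B i ^ β i = ∑ d ∈ (PL B β).support, (PL B β).coeff d • (mo a d : RR K m) := by
  rw [← aeval_PL, MvPolynomial.aeval_def, MvPolynomial.eval₂_eq', Finset.mul_sum]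
  refine Finset.sum_congr rfl fun d _ => ?_
  rw [Algebra.smul_def, mul_left_comm]
  congr 1
  rw [mo, mo, ← Finset.prod_mul_distrib]
  refine Finset.prod_congr rfl fun i _ => by simp

lemma mo_mem_FF {a b : Fin m → ℕ} (h : ∑ i, (a i + b i) = m * (p - 1)) (hb : ∃ i, p ≤ b i) :
    (mo a b : RR K m) ∈ FF K m p m m := by
  obtain ⟨i, hi⟩ := hb
  refine Submodule.subset_span (Or.inl ⟨a, b, ?_, rfl, fun _ => ⟨i, Or.inr hi⟩⟩)
  rw [h]
  have hpp := (Fact.out : p.Prime).pos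
  obtain ⟨r, hr⟩ : ∃ r, p = r + 1 := ⟨p - 1, by omega⟩
  rw [hr, Nat.add_sub_cancel]; ring

lemma wil_pf {a : Fin m → ℕ} (ha : ∀ i, a i ≤ p - 1) :
    pf K (fun i => p - 1 - a i) * pf K a * (-1) ^ (∑ i, a i) = ((p - 1).factorial : K) ^ m := by
  unfold pf
  rw [← Finset.prod_pow_eq_pow_sum, ← Finset.prod_mul_distrib, ← Finset.prod_mul_distrib,
    Finset.prod_congr rfl fun i _ => wil (K := K) (ha i)]
  simp

/-- symmetric coefficients -/
def DD (p : ℕ) (B : Matrix (Fin m) (Fin m) K) (a α : Fin m → ℕ) : K :=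
  pf K a * (PL B (fun i => p - 1 - a i)).coeff (fs (fun i => p - 1 - α i))

lemma sum_rev {a : Fin m → ℕ} (ha : ∀ i, a i ≤ p - 1) :
    ∑ i, (p - 1 - a i) + ∑ i, a i = m * (p - 1) := by
  rw [← Finset.sum_add_distrib, Finset.sum_congr rfl (g := fun _ => p - 1) fun i _ => by
    have := ha i; omega]
  simp

lemma DD_zero {B : Matrix (Fin m) (Fin m) K} {a α : Fin m → ℕ} (ha : ∀ i, a i ≤ p - 1)
    (hα : ∀ i, α i ≤ p - 1) (h : ∑ i, a i ≠ ∑ i, α i) : DD p B a α = 0 := by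
  have h1 := sum_rev ha
  have h2 := sum_rev hα
  rw [DD, (PL_homog B _).coeff_eq_zero, mul_zero]
  rw [Finsupp.degree_eq_sum]
  simp only [fs_apply]
  omega

lemma DD_symm {B : Matrix (Fin m) (Fin m) K} (hB : B.IsSymm) {a α : Fin m → ℕ} (ha : ∀ i, a i ≤ p - 1)
    (hα : ∀ i, α i ≤ p - 1) : DD p B a α = DD p B α a := by
  by_cases h : ∑ i, a i = ∑ i, α i
  · have h1 := wil_pf (K := K) ha
    have h2 := wil_pf (K := K) hα
    have h3 := NB_symm hB _ (fun i => p - 1 - a i) (fun i => p - 1 - α i) rfl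
    unfold NB at h3
    unfold DD
    have n1 : pf K (fun i => p - 1 - a i) ≠ 0 := pf_ne (p := p) fun i => Nat.sub_le _ _
    have n2 : pf K (fun i => p - 1 - α i) ≠ 0 := pf_ne (p := p) fun i => Nat.sub_le _ _
    have n3 : ((-1 : K)) ^ (∑ i, a i) ≠ 0 := pow_ne_zero _ (by simp)
    rw [← h] at h2
    rw [← h2] at h1
    have h4 : pf K (fun i => p - 1 - a i) * pf K a = pf K (fun i => p - 1 - α i) * pf K α :=
      mul_right_cancel₀ n3 h1
    apply mul_left_cancel₀ (mul_ne_zero n1 n2)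
    generalize pf K (fun i => p - 1 - a i) = A at *
    generalize pf K (fun i => p - 1 - α i) = A' at *
    generalize MvPolynomial.coeff (fs fun i => p - 1 - α i) (PL B fun i => p - 1 - a i) = C1 at *
    generalize MvPolynomial.coeff (fs fun i => p - 1 - a i) (PL B fun i => p - 1 - α i) = C2 at *
    calc A * A' * (pf K a * C1) = (A * pf K a) * (A' * C1) := by ring
      _ = (A' * pf K α) * (A * C2) := by rw [h4, h3]
      _ = _ := by ring
  · rw [DD_zero ha hα h, DD_zero hα ha (Ne.symm h)]

lemma full_mem (hp3 : 3 ≤ p) {B : Matrix (Fin m) (Fin m) K} (hB : B.IsSymm) :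
    ∏ i, (Xc i - Lr B i) ^ (p - 1) ∈ FF K m p m m := by
  have hpp := (Fact.out : p.Prime).pos
  have e1 : ∀ i : Fin m, (Xc i - Lr B i) ^ (p - 1) =
      ∑ j : Fin p, (Xc i : RR K m) ^ (p - 1 - (j : ℕ)) * Lr B i ^ (j : ℕ) := by
    intro i
    funext v
    simp only [Pi.pow_apply, Pi.sub_apply, Finset.sum_apply, Pi.mul_apply]
    exact sub_pow_pred _ _
  rw [Finset.prod_congr rfl fun i _ => e1 i, Finset.prod_univ_sum, Fintype.piFinset_univ]
  have e2 : ∀ x : Fin m → Fin p, ∏ i, ((Xc i : RR K m) ^ (p - 1 - (x i : ℕ)) * Lr B i ^ (x i : ℕ)) =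
      ∑ d ∈ (PL B (fun i => (x i : ℕ))).support, (PL B (fun i => (x i : ℕ))).coeff d •
        (mo (fun i => p - 1 - (x i : ℕ)) d : RR K m) := by
    intro x
    rw [← Lr_prod, Finset.prod_mul_distrib, mo]
    simp
  rw [Finset.sum_congr rfl fun x _ => e2 x]
  -- split off the non reduced exponents
  have e3 : ∀ x : Fin m → Fin p,
      ∑ d ∈ (PL B (fun i => (x i : ℕ))).support, (PL B (fun i => (x i : ℕ))).coeff d •
        (mo (fun i => p - 1 - (x i : ℕ)) d : RR K m) -
      ∑ y : Fin m → Fin p, (PL B (fun i => (x i : ℕ))).coeff (fs (fun i => (y i : ℕ))) •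
        (mo (fun i => p - 1 - (x i : ℕ)) (fun i => (y i : ℕ)) : RR K m) ∈ FF K m p m m := by
    intro x
    set P := PL B (fun i => (x i : ℕ)) with hP
    rw [← Finset.sum_filter_add_sum_filter_not P.support (fun d => ∀ i, d i < p)]
    have e4 : ∑ d ∈ P.support with ∀ i, d i < p, P.coeff d •
        (mo (fun i => p - 1 - (x i : ℕ)) d : RR K m) =
        ∑ y : Fin m → Fin p, P.coeff (fs (fun i => (y i : ℕ))) •
        (mo (fun i => p - 1 - (x i : ℕ)) (fun i => (y i : ℕ)) : RR K m) := by
      have hinj : Function.Injective (fun y : Fin m → Fin p => fs (fun i => (y i : ℕ))) := by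
        intro y z hyz
        funext i
        have := DFunLike.congr_fun hyz i
        simp only [fs_apply] at this
        exact Fin.ext this
      have e5 : ∑ y : Fin m → Fin p, P.coeff (fs (fun i => (y i : ℕ))) •
        (mo (fun i => p - 1 - (x i : ℕ)) (fun i => (y i : ℕ)) : RR K m) =
          ∑ d ∈ Finset.univ.image (fun y : Fin m → Fin p => fs (fun i => (y i : ℕ))), P.coeff d •
        (mo (fun i => p - 1 - (x i : ℕ)) d : RR K m) := by
        rw [Finset.sum_image (fun y _ z _ h => hinj h)]
        rfl
      rw [e5]
      refine Finset.sum_subset ?_ ?_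
      · intro d hd
        rw [Finset.mem_filter] at hd
        rw [Finset.mem_image]
        exact ⟨fun i => ⟨d i, hd.2 i⟩, Finset.mem_univ _, by ext i; rfl⟩
      · intro d hd hd2
        rw [Finset.mem_image] at hd
        obtain ⟨y, -, rfl⟩ := hd
        have : P.coeff (fs (fun i => (y i : ℕ))) = 0 := by
          by_contra hne
          exact hd2 (Finset.mem_filter.2 ⟨MvPolynomial.mem_support_iff.2 hne, fun i => (y i).2⟩)
        rw [this, zero_smul]
    rw [e4, add_sub_cancel_left]
    refine Submodule.sum_mem _ fun d hd => Submodule.smul_mem _ _ ?_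
    rw [Finset.mem_filter, MvPolynomial.mem_support_iff] at hd
    obtain ⟨hd1, hd2⟩ := hd
    push Not at hd2
    refine mo_mem_FF ?_ hd2
    have h1 : d.degree = ∑ i, (x i : ℕ) := by
      by_contra h
      exact hd1 ((PL_homog B _).coeff_eq_zero h)
    rw [Finsupp.degree_eq_sum] at h1
    rw [Finset.sum_add_distrib, h1]
    exact sum_rev fun i => by have := (x i).2; omega
  suffices h : ∑ x : Fin m → Fin p, ∑ y : Fin m → Fin p, (PL B (fun i => (x i : ℕ))).coeff (fs (fun i => (y i : ℕ))) •
        (mo (fun i => p - 1 - (x i : ℕ)) (fun i => (y i : ℕ)) : RR K m) ∈ FF K m p m m by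
    have h2 := Submodule.sum_mem (FF K m p m m) (t := Finset.univ) fun x _ => e3 x
    rw [Finset.sum_sub_distrib] at h2
    exact (Submodule.sub_mem_iff_left _ h).1 h2
  -- reindex
  have e6 : ∑ x : Fin m → Fin p, ∑ y : Fin m → Fin p, (PL B (fun i => (x i : ℕ))).coeff (fs (fun i => (y i : ℕ))) •
        (mo (fun i => p - 1 - (x i : ℕ)) (fun i => (y i : ℕ)) : RR K m) =
      ∑ a : Fin m → Fin p, ∑ α : Fin m → Fin p, DD p B (fun i => a i) (fun i => α i) •
        ev K p (fun i => a i) (fun i => α i) := by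
    set e : (Fin m → Fin p) ≃ (Fin m → Fin p) := Equiv.piCongrRight fun _ => Fin.revPerm with he
    have hv : ∀ (a : Fin m → Fin p), (fun i => (e a i : ℕ)) = fun i => p - 1 - (a i : ℕ) := by
      intro a
      funext i
      simp [he, Fin.val_rev]
      omega
    rw [← Equiv.sum_comp e]
    refine Finset.sum_congr rfl fun a _ => ?_
    rw [← Equiv.sum_comp e]
    refine Finset.sum_congr rfl fun α _ => ?_
    have ha : ∀ i, (a i : ℕ) ≤ p - 1 := fun i => by have := (a i).2; omega
    have hva : (fun i => p - 1 - (e a i : ℕ)) = fun i => (a i : ℕ) := by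
      funext i
      have h1 := congrFun (hv a) i
      have := ha i
      omega
    rw [hv, hv, hva, DD, ev, smul_smul, mul_right_comm, mul_inv_cancel₀ (pf_ne ha), one_mul]
  rw [e6]
  have h2 : (2 : K) ≠ 0 := by
    have := cast_ne_zero_of_lt (K := K) (p := p) (n := 2) (by norm_num) (by omega)
    exact_mod_cast this
  have hb : ∀ (a : Fin m → Fin p) (i : Fin m), (a i : ℕ) ≤ p - 1 := fun a i => by have := (a i).2; omega
  have e7 : ∑ a : Fin m → Fin p, ∑ α : Fin m → Fin p, DD p B (fun i => a i) (fun i => α i) •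
        ev K p (fun i => a i) (fun i => α i) =
      ∑ a : Fin m → Fin p, ∑ α : Fin m → Fin p, (2⁻¹ * DD p B (fun i => a i) (fun i => α i)) •
        psi p (1 : K) (fun i => a i) (fun i => α i) := by
    have e8 : ∑ a : Fin m → Fin p, ∑ α : Fin m → Fin p, DD p B (fun i => a i) (fun i => α i) •
        ev K p (fun i => α i) (fun i => a i) =
      ∑ a : Fin m → Fin p, ∑ α : Fin m → Fin p, DD p B (fun i => a i) (fun i => α i) •
        ev K p (fun i => a i) (fun i => α i) := by
      rw [Finset.sum_comm]
      refine Finset.sum_congr rfl fun a _ => Finset.sum_congr rfl fun α _ => ?_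
      rw [DD_symm hB (hb _) (hb _)]
    simp only [psi, one_smul, smul_add, mul_smul, Finset.sum_add_distrib, ← Finset.smul_sum]
    rw [e8, ← add_smul, ← two_mul, mul_inv_cancel₀ h2, one_smul]
  rw [e7]
  refine Submodule.sum_mem _ fun a _ => Submodule.sum_mem _ fun α _ => ?_
  by_cases hs : ∑ i, (a i : ℕ) = ∑ i, (α i : ℕ)
  · refine Submodule.smul_mem _ _ (Submodule.subset_span (Or.inr ⟨⟨rfl, rfl⟩, _, _, ⟨hb a, hb α, ?_⟩, rfl⟩))
    rw [ldeg, Finset.sum_add_distrib, hs, add_comm (∑ i, (α i : ℕ)), sum_rev (hb α)]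
    obtain ⟨r, hr⟩ : ∃ r, p = r + 1 := ⟨p - 1, by omega⟩
    rw [hr, Nat.add_sub_cancel]; ring
  · rw [DD_zero (hb a) (hb α) hs, mul_zero, zero_smul]
    exact Submodule.zero_mem _

lemma HD_mul_MM {A B : ℕ} {f z : RR K m} (hf : f ∈ HD K m p (A + 1) B) (hz : z ∈ MM K m) :
    f * z ∈ HD K m p A B := by
  have : MM K m ≤ (HD K m p A B).comap (LinearMap.mulLeft K f) := by
    rw [MM, Submodule.span_le]
    rintro _ (⟨i, rfl⟩ | ⟨i, rfl⟩)
    · have h1 := HD_mul_X (A := A + 1) (Nat.succ_pos A) i hf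
      rw [Nat.add_sub_cancel] at h1
      rw [SetLike.mem_coe, Submodule.mem_comap, LinearMap.mulLeft_apply]
      exact h1
    · have h1 := HD_mul_Y (A := A + 1) (Nat.succ_pos A) i hf
      rw [Nat.add_sub_cancel] at h1
      rw [SetLike.mem_coe, Submodule.mem_comap, LinearMap.mulLeft_apply]
      exact h1
  have h2 := this hz
  rw [Submodule.mem_comap, LinearMap.mulLeft_apply] at h2
  exact h2

lemma HD_mul_pow {B : ℕ} {z : RR K m} (hz : z ∈ MM K m) : ∀ (n : ℕ) {A : ℕ} {f : RR K m},
    f ∈ HD K m p (A + n) B → f * z ^ n ∈ HD K m p A B := by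
  intro n
  induction n with
  | zero => intro A f hf; simpa using hf
  | succ n ih =>
    intro A f hf
    rw [pow_succ', ← mul_assoc]
    exact ih (HD_mul_MM (by rw [add_assoc]; exact hf) hz)

lemma HD_mul_prod {B : ℕ} {l : Fin m → RR K m} (hl : ∀ i, l i ∈ MM K m) (n : ℕ) (J : Finset (Fin m)) :
    ∀ {A : ℕ} {f : RR K m}, f ∈ HD K m p (A + J.card * n) B → f * ∏ i ∈ J, l i ^ n ∈ HD K m p A B := by
  induction J using Finset.induction_on with
  | empty => intro A f hf; simpa using hf
  | insert i J hi ih =>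
    intro A f hf
    rw [Finset.prod_insert hi, ← mul_assoc]
    apply ih
    apply HD_mul_pow (hl i)
    rw [Finset.card_insert_of_notMem hi] at hf
    convert hf using 1
    ring

lemma pow_card_pred [NeZero t] (hK : Fintype.card K = p ^ t) (f : RR K m) :
    f ^ (Fintype.card K - 1) = ∏ j : Fin t, (f ^ (p - 1)) ^ p ^ (j : ℕ) := by
  simp only [← pow_mul]
  rw [Finset.prod_pow_eq_pow_sum, hK]
  congr 1
  rw [Fin.sum_univ_eq_sum_range (fun j => (p - 1) * p ^ j), ← Finset.mul_sum, mul_comm]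
  obtain ⟨r, rfl⟩ : ∃ r, p = r + 1 := ⟨p - 1, by have := (Fact.out : p.Prime).pos; omega⟩
  have := geom_sum_mul_add r t
  simp only [Nat.add_sub_cancel]
  omega

lemma chi_graph_mem [NeZero t] (hK : Fintype.card K = p ^ t) (hp3 : 3 ≤ p) (hm : 1 ≤ m)
    {W : Submodule K (VV K m)} (hW : IsLag W) (h0 : W ⊓ Y0 = ⊥) : chi W ∈ TT K m p t := by
  obtain ⟨B, hB, hiff⟩ := graph_form hW h0
  have hpp := (Fact.out : p.Prime).pos
  have e1 : chi W = ∏ i, (- (Xc i - Lr B i) ^ (Fintype.card K - 1) + 1) := by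
    funext v
    rw [Finset.prod_apply, chi]
    have h1 : ∀ i, (- (Xc i - Lr B i) ^ (Fintype.card K - 1) + 1 : RR K m) v =
        if v.1 i = ∑ k, B i k * v.2 k then 1 else 0 := by
      intro i
      have : Lr B i v = ∑ k, B i k * v.2 k := by
        simp [Lr, Yc, Finset.sum_apply]
      simp only [Pi.add_apply, Pi.neg_apply, Pi.pow_apply, Pi.sub_apply, Pi.one_apply, this, Xc]
      by_cases h : v.1 i = ∑ k, B i k * v.2 k
      · rw [if_pos h, h, sub_self, zero_pow, neg_zero, zero_add]
        have := Fintype.one_lt_card (α := K)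
        omega
      · rw [if_neg h, FiniteField.pow_card_sub_one_eq_one _ (sub_ne_zero.2 h)]; ring
    rw [Finset.prod_congr rfl fun i _ => h1 i, Finset.prod_boole]
    simp [hiff]
  rw [e1, Finset.prod_add]
  refine Submodule.sum_mem _ fun J _ => ?_
  simp only [Finset.prod_const_one, mul_one]
  have e2 : ∏ i ∈ J, (- (Xc i - Lr B i) ^ (Fintype.card K - 1)) =
      ((-1 : K) ^ J.card) • ∏ j : Fin t, (∏ i ∈ J, (Xc i - Lr B i) ^ (p - 1)) ^ p ^ (j : ℕ) := by
    have : ∏ j : Fin t, (∏ i ∈ J, (Xc i - Lr B i) ^ (p - 1)) ^ p ^ (j : ℕ) =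
        ∏ i ∈ J, (Xc i - Lr B i) ^ (Fintype.card K - 1) := by
      simp_rw [← Finset.prod_pow]
      rw [Finset.prod_comm]
      exact Finset.prod_congr rfl fun i _ => (pow_card_pred hK _).symm
    rw [this, Finset.prod_neg, Algebra.smul_def]
    simp
  rw [e2]
  refine Submodule.smul_mem _ _ ?_
  have hJm : J.card ≤ m := by simpa using Finset.card_le_univ J
  refine prod_reduce hK hm _ (fun _ => J.card) rfl (fun _ => hJm) _ fun j => ?_
  by_cases hJ : J = Finset.univ
  · have : J.card = m := by rw [hJ]; simp
    rw [this, hJ]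
    exact full_mem hp3 hB
  · have hlt : J.card < m := by
      by_contra h
      exact hJ (Finset.eq_univ_of_card J (by simp; omega))
    rw [FF_eq_HD (by omega)]
    rw [← one_mul (∏ i ∈ J, _)]
    refine HD_mul_prod (l := fun i => Xc i - Lr B i) ?_ _ J ?_
    · intro i
      refine Submodule.sub_mem _ (X_mem i) (Submodule.sum_mem _ fun k _ => Submodule.smul_mem _ _ (Y_mem k))
    · refine Submodule.subset_span ⟨0, 0, ?_, mo_zero.symm⟩
      obtain ⟨r, hr⟩ : ∃ r, p = r + 1 := ⟨p - 1, by omega⟩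
      rw [hr, Nat.add_sub_cancel]; simp; ring

theorem UU_le_TT [NeZero t] (hK : Fintype.card K = p ^ t) (hp3 : 3 ≤ p) (hm : 1 ≤ m) :
    UU K m ≤ TT K m p t := by
  rw [UU, Submodule.span_le]
  rintro _ ⟨W, hW, rfl⟩
  exact swap_reduce (fun k f hf => TT_swp k hf) (fun W hW h0 => chi_graph_mem hK hp3 hm hW h0) _ W hW rfl

end fourteen
end PR

/-! ### Part 15 : the basis of reduced monomials -/
namespace PR
set_option linter.unusedVariables false
set_option linter.unusedSectionVars false

/-- digits -/
abbrev Dg (m p : ℕ) := (Fin m → Fin p) × (Fin m → Fin p)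

/-- degree of a digit -/
def dwt {m p : ℕ} (d : Dg m p) : ℕ := ∑ i, ((d.1 i : ℕ) + (d.2 i : ℕ))

/-- weight of an array -/
def wtt {m t : ℕ} (a b : Fin t → Fin m → ℕ) : ℕ := ∑ j, ∑ i, (a j i + b j i)

lemma wtt_add {m t : ℕ} (a b a' b' : Fin t → Fin m → ℕ) :
    wtt (a + a') (b + b') = wtt a b + wtt a' b' := by
  unfold wtt
  rw [← Finset.sum_add_distrib]
  refine Finset.sum_congr rfl fun j _ => ?_
  rw [← Finset.sum_add_distrib]
  refine Finset.sum_congr rfl fun i _ => ?_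
  simp only [Pi.add_apply]
  ring

section fifteen
variable {K : Type*} [Field K] [Fintype K] {m : ℕ} {p : ℕ} [Fact p.Prime] [CharP K p] {t : ℕ}

variable (K) in
/-- reduced monomials -/
def rd (e : Fin t → Dg m p) : RR K m :=
  mon K p (fun j i => ((e j).1 i : ℕ)) (fun j i => ((e j).2 i : ℕ))

lemma rd_eq (e : Fin t → Dg m p) : rd K e =
    ∏ j, (mo (fun i => ((e j).1 i : ℕ)) (fun i => ((e j).2 i : ℕ)) : RR K m) ^ p ^ (j : ℕ) := rfl

variable (K m p t) in
/-- span of reduced monomials of bounded weight -/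
def RW (w : ℕ) : Submodule K (RR K m) :=
  Submodule.span K {f | ∃ e : Fin t → Dg m p, ∑ j, dwt (e j) ≤ w ∧ f = rd K e}

variable (K m p t) in
/-- span of monomials of bounded weight -/
def PW (w : ℕ) : Submodule K (RR K m) :=
  Submodule.span K {f | ∃ a b : Fin t → Fin m → ℕ, wtt a b ≤ w ∧ f = mon K p a b}

lemma wtt_eu_x (n : ℕ) (j : Fin t) (i : Fin m) : wtt (n • eu j i) 0 = n := by
  unfold wtt
  have : ∀ j', ∑ i', ((n • eu j i) j' i' + (0 : Fin t → Fin m → ℕ) j' i') =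
      n * ∑ i', eu j i j' i' := by
    intro j'
    rw [Finset.mul_sum]
    simp
  simp only [this, sum_eu]
  simp

lemma wtt_eu_y (n : ℕ) (j : Fin t) (i : Fin m) : wtt 0 (n • eu j i) = n := by
  refine Eq.trans ?_ (wtt_eu_x n j i)
  unfold wtt
  refine Finset.sum_congr rfl fun j' _ => Finset.sum_congr rfl fun i' _ => ?_
  simp

lemma sub_nsmul_eu {a : Fin t → Fin m → ℕ} {n : ℕ} {j : Fin t} {i : Fin m} (h : n ≤ a j i) :
    ∃ a', a = a' + n • eu j i := by
  refine ⟨a - n • eu j i, ?_⟩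
  funext j' i'
  simp only [Pi.add_apply, Pi.sub_apply, Pi.smul_apply, smul_eq_mul, eu]
  split_ifs with hh
  · rw [hh.1, hh.2]; omega
  · omega

lemma mon_mem_RW [NeZero t] (hK : Fintype.card K = p ^ t) (w : ℕ) (a b : Fin t → Fin m → ℕ)
    (h : wtt a b ≤ w) : mon K p a b ∈ RW K m p t w := by
  have hp2 := (Fact.out : p.Prime).two_le
  induction hn : wtt a b using Nat.strong_induction_on generalizing a b with
  | _ n ih =>
  by_cases ha : ∃ j i, p ≤ a j i
  · obtain ⟨j, i, hji⟩ := ha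
    obtain ⟨a', rfl⟩ := sub_nsmul_eu hji
    rw [carry_x hK]
    have e1 := wtt_add a' b (p • eu j i) 0
    have e2 := wtt_add a' b (1 • eu (j + 1) i) 0
    rw [add_zero, wtt_eu_x] at e1 e2
    rw [one_smul] at e2
    exact ih _ (by omega) _ _ (by omega) rfl
  by_cases hb : ∃ j i, p ≤ b j i
  · obtain ⟨j, i, hji⟩ := hb
    obtain ⟨b', rfl⟩ := sub_nsmul_eu hji
    rw [carry_y hK]
    have e1 := wtt_add a b' 0 (p • eu j i)
    have e2 := wtt_add a b' 0 (1 • eu (j + 1) i)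
    rw [add_zero, wtt_eu_y] at e1 e2
    rw [one_smul] at e2
    exact ih _ (by omega) _ _ (by omega) rfl
  push Not at ha hb
  refine Submodule.subset_span ⟨fun j => (fun i => ⟨a j i, ha j i⟩, fun i => ⟨b j i, hb j i⟩), ?_, rfl⟩
  exact h

lemma PW_le_RW [NeZero t] (hK : Fintype.card K = p ^ t) (w : ℕ) : PW K m p t w ≤ RW K m p t w := by
  refine Submodule.span_le.2 ?_
  rintro f ⟨a, b, h, rfl⟩
  exact mon_mem_RW hK w a b h

lemma PW_mul {u v : ℕ} : PW K m p t u * PW K m p t v ≤ PW K m p t (u + v) := by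
  unfold PW
  rw [Submodule.span_mul_span]
  refine Submodule.span_mono ?_
  rintro f ⟨x, ⟨a, b, h, rfl⟩, y, ⟨a', b', h', rfl⟩, rfl⟩
  refine ⟨a + a', b + b', ?_, (mon_mul _ _ _ _)⟩
  rw [wtt_add]; omega

lemma one_mem_PW (w : ℕ) : (1 : RR K m) ∈ PW K m p t w :=
  Submodule.subset_span ⟨0, 0, by simp [wtt], by simp [mon, mo_zero]⟩

lemma X_frob_PW [NeZero t] (hK : Fintype.card K = p ^ t) (i : Fin m) (j : ℕ) :
    ((Xc i : RR K m) ^ p ^ j ∈ PW K m p t 1) ∧ ((Yc i : RR K m) ^ p ^ j ∈ PW K m p t 1) := by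
  suffices h : ∃ j' : Fin t, ∀ f : RR K m, f ^ p ^ j = f ^ p ^ (j' : ℕ) by
    obtain ⟨j', h⟩ := h
    rw [h, h]
    constructor
    · refine Submodule.subset_span ⟨1 • eu j' i, 0, by rw [wtt_eu_x], ?_⟩
      rw [mon_nsmul_eu_x, pow_one]
    · refine Submodule.subset_span ⟨0, 1 • eu j' i, by rw [wtt_eu_y], ?_⟩
      rw [mon_nsmul_eu_y, pow_one]
  induction j with
  | zero => exact ⟨⟨0, Nat.pos_of_ne_zero (NeZero.ne t)⟩, fun f => rfl⟩
  | succ j ih =>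
    obtain ⟨j', h⟩ := ih
    refine ⟨j' + 1, fun f => ?_⟩
    rw [← frob_succ hK, ← h, ← pow_mul, pow_succ']

lemma LL_le_PW [NeZero t] (hK : Fintype.card K = p ^ t) : LL K m p ≤ PW K m p t 1 := by
  refine sup_le (Submodule.one_le.2 (one_mem_PW 1)) (Submodule.span_le.2 ?_)
  rintro f ⟨z, hz, j, rfl⟩
  rw [SetLike.mem_coe]
  induction hz using Submodule.span_induction with
  | mem x hx =>
    rcases hx with ⟨i, rfl⟩ | ⟨i, rfl⟩
    · exact (X_frob_PW hK i j).1
    · exact (X_frob_PW hK i j).2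
  | zero => rw [zero_pow (pow_pos (Fact.out : p.Prime).pos _).ne']; exact Submodule.zero_mem _
  | add x y _ _ hx hy => rw [add_pow_char_pow]; exact Submodule.add_mem _ hx hy
  | smul c x _ hx => rw [smul_pow]; exact Submodule.smul_mem _ _ hx

lemma LL_pow_le_PW [NeZero t] (hK : Fintype.card K = p ^ t) (w : ℕ) :
    LL K m p ^ w ≤ PW K m p t w := by
  induction w with
  | zero => rw [pow_zero]; exact Submodule.one_le.2 (one_mem_PW 0)
  | succ w ih => rw [pow_succ]; exact (mul_le_mul' ih (LL_le_PW hK)).trans PW_mul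

lemma delta_mem (v : VV K m) : (Pi.single v 1 : RR K m) ∈
    Algebra.adjoin K (Set.range Xc ∪ Set.range Yc : Set (RR K m)) := by
  set S := Algebra.adjoin K (Set.range Xc ∪ Set.range Yc : Set (RR K m)) with hS
  have hX : ∀ i, (Xc i : RR K m) ∈ S := fun i => Algebra.subset_adjoin (Or.inl ⟨i, rfl⟩)
  have hY : ∀ i, (Yc i : RR K m) ∈ S := fun i => Algebra.subset_adjoin (Or.inr ⟨i, rfl⟩)
  have hc : ∀ c : K, algebraMap K (RR K m) c ∈ S := fun c => S.algebraMap_mem c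
  have hmem : ((∏ i, (1 - (Xc i - algebraMap K (RR K m) (v.1 i)) ^ (Fintype.card K - 1))) *
      ∏ i, (1 - (Yc i - algebraMap K (RR K m) (v.2 i)) ^ (Fintype.card K - 1)) : RR K m) ∈ S := by
    refine S.mul_mem (S.prod_mem fun i _ => ?_) (S.prod_mem fun i _ => ?_)
    · exact S.sub_mem S.one_mem (S.pow_mem (S.sub_mem (hX i) (hc _)) _)
    · exact S.sub_mem S.one_mem (S.pow_mem (S.sub_mem (hY i) (hc _)) _)
  convert hmem using 1
  have hf : ∀ x : K, 1 - x ^ (Fintype.card K - 1) = if x = 0 then 1 else 0 := by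
    intro x
    by_cases hx : x = 0
    · rw [if_pos hx, hx, zero_pow (by have := Fintype.one_lt_card (α := K); omega), sub_zero]
    · rw [if_neg hx, FiniteField.pow_card_sub_one_eq_one x hx, sub_self]
  funext w
  have e1 : ∀ (c : K), (algebraMap K (RR K m) c) w = c := fun c => rfl
  simp only [Pi.mul_apply, Finset.prod_apply, Pi.sub_apply, Pi.pow_apply, Pi.one_apply, e1, Xc, Yc, hf]
  rw [Finset.prod_boole, Finset.prod_boole]
  by_cases h : w = v
  · subst h; simp
  · rw [Pi.single_eq_of_ne h]
    by_cases h1 : ∀ i ∈ Finset.univ, w.1 i - v.1 i = 0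
    · by_cases h2 : ∀ i ∈ Finset.univ, w.2 i - v.2 i = 0
      · exfalso
        apply h
        refine Prod.ext (funext fun i => sub_eq_zero.1 (h1 i (Finset.mem_univ _)))
          (funext fun i => sub_eq_zero.1 (h2 i (Finset.mem_univ _)))
      · rw [if_neg h2, mul_zero]
    · rw [if_neg h1, zero_mul]

lemma mem_some_PW [NeZero t] (hK : Fintype.card K = p ^ t) (f : RR K m) :
    ∃ w, f ∈ PW K m p t w := by
  have hmono : ∀ {u v : ℕ}, u ≤ v → PW K m p t u ≤ PW K m p t v := by
    intro u v h
    refine Submodule.span_mono ?_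
    rintro f ⟨a, b, h', rfl⟩
    exact ⟨a, b, by omega, rfl⟩
  have hadd : ∀ f g : RR K m, (∃ w, f ∈ PW K m p t w) → (∃ w, g ∈ PW K m p t w) →
      ∃ w, f + g ∈ PW K m p t w := by
    rintro f g ⟨u, hu⟩ ⟨v, hv⟩
    exact ⟨u + v, Submodule.add_mem _ (hmono (by omega) hu) (hmono (by omega) hv)⟩
  have hadj : ∀ f ∈ Algebra.adjoin K (Set.range Xc ∪ Set.range Yc : Set (RR K m)),
      ∃ w, f ∈ PW K m p t w := by
    intro f hf
    induction hf using Algebra.adjoin_induction with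
    | mem x hx =>
      refine ⟨1, ?_⟩
      rcases hx with ⟨i, rfl⟩ | ⟨i, rfl⟩
      · simpa using (X_frob_PW (t := t) hK i 0).1
      · simpa using (X_frob_PW (t := t) hK i 0).2
    | algebraMap c => exact ⟨0, by rw [Algebra.algebraMap_eq_smul_one]; exact Submodule.smul_mem _ _ (one_mem_PW 0)⟩
    | add x y _ _ hx hy => exact hadd _ _ hx hy
    | mul x y _ _ hx hy =>
      obtain ⟨u, hu⟩ := hx
      obtain ⟨v, hv⟩ := hy
      exact ⟨u + v, PW_mul (Submodule.mul_mem_mul hu hv)⟩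
  have hs : f = ∑ v, f v • (Pi.single v 1 : RR K m) := by
    funext w
    rw [Finset.sum_apply, Finset.sum_eq_single w]
    · simp
    · intro b _ hb; simp [Pi.single_eq_of_ne hb.symm]
    · simp
  apply hadj
  rw [hs]
  exact Subalgebra.sum_mem _ fun v _ => Subalgebra.smul_mem _ (delta_mem v) _

lemma rd_span [NeZero t] (hK : Fintype.card K = p ^ t) :
    ⊤ ≤ Submodule.span K (Set.range (rd K : (Fin t → Dg m p) → RR K m)) := by
  intro f _
  obtain ⟨w, hw⟩ := mem_some_PW (t := t) (p := p) hK f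
  refine Submodule.span_mono ?_ (PW_le_RW hK w hw)
  rintro f ⟨e, -, rfl⟩
  exact ⟨e, rfl⟩

lemma rd_indep [NeZero t] (hK : Fintype.card K = p ^ t) :
    LinearIndependent K (rd K : (Fin t → Dg m p) → RR K m) := by
  refine linearIndependent_of_top_le_span_of_card_eq_finrank (rd_span hK) ?_
  rw [Module.finrank_pi]
  simp only [Fintype.card_prod, Fintype.card_pi, Fintype.card_fin, Finset.prod_const,
    Finset.card_univ, hK]
  ring

/-- the basis of reduced monomials -/
def rdB [NeZero t] (hK : Fintype.card K = p ^ t) : Module.Basis (Fin t → Dg m p) K (RR K m) :=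
  Module.Basis.mk (rd_indep hK) (rd_span hK)

lemma rdB_apply [NeZero t] (hK : Fintype.card K = p ^ t) (e : Fin t → Dg m p) :
    rdB hK e = rd K e := by rw [rdB, Module.Basis.mk_apply]

lemma NN_coord [NeZero t] (hK : Fintype.card K = p ^ t) {w : ℕ} {f : RR K m} (hf : f ∈ NN K m p w)
    (e : Fin t → Dg m p) (he : w ≤ ∑ j, dwt (e j)) : (rdB hK).repr f e = 0 := by
  cases w with
  | zero =>
    have : f = 0 := by simpa [NN] using hf
    rw [this]; simp
  | succ w =>
    have h1 : f ∈ RW K m p t w := PW_le_RW hK w (LL_pow_le_PW hK w hf)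
    have h2 : RW K m p t w ≤ LinearMap.ker ((rdB (m := m) hK).coord e) := by
      refine Submodule.span_le.2 ?_
      rintro x ⟨e', h', rfl⟩
      rw [SetLike.mem_coe, LinearMap.mem_ker, ← rdB_apply hK, Module.Basis.coord_apply,
        Module.Basis.repr_self, Finsupp.single_eq_of_ne]
      rintro rfl
      omega
    have h3 := h2 h1
    rwa [LinearMap.mem_ker, Module.Basis.coord_apply] at h3

end fifteen
end PR

/-! ### Part 16 : the basis of the code -/
namespace PR
set_option linter.unusedVariables false
set_option linter.unusedSectionVars false

/-- leading digit of a state -/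
def lead {m p : ℕ} (x : Dg m p) : Dg m p := (x.1, fun i => Fin.rev (x.2 i))

lemma lead_inj {m p : ℕ} {x y : Dg m p} (h : lead x = lead y) : x = y := by
  have h1 := congrArg Prod.fst h
  have h2 := congrArg Prod.snd h
  refine Prod.ext h1 (funext fun i => ?_)
  exact Fin.rev_injective (congrFun h2 i)

lemma dwt_lead {m p : ℕ} (x : Dg m p) :
    dwt (lead x) = ldeg p (fun i => (x.1 i : ℕ)) (fun i => (x.2 i : ℕ)) := by
  unfold dwt ldeg lead
  refine Finset.sum_congr rfl fun i _ => ?_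
  have := (x.2 i).2
  simp only [Fin.val_rev]
  omega

/-- admissible representatives -/
def QP (m p A B : ℕ) (x : Dg m p) : Prop :=
  dwt (lead x) + A = p * B ∧
    (A = m ∧ B = m → Fintype.equivFin (Fin m → Fin p) x.1 ≤ Fintype.equivFin (Fin m → Fin p) x.2)

lemma QP.dst {m p A B : ℕ} {x : Dg m p} (h : dwt (lead x) + A = p * B) :
    Dst p A B (fun i => (x.1 i : ℕ)) (fun i => (x.2 i : ℕ)) := by
  refine ⟨fun i => ?_, fun i => ?_, ?_⟩
  · have := (x.1 i).2; dsimp only; omega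
  · have := (x.2 i).2; dsimp only; omega
  · rw [← dwt_lead]; exact h

lemma type_unique {t p : ℕ} [NeZero t] (hp : 2 ≤ p) {l s s' : Fin t → ℕ}
    (h : ∀ j, l j + s j = p * s (j + 1)) (h' : ∀ j, l j + s' j = p * s' (j + 1)) : s = s' := by
  obtain ⟨j0, -, hj0⟩ := Finset.exists_max_image (Finset.univ : Finset (Fin t))
    (fun j => |(s j : ℤ) - s' j|) ⟨0, Finset.mem_univ _⟩
  have e1 := h (j0 - 1)
  have e2 := h' (j0 - 1)
  rw [sub_add_cancel] at e1 e2
  have e3 : (s (j0 - 1) : ℤ) - s' (j0 - 1) = p * ((s j0 : ℤ) - s' j0) := by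
    zify at e1 e2
    linarith
  have e4 := hj0 (j0 - 1) (Finset.mem_univ _)
  rw [e3, abs_mul, Nat.abs_cast] at e4
  have e5 : |(s j0 : ℤ) - s' j0| = 0 := by
    have h0 := abs_nonneg ((s j0 : ℤ) - s' j0)
    have h2 : (2 : ℤ) ≤ p := by exact_mod_cast hp
    nlinarith
  funext j
  have e6 := hj0 j (Finset.mem_univ _)
  rw [e5] at e6
  have e7 := abs_nonpos_iff.1 e6
  omega

section sixteen
variable {K : Type*} [Field K] [Fintype K] {m : ℕ} {p : ℕ} [Fact p.Prime] [CharP K p] {t : ℕ}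

/-- coefficients of a digit element -/
def dcf (ε : K) (x d : Dg m p) : K :=
  (if d = lead x then (pf K (fun i => (x.1 i : ℕ)))⁻¹ else 0) +
    (if d = lead x.swap then ε * (pf K (fun i => (x.2 i : ℕ)))⁻¹ else 0)

lemma psi_dcf (ε : K) (x : Dg m p) :
    psi p ε (fun i => (x.1 i : ℕ)) (fun i => (x.2 i : ℕ)) =
      ∑ d : Dg m p, dcf ε x d • (mo (fun i => (d.1 i : ℕ)) (fun i => (d.2 i : ℕ)) : RR K m) := by
  have hr : ∀ y : Dg m p, (mo (fun i => ((lead y).1 i : ℕ)) (fun i => ((lead y).2 i : ℕ)) : RR K m) =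
      mo (fun i => (y.1 i : ℕ)) (fun i => p - 1 - (y.2 i : ℕ)) := by
    intro y
    congr 1
    funext i
    simp only [lead, Fin.val_rev]
    omega
  simp only [dcf, add_smul, Finset.sum_add_distrib, ite_smul, zero_smul]
  rw [Finset.sum_ite_eq', Finset.sum_ite_eq', if_pos (Finset.mem_univ _), if_pos (Finset.mem_univ _),
    hr, hr, psi, ev, ev, mul_smul]
  rfl

variable (K) in
/-- elements of the code -/
def tt [NeZero t] (s : Fin t → ℕ) (x : Fin t → Dg m p) : RR K m :=
  (tctx K s (fun j i => ((x j).1 i : ℕ)) (fun j i => ((x j).2 i : ℕ))).tot p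

lemma tt_expand [NeZero t] (s : Fin t → ℕ) (x : Fin t → Dg m p) :
    tt K s x = ∑ e : Fin t → Dg m p,
      (∏ j, dcf (epsl K m (s j) (s (j + 1))) (x j) (e j) ^ p ^ (j : ℕ)) • rd K e := by
  unfold tt Ctx.tot tctx
  dsimp only
  have : ∀ j : Fin t, psi p (epsl K m (s j) (s (j + 1))) (fun i => ((x j).1 i : ℕ))
      (fun i => ((x j).2 i : ℕ)) ^ p ^ (j : ℕ) =
      ∑ d : Dg m p, dcf (epsl K m (s j) (s (j + 1))) (x j) d ^ p ^ (j : ℕ) •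
        (mo (fun i => (d.1 i : ℕ)) (fun i => (d.2 i : ℕ)) : RR K m) ^ p ^ (j : ℕ) := by
    intro j
    rw [psi_dcf, sum_pow_char_pow]
    simp only [smul_pow]
  rw [Finset.prod_congr rfl (fun j _ => this j), Finset.prod_univ_sum, Fintype.piFinset_univ]
  refine Finset.sum_congr rfl fun e _ => ?_
  rw [Finset.prod_smul, rd_eq]

lemma tt_coord [NeZero t] (hK : Fintype.card K = p ^ t) (s : Fin t → ℕ) (x e : Fin t → Dg m p) :
    (rdB hK).repr (tt K s x) e =
      ∏ j, dcf (epsl K m (s j) (s (j + 1))) (x j) (e j) ^ p ^ (j : ℕ) := by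
  rw [tt_expand]
  simp only [← rdB_apply hK]
  rw [Module.Basis.repr_sum_self]

lemma dcf_dwt {A B : ℕ} {x d : Dg m p} (h : dwt (lead x) + A = p * B)
    (hd : dcf (epsl K m A B) x d ≠ 0) :
    dwt d + A = p * B ∧ (d = lead x ∨ ((A = m ∧ B = m) ∧ d = lead x.swap)) := by
  by_cases h1 : d = lead x
  · exact ⟨by rw [h1, h], Or.inl h1⟩
  by_cases h2 : d = lead x.swap
  · by_cases h3 : A = m ∧ B = m
    · refine ⟨?_, Or.inr ⟨h3, h2⟩⟩
      rw [h2, ← h, dwt_lead, dwt_lead]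
      have hs := (QP.dst h)
      have hh := hs.hst (K := K)
      obtain ⟨g1, g2, g3⟩ := hh
      rcases g3 with g3 | g3
      · simp [epsl, h3] at g3
      · rw [← ldeg_swap g1 g2 g3]; rfl
    · exfalso; apply hd; simp [dcf, h1, epsl, h3]
  · exfalso; apply hd; simp [dcf, h1, h2]

variable (m p t) in
/-- index set of the basis of the code -/
abbrev Idx [NeZero t] := (s : Fin t → Fin m) × (∀ j, {x : Dg m p // QP m p ((s j : ℕ) + 1) ((s (j + 1) : ℕ) + 1) x})

variable (m p t) in
/-- zero array -/
def ez : Fin t → Dg m p := fun _ => (fun _ => ⟨0, (Fact.out : p.Prime).pos⟩, fun _ => ⟨0, (Fact.out : p.Prime).pos⟩)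

variable (K) in
/-- the basis of the code -/
def vec [NeZero t] : Option (Idx m p t) → RR K m
  | none => 1
  | some y => tt K (fun j => (y.1 j : ℕ) + 1) (fun j => (y.2 j).1)

/-- leading monomials -/
def ex [NeZero t] : Option (Idx m p t) → (Fin t → Dg m p)
  | none => ez m p t
  | some y => fun j => lead (y.2 j).1

lemma rd_ez : rd K (ez m p t) = 1 := by
  rw [rd_eq]
  refine Finset.prod_eq_one fun j _ => ?_
  have : (mo (fun i => ((ez m p t j).1 i : ℕ)) (fun i => ((ez m p t j).2 i : ℕ)) : RR K m) = mo 0 0 := rfl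
  rw [this, mo_zero, one_pow]

lemma one_coord [NeZero t] (hK : Fintype.card K = p ^ t) (e : Fin t → Dg m p) :
    (rdB (K := K) hK).repr (1 : RR K m) e = if ez m p t = e then 1 else 0 := by
  rw [← rd_ez (p := p) (t := t), ← rdB_apply hK, Module.Basis.repr_self, Finsupp.single_apply]

lemma dwt_ez (j : Fin t) : dwt (ez m p t j) = 0 := by simp [dwt, ez]

lemma ex_some_type [NeZero t] (y : Idx m p t) (j : Fin t) :
    dwt (ex (some y) j) + ((y.1 j : ℕ) + 1) = p * ((y.1 (j + 1) : ℕ) + 1) := (y.2 j).2.1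

lemma ex_ne_ez [NeZero t] (y : Idx m p t) (h : ∀ j, dwt (ex (some y) j) = 0) : False := by
  have := type_unique (Fact.out : p.Prime).two_le (fun j => ex_some_type y j) (s' := fun _ => 0) (by simp [h])
  have := congrFun this 0
  simp at this

lemma dcf_self_ne (hp3 : 3 ≤ p) {A B : ℕ} (x : Dg m p) : dcf (epsl K m A B) x (lead x) ≠ 0 := by
  have hpf : ∀ a : Fin m → Fin p, pf K (fun i => (a i : ℕ)) ≠ 0 := fun a =>
    pf_ne (p := p) fun i => by have := (a i).2; omega
  unfold dcf
  rw [if_pos rfl]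
  split_ifs with h
  · have h1 := lead_inj h
    have h2 : x.2 = x.1 := congrArg Prod.fst h1.symm
    rw [h2]
    by_cases h3 : A = m ∧ B = m
    · simp only [epsl, if_pos h3, one_mul]
      rw [← two_mul]
      refine mul_ne_zero ?_ (inv_ne_zero (hpf _))
      have := cast_ne_zero_of_lt (K := K) (p := p) (n := 2) (by omega) (by omega)
      exact_mod_cast this
    · simp only [epsl, if_neg h3, zero_mul, add_zero]
      exact inv_ne_zero (hpf _)
  · rw [add_zero]; exact inv_ne_zero (hpf _)

lemma vec_coord [NeZero t] (hK : Fintype.card K = p ^ t) (hp3 : 3 ≤ p) (x y : Option (Idx m p t)) :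
    (rdB (K := K) hK).repr (vec K y) (ex x) ≠ 0 ↔ x = y := by
  have hp2 := (Fact.out : p.Prime).two_le
  constructor
  · intro h
    cases y with
    | none =>
      cases x with
      | none => rfl
      | some x =>
        exfalso
        simp only [vec] at h
        rw [one_coord] at h
        have h1 : ez m p t = ex (some x) := by
          by_contra hne; rw [if_neg hne] at h; exact h rfl
        exact ex_ne_ez x (fun j => by rw [← h1, dwt_ez])
    | some y =>
      simp only [vec] at h
      rw [tt_coord, Finset.prod_ne_zero_iff] at h
      have hd : ∀ j, dcf (epsl K m ((y.1 j : ℕ) + 1) ((y.1 (j + 1) : ℕ) + 1)) (y.2 j).1 (ex x j) ≠ 0 :=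
        fun j => (pow_ne_zero_iff (pow_pos (by omega : 0 < p) _).ne').1 (h j (Finset.mem_univ _))
      have h1 := fun j => dcf_dwt (y.2 j).2.1 (hd j)
      cases x with
      | none =>
        exfalso
        have := type_unique hp2 (fun j => (h1 j).1) (s' := fun _ => 0) (by simp [ex, dwt_ez])
        have := congrFun this 0
        simp at this
      | some x =>
        obtain ⟨s, x⟩ := x
        obtain ⟨s', y⟩ := y
        have hss := type_unique hp2 (fun j => (h1 j).1) (s' := fun j => (s j : ℕ) + 1)
          (fun j => ex_some_type ⟨s, x⟩ j)
        have hss' : s = s' := by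
          funext j
          have := congrFun hss j
          dsimp only at this
          exact Fin.ext (by omega)
        subst hss'
        congr 2
        funext j
        apply Subtype.ext
        rcases (h1 j).2 with h2 | ⟨h2, h3⟩
        · exact lead_inj h2
        · have h4 : (x j).1 = (y j).1.swap := lead_inj h3
          have h5 := (x j).2.2 h2
          have h6 := (y j).2.2 h2
          rw [h4] at h5 ⊢
          have h7 : (y j).1.1 = (y j).1.2 := (Fintype.equivFin (Fin m → Fin p)).injective (le_antisymm h6 h5)
          exact Prod.ext h7.symm h7
  · rintro rfl
    cases x with
    | none => simp only [vec]; rw [one_coord]; simp [ex]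
    | some x =>
      simp only [vec]
      rw [tt_coord]
      exact Finset.prod_ne_zero_iff.2 fun j _ => pow_ne_zero _ (dcf_self_ne hp3 _)

lemma sum_vec_coord [NeZero t] (hK : Fintype.card K = p ^ t) (hp3 : 3 ≤ p)
    (c : Option (Idx m p t) → K) (x : Option (Idx m p t)) :
    (rdB (K := K) hK).repr (∑ y, c y • vec K y) (ex x) =
      c x * (rdB (K := K) hK).repr (vec K x) (ex x) := by
  rw [map_sum, Finsupp.finset_sum_apply, Finset.sum_eq_single x]
  · simp
  · intro y _ hy
    rw [map_smul, Finsupp.smul_apply, smul_eq_mul]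
    have := (vec_coord (K := K) hK hp3 x y).not.2 (Ne.symm hy)
    push Not at this
    rw [this, mul_zero]
  · simp

lemma vec_indep [NeZero t] (hK : Fintype.card K = p ^ t) (hp3 : 3 ≤ p) :
    LinearIndependent K (vec K : Option (Idx m p t) → RR K m) := by
  rw [Fintype.linearIndependent_iff]
  intro c hc x
  have h := sum_vec_coord hK hp3 c x
  rw [hc] at h
  have h2 := (vec_coord (K := K) hK hp3 x x).2 rfl
  simp only [map_zero, Finsupp.coe_zero, Pi.zero_apply] at h
  rcases mul_eq_zero.1 h.symm with h | h
  · exact h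
  · exact absurd h h2

lemma TT_le_vec [NeZero t] (hm : 1 ≤ m) :
    TT K m p t ≤ Submodule.span K (Set.range (vec K : Option (Idx m p t) → RR K m)) := by
  refine Submodule.span_le.2 ?_
  rintro f (hf | ⟨s, a, α, h1, h2, hD, rfl⟩)
  · rw [Set.mem_singleton_iff] at hf
    exact Submodule.subset_span ⟨none, hf.symm⟩
  have hpp := (Fact.out : p.Prime).pos
  let x0 : Fin t → Dg m p := fun j => (fun i => ⟨a j i, by have := (hD j).1 i; omega⟩,
    fun i => ⟨α j i, by have := (hD j).2.1 i; omega⟩)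
  have hx0 : ∀ j, dwt (lead (x0 j)) + s j = p * s (j + 1) := fun j => by
    rw [dwt_lead]; exact (hD j).2.2
  let s' : Fin t → Fin m := fun j => ⟨s j - 1, by have := h1 j; have := h2 j; omega⟩
  have hs' : ∀ j, (s' j : ℕ) + 1 = s j := fun j => by
    have := h1 j
    change s j - 1 + 1 = s j
    omega
  have hex : ∀ j, ∃ x : Dg m p, QP m p (s j) (s (j + 1)) x ∧
      psi p (epsl K m (s j) (s (j + 1))) (fun i => (x.1 i : ℕ)) (fun i => (x.2 i : ℕ)) =
      psi p (epsl K m (s j) (s (j + 1))) (a j) (α j) := by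
    intro j
    by_cases hh : s j = m ∧ s (j + 1) = m
    · rcases le_total (Fintype.equivFin (Fin m → Fin p) (x0 j).1) (Fintype.equivFin (Fin m → Fin p) (x0 j).2) with hle | hle
      · exact ⟨x0 j, ⟨hx0 j, fun _ => hle⟩, rfl⟩
      · refine ⟨(x0 j).swap, ⟨?_, fun _ => hle⟩, ?_⟩
        · have hst := (hD j).hst (K := K)
          obtain ⟨g1, g2, g3⟩ := hst
          rcases g3 with g3 | g3
          · simp [epsl, hh] at g3
          · rw [← hx0 j, dwt_lead, dwt_lead]
            congr 1
            exact ldeg_swap g1 g2 g3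
        · simp only [epsl, if_pos hh, psi, one_smul]
          rw [add_comm]
          rfl
    · exact ⟨x0 j, ⟨hx0 j, fun h => absurd h hh⟩, rfl⟩
  choose x hx hx2 using hex
  refine Submodule.subset_span ⟨some ⟨s', fun j => ⟨x j, by rw [hs', hs']; exact hx j⟩⟩, ?_⟩
  simp only [vec, tt, Ctx.tot, tctx, hs', hx2]

lemma vec_mem_UU [NeZero t] (hK : Fintype.card K = p ^ t) (hp3 : 3 ≤ p) (hm : 2 ≤ m)
    (y : Option (Idx m p t)) : vec K y ∈ UU K m := by
  induction hn : ∑ j, dwt (ex y j) using Nat.strong_induction_on generalizing y with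
  | _ w ih =>
  cases y with
  | none => exact one_mem_UU
  | some y =>
    have hl := lead_mem hK hp3 hm (K := K) (fun j => (y.1 j : ℕ) + 1) (fun j => by omega)
      (fun j => (y.1 j).2) (a := fun j i => (((y.2 j).1.1 i : Fin p) : ℕ)) (α := fun j i => (((y.2 j).1.2 i : Fin p) : ℕ))
      (fun j => QP.dst (y.2 j).2.1)
    obtain ⟨u, hu, n, hn2, hun⟩ := Submodule.mem_sup.1 hl
    have hw : Ctx.w (tctx K (fun j => (y.1 j : ℕ) + 1) (fun j i => (((y.2 j).1.1 i : Fin p) : ℕ))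
        (fun j i => (((y.2 j).1.2 i : Fin p) : ℕ))) p = w := by
      rw [← hn]
      unfold Ctx.w
      refine Finset.sum_congr rfl fun j _ => ?_
      simp only [tctx, ex]
      rw [dwt_lead]
    rw [hw] at hn2
    have hv : vec K (some y) = u + n := hun.symm
    have hnS : n ∈ Submodule.span K (Set.range (vec K : Option (Idx m p t) → RR K m)) := by
      have : n = vec K (some y) - u := by rw [hv]; ring
      rw [this]
      exact Submodule.sub_mem _ (Submodule.subset_span ⟨_, rfl⟩)
        (TT_le_vec (by omega) (UU_le_TT hK hp3 (by omega) hu))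
    obtain ⟨c, hc⟩ := (Submodule.mem_span_range_iff_exists_fun K).1 hnS
    rw [hv]
    refine Submodule.add_mem _ hu ?_
    rw [← hc]
    refine Submodule.sum_mem _ fun z _ => ?_
    by_cases hz : ∑ j, dwt (ex z j) < w
    · exact Submodule.smul_mem _ _ (ih _ hz z rfl)
    · have h1 := sum_vec_coord hK hp3 c z
      rw [hc, NN_coord hK hn2 _ (by omega)] at h1
      rcases mul_eq_zero.1 h1.symm with h | h
      · rw [h, zero_smul]; exact Submodule.zero_mem _
      · exact absurd h ((vec_coord (K := K) hK hp3 z z).2 rfl)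

theorem finrank_UU [NeZero t] (hK : Fintype.card K = p ^ t) (hp3 : 3 ≤ p) (hm : 2 ≤ m) :
    Module.finrank K (UU K m) = 1 + ∑ s : Fin t → Fin m,
      ∏ j, Fintype.card {x : Dg m p // QP m p ((s j : ℕ) + 1) ((s (j + 1) : ℕ) + 1) x} := by
  have h : UU K m = Submodule.span K (Set.range (vec K : Option (Idx m p t) → RR K m)) := by
    apply le_antisymm
    · exact (UU_le_TT hK hp3 (by omega)).trans (TT_le_vec (by omega))
    · refine Submodule.span_le.2 ?_
      rintro _ ⟨y, rfl⟩
      exact vec_mem_UU hK hp3 hm y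
  rw [h, finrank_span_eq_card (vec_indep hK hp3), Fintype.card_option, Fintype.card_sigma, add_comm]
  congr 1
  refine Finset.sum_congr rfl fun s _ => ?_
  rw [Fintype.card_pi]

end sixteen
end PR

/-! ### Part 17 : counting digit states -/
namespace PR
set_option linter.unusedVariables false
set_option linter.unusedSectionVars false

/-- digits as tuples -/
def dgEquiv (m p : ℕ) : (Fin (2 * m) → Fin p) ≃ Dg m p :=
  (Equiv.arrowCongr ((finCongr (two_mul m)).trans finSumFinEquiv.symm) (Equiv.refl _)).trans
    (Equiv.sumArrowEquivProdArrow _ _ _)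

lemma dgEquiv_sum (m p : ℕ) (c : Fin (2 * m) → Fin p) :
    ∑ i, (c i : ℕ) = dwt (dgEquiv m p c) := by
  unfold dwt
  rw [Finset.sum_add_distrib]
  have h := Fintype.sum_equiv ((finCongr (two_mul m)).trans finSumFinEquiv.symm)
    (fun i => (c i : ℕ)) (fun y => (c (((finCongr (two_mul m)).trans finSumFinEquiv.symm).symm y) : ℕ))
    (fun i => by rw [Equiv.symm_apply_apply])
  rw [h, Fintype.sum_sum_type]
  rfl

/-- leading digits as an equivalence -/
def leadEquiv (m p : ℕ) : Dg m p ≃ Dg m p :=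
  Equiv.prodCongr (Equiv.refl _) (Equiv.arrowCongr (Equiv.refl _) Fin.revPerm)

lemma leadEquiv_apply (m p : ℕ) (x : Dg m p) : leadEquiv m p x = lead x := rfl

lemma card_deg (m p : ℕ) (A B : ℕ) :
    Fintype.card {x : Dg m p // dwt (lead x) + A = p * B} = 
      (Finset.univ.filter (fun c : Fin (2 * m) → Fin p => (∑ i, (c i : ℤ)) = (p : ℤ) * B - A)).card := by
  rw [← Fintype.card_subtype]
  refine Fintype.card_congr (Equiv.symm (Equiv.subtypeEquiv ((dgEquiv m p).trans (leadEquiv m p).symm) ?_))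
  intro c
  have h1 : lead (((dgEquiv m p).trans (leadEquiv m p).symm) c) = dgEquiv m p c := by
    rw [← leadEquiv_apply, Equiv.trans_apply, Equiv.apply_symm_apply]
  rw [h1, ← dgEquiv_sum]
  constructor
  · intro h
    zify
    linarith
  · intro h
    zify at h
    linarith

lemma dwt_lead_mm {m p : ℕ} [Fact p.Prime] (hp : 0 < p) (x : Dg m p) :
    dwt (lead x) + m = p * m ↔ ∑ i, (x.1 i : ℕ) = ∑ i, (x.2 i : ℕ) := by
  have h := ldeg_eq (p := p) (a := fun i => (x.1 i : ℕ)) (α := fun i => (x.2 i : ℕ))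
    (fun i => by have := (x.2 i).2; omega)
  rw [← dwt_lead] at h
  zify
  push_cast [Nat.cast_sub (show 1 ≤ p from hp)] at h
  rw [h]
  constructor
  · intro h; linarith
  · intro h; rw [h]; ring

lemma card_mm {m p : ℕ} [Fact p.Prime] (hp : 0 < p) :
    2 * Fintype.card {x : Dg m p // QP m p m m x} =
      Fintype.card {x : Dg m p // dwt (lead x) + m = p * m} + p ^ m := by
  simp only [Fintype.card_subtype]
  set f := Fintype.equivFin (Fin m → Fin p) with hf
  have e1 : (Finset.univ.filter fun x : Dg m p => QP m p m m x) =
      Finset.univ.filter fun x : Dg m p => dwt (lead x) + m = p * m ∧ f x.1 ≤ f x.2 := by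
    ext x; simp [QP, hf]
  have e2 : (Finset.univ.filter fun x : Dg m p => dwt (lead x) + m = p * m ∧ f x.1 ≤ f x.2).card =
      (Finset.univ.filter fun x : Dg m p => dwt (lead x) + m = p * m ∧ f x.2 ≤ f x.1).card := by
    refine Finset.card_equiv (Equiv.prodComm _ _) ?_
    intro x
    simp only [Finset.mem_filter, Finset.mem_univ, true_and, dwt_lead_mm hp, Equiv.prodComm_apply,
      Prod.fst_swap, Prod.snd_swap]
    exact and_congr_left fun _ => eq_comm
  have e3 : (Finset.univ.filter fun x : Dg m p => dwt (lead x) + m = p * m ∧ f x.1 ≤ f x.2) ∪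
      (Finset.univ.filter fun x : Dg m p => dwt (lead x) + m = p * m ∧ f x.2 ≤ f x.1) =
      Finset.univ.filter fun x : Dg m p => dwt (lead x) + m = p * m := by
    ext x
    simp only [Finset.mem_union, Finset.mem_filter, Finset.mem_univ, true_and]
    have := le_total (f x.1) (f x.2)
    tauto
  have e4 : (Finset.univ.filter fun x : Dg m p => dwt (lead x) + m = p * m ∧ f x.1 ≤ f x.2) ∩
      (Finset.univ.filter fun x : Dg m p => dwt (lead x) + m = p * m ∧ f x.2 ≤ f x.1) =
      Finset.univ.image (fun a : Fin m → Fin p => ((a, a) : Dg m p)) := by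
    ext x
    simp only [Finset.mem_inter, Finset.mem_filter, Finset.mem_univ, true_and, Finset.mem_image]
    constructor
    · rintro ⟨⟨_, h1⟩, _, h2⟩
      have h3 : x.1 = x.2 := f.injective (le_antisymm h1 h2)
      exact ⟨x.1, Prod.ext rfl h3⟩
    · rintro ⟨a, rfl⟩
      have : dwt (lead ((a, a) : Dg m p)) + m = p * m := (dwt_lead_mm hp _).2 rfl
      exact ⟨⟨this, le_rfl⟩, this, le_rfl⟩
  have e5 := Finset.card_union_add_card_inter
    (Finset.univ.filter fun x : Dg m p => dwt (lead x) + m = p * m ∧ f x.1 ≤ f x.2)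
    (Finset.univ.filter fun x : Dg m p => dwt (lead x) + m = p * m ∧ f x.2 ≤ f x.1)
  rw [e3, e4, ← e2, Finset.card_image_of_injective _ (fun a b h => congrArg Prod.fst h)] at e5
  simp only [Finset.card_univ, Fintype.card_pi, Fintype.card_fin, Finset.prod_const] at e5
  rw [e1]
  omega

end PR

/-! ### Part 18 : the rank -/
namespace PR
set_option linter.unusedVariables false
set_option linter.unusedSectionVars false

lemma finrank_span_ext {F L I J : Type*} [Field F] [Field L] [Algebra F L] [Fintype I] [Fintype J]
    (r : I → J → F) : Module.finrank F (Submodule.span F (Set.range r)) =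
      Module.finrank L (Submodule.span L (Set.range fun i => (algebraMap F L) ∘ r i)) := by
  obtain ⟨κ, a, ha, hspan, hli⟩ := exists_linearIndependent' F r
  haveI : Finite κ := Finite.of_injective a ha
  haveI : Fintype κ := Fintype.ofFinite κ
  have hli2 : LinearIndependent L (fun k => (algebraMap F L) ∘ (r ∘ a) k) :=
    linearIndependent_algebraMap_comp_iff.2 hli
  have hs : Submodule.span L (Set.range fun k => (algebraMap F L) ∘ (r ∘ a) k) =
      Submodule.span L (Set.range fun i => (algebraMap F L) ∘ r i) := by
    apply le_antisymm
    · refine Submodule.span_mono ?_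
      rintro _ ⟨k, rfl⟩
      exact ⟨a k, rfl⟩
    · refine Submodule.span_le.2 ?_
      rintro _ ⟨i, rfl⟩
      have h1 : r i ∈ Submodule.span F (Set.range (r ∘ a)) := by
        rw [hspan]; exact Submodule.subset_span ⟨i, rfl⟩
      obtain ⟨c, hc⟩ := (Submodule.mem_span_range_iff_exists_fun F).1 h1
      rw [SetLike.mem_coe]
      dsimp only
      rw [← hc]
      have : (algebraMap F L) ∘ (∑ k, c k • (r ∘ a) k) =
          ∑ k, (algebraMap F L (c k)) • ((algebraMap F L) ∘ (r ∘ a) k) := by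
        funext x
        simp [Finset.sum_apply, Algebra.smul_def]
      rw [this]
      exact Submodule.sum_mem _ fun k _ => Submodule.smul_mem _ _ (Submodule.subset_span ⟨k, rfl⟩)
  rw [← hs, ← hspan, finrank_span_eq_card hli, finrank_span_eq_card hli2]

section eighteen
variable {K : Type*} [Field K] [Fintype K] {m : ℕ} {p : ℕ} [Fact p.Prime] [CharP K p] {t : ℕ}

lemma UU_scalar {f : RR K m} (hf : f ∈ UU K m) (c : K) (hc : c ≠ 0) (v : VV K m) : f (c • v) = f v := by
  unfold UU at hf
  induction hf using Submodule.span_induction with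
  | mem x hx =>
    obtain ⟨W, -, rfl⟩ := hx
    simp only [chi, Submodule.smul_mem_iff W hc]
  | zero => rfl
  | add x y _ _ hx hy => rw [Pi.add_apply, Pi.add_apply, hx, hy]
  | smul d x _ hx => rw [Pi.smul_apply, Pi.smul_apply, hx]

lemma UU_sum (hm : 1 ≤ m) {f : RR K m} (hf : f ∈ UU K m) : ∑ v, f v = 0 := by
  unfold UU at hf
  induction hf using Submodule.span_induction with
  | mem x hx =>
    obtain ⟨W, hW, rfl⟩ := hx
    simp only [chi]
    rw [Finset.sum_boole, ← Fintype.card_subtype]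
    have h1 : Fintype.card {x // x ∈ W} = Fintype.card K ^ m := by
      have := Module.card_eq_pow_finrank (K := K) (V := W)
      rw [hW.2] at this
      convert this
    rw [h1, Nat.cast_pow, FiniteField.cast_card_eq_zero, zero_pow (by omega)]
  | zero => simp
  | add x y _ _ hx hy => simp only [Pi.add_apply, Finset.sum_add_distrib, hx, hy, add_zero]
  | smul d x _ hx => simp only [Pi.smul_apply, smul_eq_mul, ← Finset.mul_sum, hx, mul_zero]

end eighteen

theorem rank_eq (p t m : ℕ) [Fact p.Prime] [Fintype (GaloisField p t)] (hm : 1 ≤ m) :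
    (incMat p t m m).rank = Module.finrank (GaloisField p t) (UU (GaloisField p t) m) := by
  have hz : ∀ Z : Pts p t m, ∃ z : SympV p t m, z ≠ 0 ∧ Z.1 = Submodule.span (GaloisField p t) {z} := by
    intro Z
    obtain ⟨z, hz0, hz⟩ := finrank_eq_one_iff'.1 Z.2
    refine ⟨z.1, fun h => hz0 (Subtype.ext h), ?_⟩
    apply le_antisymm
    · intro w hw
      obtain ⟨c, hc⟩ := hz ⟨w, hw⟩
      exact Submodule.mem_span_singleton.2 ⟨c, congrArg Subtype.val hc⟩
    · rw [Submodule.span_singleton_le_iff_mem]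
      exact z.2
  choose z hz0 hz using hz
  let ρ : RR (GaloisField p t) m →ₗ[GaloisField p t] (Pts p t m → GaloisField p t) :=
    LinearMap.funLeft (GaloisField p t) (GaloisField p t) z
  have hρ : ∀ f Z, ρ f Z = f (z Z) := fun f Z => rfl
  have hinj : Function.Injective (ρ.domRestrict (UU (GaloisField p t) m)) := by
    rw [← LinearMap.ker_eq_bot, LinearMap.ker_eq_bot']
    rintro ⟨f, hf⟩ h
    have h1 : ∀ Z, f (z Z) = 0 := fun Z => congrFun h Z
    have h2 : ∀ v : SympV p t m, v ≠ 0 → f v = 0 := by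
      intro v hv
      have hv1 : v ∈ Submodule.span (GaloisField p t) {v} := Submodule.mem_span_singleton_self v
      have h3 := hz ⟨Submodule.span (GaloisField p t) {v}, finrank_span_singleton hv⟩
      dsimp only at h3
      rw [h3] at hv1
      obtain ⟨c, hc⟩ := Submodule.mem_span_singleton.1 hv1
      have hc0 : c ≠ 0 := by
        rintro rfl
        rw [zero_smul] at hc
        exact hv hc.symm
      rw [← hc, UU_scalar hf c hc0, h1]
    have h4 := UU_sum hm hf
    rw [Finset.sum_eq_single 0 (fun v _ hv => h2 v hv) (by simp)] at h4
    apply Subtype.ext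
    funext v
    by_cases hv : v = 0
    · rw [hv]; exact h4
    · exact h2 v hv
  rw [← LinearMap.finrank_range_of_inj hinj, LinearMap.range_domRestrict,
    Matrix.rank_eq_finrank_span_row, finrank_span_ext (L := GaloisField p t)]
  have : Submodule.span (GaloisField p t)
      (Set.range fun i => (algebraMap (ZMod p) (GaloisField p t)) ∘ (incMat p t m m).row i) =
      (UU (GaloisField p t) m).map ρ := by
    unfold UU
    rw [Submodule.map_span]
    have hrow : ∀ W : IsoFlats p t m m, (algebraMap (ZMod p) (GaloisField p t)) ∘ (incMat p t m m).row W =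
        ρ (chi W.1) := by
      intro W
      funext Z
      rw [hρ]
      simp only [Function.comp_apply, Matrix.row, incMat, chi]
      have : Z.1 ≤ W.1 ↔ z Z ∈ W.1 := by
        rw [hz Z, Submodule.span_singleton_le_iff_mem]
      by_cases h : z Z ∈ W.1
      · rw [if_pos (this.2 h), if_pos h, map_one]
      · rw [if_neg (fun h' => h (this.1 h')), if_neg h, map_zero]
    congr 1
    ext f
    constructor
    · rintro ⟨W, rfl⟩
      exact ⟨chi W.1, ⟨W.1, W.2, rfl⟩, (hrow W).symm⟩
    · rintro ⟨_, ⟨W, hW, rfl⟩, rfl⟩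
      exact ⟨⟨W, hW⟩, hrow _⟩
  rw [this]

end PR

/-- Proposition (summation formula): for `p` odd, the `p`-rank of the incidence matrix
between points and `m`-flats of `W(2m−1,p^t)` equals
`1 + Σ_{s : {0,…,t−1} → {1,…,m}} Π_{j} d_{(s_j, s_{j+1})}`, indices mod `t`. -/
theorem prank_summation (p t m : ℕ) [Fact p.Prime] [NeZero t]
    (hodd : Odd p) (ht : 1 ≤ t) (hm : 2 ≤ m) :
    ((incMat p t m m).rank : ℚ) =
      1 + ∑ s : Fin t → Fin m, ∏ j : Fin t,
            dpair p m ((s j : ℕ) + 1) ((s (j + 1) : ℕ) + 1) := by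
  have hpp := (Fact.out : p.Prime)
  have hp3 : 3 ≤ p := by
    have := hpp.two_le
    obtain ⟨k, hk⟩ := hodd
    omega
  letI : Fintype (GaloisField p t) := Fintype.ofFinite _
  have hK : Fintype.card (GaloisField p t) = p ^ t := by
    rw [← Nat.card_eq_fintype_card]
    exact GaloisField.card p t (by omega)
  rw [PR.rank_eq p t m (by omega), PR.finrank_UU (t := t) (p := p) hK hp3 hm]
  push_cast
  congr 1
  refine Finset.sum_congr rfl fun s _ => Finset.prod_congr rfl fun j _ => ?_
  unfold dpair
  split_ifs with h
  · rw [h.1, h.2, eq_div_iff two_ne_zero, mul_comm]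
    have h1 := PR.card_mm (m := m) hpp.pos
    rw [PR.card_deg] at h1
    have h2 : dlam p m (m * (p - 1)) = (Finset.univ.filter (fun c : Fin (2 * m) → Fin p =>
        (∑ i, (c i : ℤ)) = (p : ℤ) * m - m)).card := by
      unfold dlam
      rw [show (m : ℤ) * (p - 1) = (p : ℤ) * m - m by ring]
    rw [h2]
    exact_mod_cast h1
  · unfold dlam
    rw [← PR.card_deg]
    congr 1
    refine Fintype.card_congr (Equiv.subtypeEquivRight fun x => ?_)
    exact ⟨fun hx => hx.1, fun hx => ⟨hx, fun h' => absurd h' h⟩⟩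

end
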